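/- Let c be a real number with 1 < c < 39/29 and c ∉ ℕ. Then for every sufficiently small η > 0 there exist constants c₀ > 0 and R₀ > 0 such that for all R ≥ R₀, the number 𝒜₄(R) of ordered quadruples (p₁, p₂, p₃, p₄) of primes with X/8 < pⱼ ≤ X (j = 1,…,4), where X = R^{1/c}, satisfying |p₁^c + p₂^c + p₃^c + p₄^c − R| < R^{−η}, is at least c₀ · R^{4/c − 1 − η}/(log R)⁴. -/

import Mathlib

open Real MeasureTheory

/-- `countSol c η R s` is the number of ordered `s`-tuples of primes `p₁, …, pₛ` with
`X/8 < pⱼ ≤ X` (where `X = R^{1/c}`) and `|p₁^c + ⋯ + pₛ^c − R| < R^{−η}`. -/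
noncomputable def countSol (c η R : ℝ) (s : ℕ) : ℕ :=
  Nat.card {p : Fin s → ℕ //
    (∀ j, (p j).Prime ∧ R ^ (1/c) / 8 < (p j : ℝ) ∧ (p j : ℝ) ≤ R ^ (1/c)) ∧
    |(∑ j, (p j : ℝ) ^ c) - R| < R ^ (-η)}

namespace PrimePowerSums

/-- The additive character `t ↦ exp(2πit)`. -/
noncomputable def expi (t : ℝ) : ℂ := Complex.exp ((2 * π * t : ℝ) * Complex.I)

lemma norm_expi (t : ℝ) : ‖expi t‖ = 1 := Complex.norm_exp_ofReal_mul_I _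

lemma expi_add (s t : ℝ) : expi (s + t) = expi s * expi t := by
  unfold expi
  rw [← Complex.exp_add]
  congr 1
  push_cast
  ring

lemma expi_neg (t : ℝ) : expi (-t) = (starRingEnd ℂ) (expi t) := by
  unfold expi
  rw [← Complex.exp_conj]
  congr 1
  rw [map_mul, Complex.conj_ofReal, Complex.conj_I]
  push_cast
  ring

lemma expi_int (k : ℤ) : expi k = 1 := by
  unfold expi
  rw [Complex.exp_eq_one_iff]
  exact ⟨k, by push_cast; ring⟩

lemma expi_sub_int (t : ℝ) (k : ℤ) : expi (t - k) = expi t := by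
  have := expi_add (t - k) k
  rw [expi_int, mul_one, sub_add_cancel] at this
  exact this.symm

lemma continuous_expi : Continuous expi := by
  unfold expi
  fun_prop

lemma norm_sum_expi_neg {ι : Type*} (s : Finset ι) (f : ι → ℝ) :
    ‖∑ n ∈ s, expi (-f n)‖ = ‖∑ n ∈ s, expi (f n)‖ := by
  simp_rw [expi_neg]
  rw [← map_sum, RCLike.norm_conj]

/-- `1 / (1 - e(t)) = 1/2 + (i/2) cot(πt)`. -/
noncomputable def cotCoeff (t : ℝ) : ℂ :=
  1 / 2 + ((cos (π * t) / sin (π * t) / 2 : ℝ) : ℂ) * Complex.I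

lemma cotCoeff_mul {t : ℝ} (ht : sin (π * t) ≠ 0) : cotCoeff t * (1 - expi t) = 1 := by
  have h1 : expi t = ((1 - 2 * sin (π * t) ^ 2 : ℝ) : ℂ)
      + ((2 * sin (π * t) * cos (π * t) : ℝ) : ℂ) * Complex.I := by
    unfold expi
    rw [Complex.exp_mul_I, ← Complex.ofReal_cos, ← Complex.ofReal_sin]
    have : 2 * π * t = 2 * (π * t) := by ring
    rw [this, cos_two_mul, sin_two_mul]
    have := sin_sq_add_cos_sq (π * t)
    congr 2
    norm_cast
    linarith
  have h2 := sin_sq_add_cos_sq (π * t)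
  rw [h1]
  unfold cotCoeff
  generalize sin (π * t) = u at *
  generalize cos (π * t) = v at *
  have hu : (u : ℂ) ≠ 0 := by exact_mod_cast ht
  have h2' : (u : ℂ) ^ 2 + (v : ℂ) ^ 2 = 1 := by exact_mod_cast h2
  push_cast
  field_simp
  linear_combination 2 * u * h2' - 2 * u * v ^ 2 * Complex.I_sq

lemma two_mul_le_sin {θ t : ℝ} (h0 : 0 < θ) (h1 : θ ≤ t) (h2 : t ≤ 1 - θ) :
    2 * θ ≤ sin (π * t) := by
  have hpi := pi_pos
  rcases le_total t (1/2) with h | h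
  · have := mul_le_sin (x := π * t) (by nlinarith) (by nlinarith)
    have e : 2 / π * (π * t) = 2 * t := by field_simp
    rw [e] at this
    linarith
  · have := mul_le_sin (x := π * (1 - t)) (by nlinarith) (by nlinarith)
    have e : 2 / π * (π * (1 - t)) = 2 * (1 - t) := by field_simp
    rw [e] at this
    have e2 : π * (1 - t) = π - π * t := by ring
    rw [e2, sin_pi_sub] at this
    linarith

lemma abs_cot_le {θ t : ℝ} (h0 : 0 < θ) (h1 : θ ≤ t) (h2 : t ≤ 1 - θ) :
    |cos (π * t) / sin (π * t)| ≤ 1 / (2 * θ) := by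
  have := two_mul_le_sin h0 h1 h2
  rw [abs_div, abs_of_pos (a := sin (π * t)) (by linarith)]
  exact div_le_div₀ (by norm_num) (abs_cos_le_one _) (by linarith) this

lemma norm_cotCoeff_le {θ t : ℝ} (h0 : 0 < θ) (h1 : θ ≤ t) (h2 : t ≤ 1 - θ) :
    ‖cotCoeff t‖ ≤ 1 / (2 * θ) + 1 / (4 * θ) := by
  have h3 := abs_cot_le h0 h1 h2
  have h4 : (1:ℝ) / 2 ≤ 1 / (2 * θ) - 1 / (4 * θ) + 1 / (4 * θ) := by
    have : θ ≤ 1 := by linarith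
    have : 1 / (2 * 1) ≤ 1 / (2 * θ) := by gcongr
    linarith
  unfold cotCoeff
  refine (norm_add_le _ _).trans ?_
  rw [norm_mul, Complex.norm_I, mul_one, Complex.norm_real, Real.norm_eq_abs, abs_div]
  have e : 1 / (2 * θ) / 2 = 1 / (4 * θ) := by field_simp; norm_num
  norm_num at *
  linarith

lemma cot_antitone {s t : ℝ} (hs : 0 < s) (hst : s ≤ t) (ht : t < 1) :
    cos (π * t) / sin (π * t) ≤ cos (π * s) / sin (π * s) := by
  have hpi := pi_pos
  have s1 : 0 < sin (π * s) := sin_pos_of_pos_of_lt_pi (by positivity) (by nlinarith)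
  have s2 : 0 < sin (π * t) := sin_pos_of_pos_of_lt_pi (by nlinarith) (by nlinarith)
  rw [div_le_div_iff₀ s2 s1]
  have := sin_sub (π * t) (π * s)
  have h3 : 0 ≤ sin (π * t - π * s) := sin_nonneg_of_nonneg_of_le_pi (by nlinarith) (by nlinarith)
  nlinarith

/-- The Kusmin–Landau inequality, for sequences with monotone differences. -/
theorem kusmin_landau (f : ℕ → ℝ) (a b : ℕ) (θ : ℝ) (k : ℤ) (hθ : 0 < θ)
    (hg : ∀ n, a ≤ n → n < b → θ ≤ f (n + 1) - f n - k ∧ f (n + 1) - f n - k ≤ 1 - θ)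
    (hm : ∀ n, a ≤ n → n + 1 < b → f (n + 1) - f n ≤ f (n + 2) - f (n + 1)) :
    ‖∑ n ∈ Finset.Ico a b, expi (f n)‖ ≤ 3 / θ := by
  rcases le_or_gt b a with hab | hab
  · rw [Finset.Ico_eq_empty_of_le hab]
    simp
    positivity
  set g : ℕ → ℝ := fun n => f (n + 1) - f n - k with hgdef
  have hsin : ∀ n, a ≤ n → n < b → sin (π * g n) ≠ 0 := fun n h1 h2 => by
    have := two_mul_le_sin hθ (hg n h1 h2).1 (hg n h1 h2).2
    simp only [hgdef]
    linarith
  have hE : ∀ n, expi (f (n + 1)) = expi (f n) * expi (g n) := fun n => by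
    simp only [hgdef]
    rw [expi_sub_int, ← expi_add]
    congr 1
    ring
  have key : ∀ m, a ≤ m → m < b →
      ‖∑ n ∈ Finset.Ico a (m + 1), expi (f n) + cotCoeff (g m) * expi (f (m + 1))‖ ≤
      ‖cotCoeff (g a)‖ + (cos (π * g a) / sin (π * g a) - cos (π * g m) / sin (π * g m)) / 2 := by
    intro m hm1
    induction m, hm1 using Nat.le_induction with
    | base =>
      intro _
      rw [Finset.sum_Ico_succ_top le_rfl, Finset.Ico_self, Finset.sum_empty, zero_add, hE]
      have h := cotCoeff_mul (hsin a le_rfl hab)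
      have : expi (f a) + cotCoeff (g a) * (expi (f a) * expi (g a))
          = cotCoeff (g a) * expi (f a) := by linear_combination (-expi (f a)) * h
      rw [this, norm_mul, norm_expi]
      simp
    | succ m hm1 ih =>
      intro hmb
      have ih := ih (by omega)
      have h := cotCoeff_mul (hsin (m + 1) (by omega) hmb)
      rw [Finset.sum_Ico_succ_top (by omega), hE (m + 1)]
      have e1 : ∑ n ∈ Finset.Ico a (m + 1), expi (f n) + expi (f (m + 1))
          + cotCoeff (g (m + 1)) * (expi (f (m + 1)) * expi (g (m + 1)))
          = (∑ n ∈ Finset.Ico a (m + 1), expi (f n) + cotCoeff (g m) * expi (f (m + 1)))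
            + (cotCoeff (g (m + 1)) - cotCoeff (g m)) * expi (f (m + 1)) := by
        linear_combination (-expi (f (m + 1))) * h
      rw [e1]
      refine (norm_add_le _ _).trans ?_
      rw [norm_mul, norm_expi, mul_one]
      have hg1 := hg m hm1 (by omega)
      have hg2 := hg (m + 1) (by omega) hmb
      have hmono := hm m hm1 hmb
      have hc := cot_antitone (s := g m) (t := g (m + 1)) (by simp only [hgdef]; linarith)
        (by simp only [hgdef]; linarith) (by simp only [hgdef]; linarith)
      have e2 : ‖cotCoeff (g (m + 1)) - cotCoeff (g m)‖ =
          (cos (π * g m) / sin (π * g m) - cos (π * g (m+1)) / sin (π * g (m+1))) / 2 := by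
        have : cotCoeff (g (m + 1)) - cotCoeff (g m) =
          -(((cos (π * g m) / sin (π * g m) - cos (π * g (m+1)) / sin (π * g (m+1))) / 2 : ℝ) : ℂ)
            * Complex.I := by
          unfold cotCoeff
          push_cast
          ring
        rw [this, norm_mul, norm_neg, Complex.norm_I, mul_one, Complex.norm_real,
          Real.norm_eq_abs, abs_of_nonneg]
        linarith
      rw [e2]
      linarith
  obtain ⟨m, rfl⟩ : ∃ m, b = m + 1 := ⟨b - 1, by omega⟩
  have h := key m (by omega) (by omega)
  have ha := hg a le_rfl hab
  have hmm := hg m (by omega) (by omega)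
  have b1 := norm_cotCoeff_le hθ ha.1 ha.2
  have b2 := norm_cotCoeff_le hθ hmm.1 hmm.2
  have b3 := (abs_le.mp (abs_cot_le hθ ha.1 ha.2)).2
  have b4 := (abs_le.mp (abs_cot_le hθ hmm.1 hmm.2)).1
  have e1 : ∑ n ∈ Finset.Ico a (m + 1), expi (f n) =
      (∑ n ∈ Finset.Ico a (m + 1), expi (f n) + cotCoeff (g m) * expi (f (m + 1)))
      - cotCoeff (g m) * expi (f (m + 1)) := by ring
  rw [e1]
  refine (norm_sub_le _ _).trans ?_
  rw [norm_mul (cotCoeff (g m)), norm_expi, mul_one]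
  have e3 : 3 / θ = 6 * (1 / (2 * θ)) := by field_simp; norm_num
  have e4 : 1 / (4 * θ) = (1 / (2 * θ)) / 2 := by field_simp; norm_num
  have e5 : 0 < 1 / (2 * θ) := by positivity
  simp only [hgdef] at h b1 b2 b3 b4 ⊢
  linarith

lemma exists_Ico_of_ordConnected (S : Finset ℕ)
    (h : ∀ x ∈ S, ∀ z ∈ S, ∀ y, x ≤ y → y ≤ z → y ∈ S) : ∃ a b, S = Finset.Ico a b := by
  rcases S.eq_empty_or_nonempty with rfl | hne
  · exact ⟨0, 0, by simp⟩
  · refine ⟨S.min' hne, S.max' hne + 1, ?_⟩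
    ext y
    simp only [Finset.mem_Ico]
    constructor
    · exact fun hy => ⟨S.min'_le y hy, Nat.lt_succ_of_le (S.le_max' y hy)⟩
    · rintro ⟨h1, h2⟩
      exact h _ (S.min'_mem hne) _ (S.max'_mem hne) y h1 (Nat.le_of_lt_succ h2)

lemma mul_sub_le_of_step {g : ℕ → ℝ} {a b : ℕ} {l : ℝ}
    (h : ∀ n, a ≤ n → n + 1 < b → l ≤ g (n + 1) - g n) :
    ∀ m n, a ≤ m → m ≤ n → n < b → l * (n - m : ℝ) ≤ g n - g m := by
  intro m n hm hmn
  induction n, hmn using Nat.le_induction with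
  | base => simp
  | succ n hn ih =>
    intro hb
    have h1 := ih (by omega)
    have h2 := h n (by omega) hb
    push_cast
    linarith

lemma sub_le_mul_of_step {g : ℕ → ℝ} {a b : ℕ} {l : ℝ}
    (h : ∀ n, a ≤ n → n + 1 < b → g (n + 1) - g n ≤ l) :
    ∀ m n, a ≤ m → m ≤ n → n < b → g n - g m ≤ l * (n - m : ℝ) := by
  intro m n h1 h2 h3
  have := mul_sub_le_of_step (g := fun n => -g n) (a := a) (b := b) (l := -l)
    (fun n h4 h5 => by have := h n h4 h5; linarith) m n h1 h2 h3
  linarith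

lemma card_le_of_window {g : ℕ → ℝ} {a b : ℕ} {l Δ α : ℝ} (hl : 0 < l) (hΔ : 0 ≤ Δ)
    (h : ∀ n, a ≤ n → n + 1 < b → l ≤ g (n + 1) - g n) (S : Finset ℕ)
    (hS : ∀ n ∈ S, a ≤ n ∧ n < b ∧ α ≤ g n ∧ g n ≤ α + Δ) : (S.card : ℝ) ≤ Δ / l + 1 := by
  rcases S.eq_empty_or_nonempty with rfl | hne
  · simp
    positivity
  · have h1 : S ⊆ Finset.Icc (S.min' hne) (S.max' hne) := fun y hy =>
      Finset.mem_Icc.mpr ⟨S.min'_le y hy, S.le_max' y hy⟩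
    have h2 := Finset.card_le_card h1
    rw [Nat.card_Icc] at h2
    have hmm := S.min'_le _ (S.max'_mem hne)
    have h3 := mul_sub_le_of_step h _ _ (hS _ (S.min'_mem hne)).1 hmm (hS _ (S.max'_mem hne)).2.1
    have h4 := (hS _ (S.min'_mem hne)).2.2
    have h5 := (hS _ (S.max'_mem hne)).2.2
    have h6 : ((S.max' hne : ℝ) - S.min' hne) ≤ Δ / l := by
      rw [le_div_iff₀ hl]
      linarith
    have h7 : (S.card : ℝ) + S.min' hne ≤ S.max' hne + 1 := by
      norm_cast
      omega
    linarith

/-- The van der Corput second derivative test, for sequences. -/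
theorem second_difference_test (f : ℕ → ℝ) (a b : ℕ) (l C : ℝ) (hl : 0 < l)
    (hC : 0 ≤ C)
    (h1 : ∀ n, a ≤ n → n + 1 < b → l ≤ (f (n + 2) - f (n + 1)) - (f (n + 1) - f n))
    (h2 : ∀ n, a ≤ n → n + 1 < b → (f (n + 2) - f (n + 1)) - (f (n + 1) - f n) ≤ C * l) :
    ‖∑ n ∈ Finset.Ico a b, expi (f n)‖ ≤ 7 / √l * (C * l * (b - a : ℕ) + 2) + (b - a : ℕ) * √l * 2 := by
  have hsl : 0 < √l := sqrt_pos.mpr hl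
  have hsq : √l * √l = l := mul_self_sqrt hl.le
  have triv : ∀ S : Finset ℕ, ‖∑ n ∈ S, expi (f n)‖ ≤ S.card := fun S => by
    refine (norm_sum_le _ _).trans ?_
    simp [norm_expi]
  have pos1 : 0 ≤ 7 / √l * (C * l * (b - a : ℕ) + 2) := by positivity
  rcases lt_or_ge (1/2) (√l) with hbig | hsmall
  · refine (triv _).trans ?_
    rw [Nat.card_Ico]
    have : (0:ℝ) ≤ (b - a : ℕ) := by positivity
    nlinarith
  rcases le_or_gt b a with hab | hab
  · rw [Finset.Ico_eq_empty_of_le hab]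
    simp only [Finset.sum_empty, norm_zero]
    positivity
  set g : ℕ → ℝ := fun n => f (n + 1) - f n with hg
  have hstep : ∀ n, a ≤ n → n + 1 < b → l ≤ g (n + 1) - g n := h1
  have hstep2 : ∀ n, a ≤ n → n + 1 < b → g (n + 1) - g n ≤ C * l := h2
  have hmono : ∀ m n, a ≤ m → m ≤ n → n < b → g m ≤ g n := fun m n h3 h4 h5 => by
    have := mul_sub_le_of_step hstep m n h3 h4 h5
    have h6 : (0:ℝ) ≤ (n:ℝ) - m := by
      have : (m:ℝ) ≤ n := by exact_mod_cast h4
      linarith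
    nlinarith
  set s := Finset.Ico a b with hs
  set K := Finset.Icc ⌊g a⌋ ⌊g (b - 1)⌋ with hK
  have hmaps : ∀ n ∈ s, ⌊g n⌋ ∈ K := fun n hn => by
    rw [hs, Finset.mem_Ico] at hn
    rw [hK, Finset.mem_Icc]
    exact ⟨Int.floor_le_floor (hmono a n le_rfl hn.1 hn.2),
      Int.floor_le_floor (hmono n (b-1) hn.1 (by omega) (by omega))⟩
  rw [← Finset.sum_fiberwise_of_maps_to hmaps]
  have hfib : ∀ k ∈ K, ‖∑ n ∈ s with ⌊g n⌋ = k, expi (f n)‖ ≤ 7 / √l := by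
    intro k _
    set A := s.filter (fun n => ⌊g n⌋ = k) with hA
    have hAmem : ∀ n, n ∈ A ↔ (a ≤ n ∧ n < b) ∧ (k:ℝ) ≤ g n ∧ g n < k + 1 := fun n => by
      rw [hA, Finset.mem_filter, hs, Finset.mem_Ico, Int.floor_eq_iff]
    rw [← Finset.sum_filter_add_sum_filter_not A (fun n => g n < k + √l),
      ← Finset.sum_filter_add_sum_filter_not (A.filter (fun n => ¬ g n < k + √l))
        (fun n => k + 1 - √l < g n)]
    have c1 : ((A.filter (fun n => g n < k + √l)).card : ℝ) ≤ √l / l + 1 := by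
      refine card_le_of_window (α := k) hl hsl.le hstep _ fun n hn => ?_
      rw [Finset.mem_filter, hAmem] at hn
      exact ⟨hn.1.1.1, hn.1.1.2, hn.1.2.1, hn.2.le⟩
    have c2 : (((A.filter (fun n => ¬ g n < k + √l)).filter
        (fun n => k + 1 - √l < g n)).card : ℝ) ≤ √l / l + 1 := by
      refine card_le_of_window (α := k + 1 - √l) hl hsl.le hstep _ fun n hn => ?_
      rw [Finset.mem_filter, Finset.mem_filter, hAmem] at hn
      exact ⟨hn.1.1.1.1, hn.1.1.1.2, hn.2.le, by linarith [hn.1.1.2.2]⟩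
    have c3 : ‖∑ n ∈ (A.filter (fun n => ¬ g n < k + √l)).filter
        (fun n => ¬ k + 1 - √l < g n), expi (f n)‖ ≤ 3 / √l := by
      set B := (A.filter (fun n => ¬ g n < k + √l)).filter (fun n => ¬ k + 1 - √l < g n) with hB
      have hBmem : ∀ n, n ∈ B ↔ (a ≤ n ∧ n < b) ∧ k + √l ≤ g n ∧ g n ≤ k + 1 - √l := fun n => by
        rw [hB, Finset.mem_filter, Finset.mem_filter, hAmem]
        constructor
        · rintro ⟨⟨⟨h3, h4⟩, h5⟩, h6⟩
          exact ⟨h3, not_lt.mp h5, not_lt.mp h6⟩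
        · rintro ⟨h3, h4, h5⟩
          exact ⟨⟨⟨h3, by linarith, by linarith⟩, not_lt.mpr h4⟩, not_lt.mpr h5⟩
      obtain ⟨a', b', hab'⟩ := exists_Ico_of_ordConnected B fun x hx z hz y hxy hyz => by
        rw [hBmem] at *
        refine ⟨⟨by omega, by omega⟩, ?_, ?_⟩
        · exact hx.2.1.trans (hmono x y hx.1.1 hxy (by omega))
        · exact (hmono y z (by omega) hyz hz.1.2).trans hz.2.2
      rw [hab']
      have hin : ∀ n, a' ≤ n → n < b' → (a ≤ n ∧ n < b) ∧ k + √l ≤ g n ∧ g n ≤ k + 1 - √l :=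
        fun n h3 h4 => (hBmem n).mp (by rw [hab', Finset.mem_Ico]; exact ⟨h3, h4⟩)
      refine kusmin_landau f a' b' (√l) k hsl (fun n h3 h4 => ?_) (fun n h3 h4 => ?_)
      · have := hin n h3 h4
        simp only [hg] at this
        constructor <;> linarith
      · have h5 := hin n h3 (by omega)
        have h6 := hin (n+1) (by omega) h4
        have := hstep n h5.1.1 (by omega)
        simp only [hg] at this
        linarith
    have e1 : √l / l = 1 / √l := by
      rw [div_eq_div_iff hl.ne' hsl.ne']
      linarith
    have e2 : 1 ≤ 1 / √l := by
      rw [le_div_iff₀ hsl]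
      linarith
    have e3 : 7 / √l = 7 * (1 / √l) := by ring
    have e4 : 3 / √l = 3 * (1 / √l) := by ring
    rw [e1] at c1 c2
    refine (norm_add_le _ _).trans ?_
    have d1 := triv (A.filter (fun n => g n < k + √l))
    have d2 := triv ((A.filter (fun n => ¬ g n < k + √l)).filter (fun n => k + 1 - √l < g n))
    have d3 := norm_add_le (∑ n ∈ (A.filter (fun n => ¬ g n < k + √l)).filter
        (fun n => k + 1 - √l < g n), expi (f n)) (∑ n ∈ (A.filter (fun n => ¬ g n < k + √l)).filter
        (fun n => ¬ k + 1 - √l < g n), expi (f n))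
    linarith
  refine (norm_sum_le _ _).trans ((Finset.sum_le_card_nsmul _ _ _ hfib).trans ?_)
  rw [nsmul_eq_mul]
  have hcard : (K.card : ℝ) ≤ C * l * (b - a : ℕ) + 2 := by
    have h3 := sub_le_mul_of_step hstep2 a (b - 1) le_rfl (by omega) (by omega)
    have h4 : ⌊g a⌋ ≤ ⌊g (b - 1)⌋ + 1 := by
      have := Int.floor_le_floor (hmono a (b-1) le_rfl (by omega) (by omega))
      omega
    have h5 : (K.card : ℤ) = ⌊g (b - 1)⌋ + 1 - ⌊g a⌋ := by
      rw [hK, Int.card_Icc, Int.toNat_of_nonneg (by omega)]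
    have h6 : (K.card : ℝ) = ⌊g (b - 1)⌋ + 1 - ⌊g a⌋ := by exact_mod_cast h5
    have h7 := Int.floor_le (g (b - 1))
    have h8 := Int.lt_floor_add_one (g a)
    have h9 : ((b - 1 : ℕ) : ℝ) - a ≤ (b - a : ℕ) := by
      have : ((b - 1 : ℕ) : ℝ) ≤ ((b - a : ℕ) : ℝ) + a := by
        norm_cast
        omega
      linarith
    have h10 : 0 ≤ C * l := by positivity
    have := mul_le_mul_of_nonneg_left h9 h10
    linarith
  have : (0:ℝ) ≤ (b - a : ℕ) * √l * 2 := by positivity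
  have h7 : 0 ≤ 7 / √l := by positivity
  have := mul_le_mul_of_nonneg_right hcard h7
  linarith

lemma rpow_sub_bounds {c : ℝ} (hc : 1 < c) {x : ℝ} (hx : 0 < x) :
    c * x ^ (c - 1) ≤ (x + 1) ^ c - x ^ c ∧ (x + 1) ^ c - x ^ c ≤ c * (x + 1) ^ (c - 1) := by
  obtain ⟨ξ, hξ, h⟩ := exists_hasDerivAt_eq_slope (fun t : ℝ => t ^ c)
    (fun t => c * t ^ (c - 1)) (show x < x + 1 by linarith)
    (ContinuousOn.rpow_const continuousOn_id fun t ht => Or.inr (by linarith))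
    (fun t ht => Real.hasDerivAt_rpow_const (Or.inl (by linarith [ht.1])))
  rw [add_sub_cancel_left, div_one] at h
  rw [← h]
  constructor
  · have := Real.rpow_le_rpow hx.le hξ.1.le (show 0 ≤ c - 1 by linarith)
    gcongr
  · have := Real.rpow_le_rpow (by linarith [hξ.1]) hξ.2.le (show 0 ≤ c - 1 by linarith)
    gcongr

lemma rpow_second_diff_bounds {c : ℝ} (hc : 1 < c) (hc2 : c < 2) {x : ℝ} (hx : 0 < x) :
    c * (c - 1) * (x + 2) ^ (c - 2) ≤ ((x + 2) ^ c - (x + 1) ^ c) - ((x + 1) ^ c - x ^ c) ∧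
    ((x + 2) ^ c - (x + 1) ^ c) - ((x + 1) ^ c - x ^ c) ≤ c * (c - 1) * x ^ (c - 2) := by
  obtain ⟨ξ, hξ, h⟩ := exists_hasDerivAt_eq_slope (fun t : ℝ => (t + 1) ^ c - t ^ c)
    (fun t => c * (t + 1) ^ (c - 1) - c * t ^ (c - 1)) (show x < x + 1 by linarith)
    (by
      apply ContinuousOn.sub
      · exact ContinuousOn.rpow_const (by fun_prop) fun t ht => Or.inr (by linarith)
      · exact ContinuousOn.rpow_const continuousOn_id fun t ht => Or.inr (by linarith))
    (fun t ht => by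
      have h1 : HasDerivAt (fun t : ℝ => (t + 1) ^ c) (c * (t + 1) ^ (c - 1)) t := by
        have := (Real.hasDerivAt_rpow_const (x := t + 1) (p := c)
          (Or.inl (by linarith [ht.1]))).comp_add_const t 1
        exact this
      exact h1.sub (Real.hasDerivAt_rpow_const (Or.inl (by linarith [ht.1]))))
  have hξ0 : 0 < ξ := by linarith [hξ.1]
  obtain ⟨ζ, hζ, h'⟩ := exists_hasDerivAt_eq_slope (fun t : ℝ => c * t ^ (c - 1))
    (fun t => c * ((c - 1) * t ^ (c - 1 - 1))) (show ξ < ξ + 1 by linarith)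
    (ContinuousOn.mul continuousOn_const
      (ContinuousOn.rpow_const continuousOn_id fun t ht => Or.inr (by linarith)))
    (fun t ht => (Real.hasDerivAt_rpow_const (Or.inl (by linarith [ht.1]))).const_mul c)
  rw [add_sub_cancel_left, div_one] at h h'
  have e : x + 1 + 1 = x + 2 := by ring
  rw [e] at h
  rw [← h, ← h', show c - 1 - 1 = c - 2 by ring, ← mul_assoc]
  have hcc : 0 ≤ c * (c - 1) := by nlinarith
  constructor
  · refine mul_le_mul_of_nonneg_left ?_ hcc
    exact Real.rpow_le_rpow_of_nonpos (by linarith [hζ.1]) (by linarith [hζ.2, hξ.2]) (by linarith)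
  · refine mul_le_mul_of_nonneg_left ?_ hcc
    exact Real.rpow_le_rpow_of_nonpos hx (by linarith [hζ.1, hξ.1]) (by linarith)

/-- Second derivative test for the monomial `y n ^ c`. -/
theorem exists_monomial_second_bound {c : ℝ} (hc : 1 < c) (hc2 : c < 2) :
    ∃ C > 0, ∀ y N : ℝ, 0 < y → 1 ≤ N → ∀ a b : ℕ, N ≤ a → (b : ℝ) ≤ 16 * N + 1 →
      ‖∑ n ∈ Finset.Ico a b, expi (y * (n : ℝ) ^ c)‖ ≤ C * (√(y * N ^ c) + N / √(y * N ^ c)) := by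
  set κ : ℝ := c * (c - 1) * 18 ^ (c - 2) with hκ
  have hκ0 : 0 < κ := by
    have : 0 < c - 1 := by linarith
    positivity
  set D : ℝ := 18 ^ (2 - c) with hD
  have hD0 : 0 < D := by positivity
  refine ⟨(112 * D + 32) * √κ + 14 / √κ, by positivity, fun y N hy hN a b ha hb => ?_⟩
  have hN0 : 0 < N := by linarith
  rcases le_or_gt b a with hab | hab
  · rw [Finset.Ico_eq_empty_of_le hab]
    simp only [Finset.sum_empty, norm_zero]
    positivity
  set l : ℝ := y * (κ * N ^ (c - 2)) with hl
  have hl0 : 0 < l := by positivity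
  have hDκ : D * κ = c * (c - 1) := by
    rw [hD, hκ]
    have : (18:ℝ) ^ (2 - c) * 18 ^ (c - 2) = 1 := by
      rw [← Real.rpow_add (by norm_num)]
      simp
    linear_combination (c * (c - 1)) * this
  have main := second_difference_test (fun n => y * (n : ℝ) ^ c) a b l D hl0 hD0.le ?_ ?_
  · refine main.trans ?_
    have hbound : ((b - a : ℕ) : ℝ) ≤ 16 * N := by
      rw [Nat.cast_sub hab.le]
      linarith
    have hT : 0 < y * N ^ c := by positivity
    have e1 : √l = √κ * (√(y * N ^ c) / N) := by
      rw [show l = κ * ((y * N ^ c) / N ^ 2) by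
        rw [hl, Real.rpow_sub hN0, Real.rpow_two]; ring]
      rw [Real.sqrt_mul hκ0.le, Real.sqrt_div hT.le, Real.sqrt_sq hN0.le]
    have hsT : 0 < √(y * N ^ c) := sqrt_pos.mpr hT
    have hsκ : 0 < √κ := sqrt_pos.mpr hκ0
    have hsl : 0 < √l := sqrt_pos.mpr hl0
    have e2 : l = √l * √l := (mul_self_sqrt hl0.le).symm
    calc 7 / √l * (D * l * (b - a : ℕ) + 2) + (b - a : ℕ) * √l * 2
        ≤ 7 / √l * (D * l * (16 * N) + 2) + (16 * N) * √l * 2 := by gcongr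
      _ = (112 * D + 32) * (N * √l) + 14 / √l := by
          have : l / √l = √l := by rw [div_eq_iff hsl.ne']; exact e2
          have h3 : 7 / √l * (D * l * (16 * N) + 2) = 112 * D * N * (l / √l) + 14 / √l := by ring
          rw [h3, this]
          ring
      _ = (112 * D + 32) * √κ * √(y * N ^ c) + 14 / √κ * (N / √(y * N ^ c)) := by
          rw [e1]
          field_simp
      _ ≤ _ := by
          have p1 : 0 ≤ (112 * D + 32) * √κ * (N / √(y * N ^ c)) := by positivity
          have p2 : 0 ≤ 14 / √κ * √(y * N ^ c) := by positivity
          linarith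
  · intro n h1 h2
    have hn0 : 0 < (n : ℝ) := by
      have : (a : ℝ) ≤ n := by exact_mod_cast h1
      linarith
    have := (rpow_second_diff_bounds hc hc2 hn0).1
    have h3 : (18 * N) ^ (c - 2) ≤ ((n : ℝ) + 2) ^ (c - 2) := by
      have : (n : ℝ) + 1 + 1 ≤ b := by exact_mod_cast h2
      exact Real.rpow_le_rpow_of_nonpos (by linarith) (by linarith) (by linarith)
    rw [Real.mul_rpow (by norm_num) hN0.le] at h3
    have h4 : κ * N ^ (c - 2) ≤ c * (c - 1) * ((n : ℝ) + 2) ^ (c - 2) := by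
      rw [hκ, mul_assoc]
      have : 0 < c - 1 := by linarith
      gcongr
    have h5 := mul_le_mul_of_nonneg_left (h4.trans this) hy.le
    push_cast
    linarith
  · intro n h1 h2
    have hna : N ≤ (n : ℝ) := by
      have : (a : ℝ) ≤ n := by exact_mod_cast h1
      linarith
    have := (rpow_second_diff_bounds hc hc2 (hN0.trans_le hna)).2
    have h3 : (n : ℝ) ^ (c - 2) ≤ N ^ (c - 2) :=
      Real.rpow_le_rpow_of_nonpos hN0 hna (by linarith)
    have h4 : c * (c - 1) * (n : ℝ) ^ (c - 2) ≤ D * κ * N ^ (c - 2) := by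
      rw [hDκ]
      have : 0 < c - 1 := by linarith
      gcongr
    have h5 := mul_le_mul_of_nonneg_left (this.trans h4) hy.le
    push_cast
    rw [hl]
    linarith

/-- Kusmin–Landau for the monomial `y n ^ c`. -/
theorem monomial_first_bound {c : ℝ} (hc : 1 < c) (hc2 : c < 2) {y N : ℝ} (hy : 0 < y) (hN : 1 ≤ N)
    (hyN : y * (c * (18 * N) ^ (c - 1)) ≤ 1 / 2) (a b : ℕ) (ha : N ≤ a) (hb : (b : ℝ) ≤ 16 * N + 1) :
    ‖∑ n ∈ Finset.Ico a b, expi (y * (n : ℝ) ^ c)‖ ≤ 3 / (y * N ^ (c - 1)) := by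
  have hN0 : 0 < N := by linarith
  have hc0 : 0 < c := by linarith
  have key := kusmin_landau (fun n => y * (n : ℝ) ^ c) a b (y * (c * N ^ (c - 1))) 0 (by positivity)
    ?_ ?_
  · refine key.trans ?_
    apply div_le_div_of_nonneg_left (by norm_num) (by positivity)
    have : N ^ (c - 1) * 1 ≤ N ^ (c - 1) * c := by gcongr
    nlinarith
  · intro n h1 h2
    have hna : N ≤ (n : ℝ) := by
      have : (a : ℝ) ≤ n := by exact_mod_cast h1
      linarith
    have hnb : (n : ℝ) + 1 ≤ 18 * N := by
      have : (n : ℝ) + 1 ≤ b := by exact_mod_cast h2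
      linarith
    have hd := rpow_sub_bounds hc (hN0.trans_le hna)
    have u1 : N ^ (c - 1) ≤ (n : ℝ) ^ (c - 1) := Real.rpow_le_rpow hN0.le hna (by linarith)
    have u2 : ((n : ℝ) + 1) ^ (c - 1) ≤ (18 * N) ^ (c - 1) :=
      Real.rpow_le_rpow (by linarith) hnb (by linarith)
    have u3 : N ^ (c - 1) ≤ (18 * N) ^ (c - 1) :=
      Real.rpow_le_rpow (by linarith) (by linarith) (by linarith)
    have v1 : y * (c * N ^ (c - 1)) ≤ y * ((n + 1 : ℝ) ^ c - (n : ℝ) ^ c) := by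
      refine mul_le_mul_of_nonneg_left (le_trans ?_ hd.1) hy.le
      gcongr
    have v2 : y * ((n + 1 : ℝ) ^ c - (n : ℝ) ^ c) ≤ y * (c * (18 * N) ^ (c - 1)) := by
      refine mul_le_mul_of_nonneg_left (le_trans hd.2 ?_) hy.le
      gcongr
    have v3 : y * (c * N ^ (c - 1)) ≤ y * (c * (18 * N) ^ (c - 1)) := by gcongr
    push_cast
    constructor <;> linarith
  · intro n h1 h2
    have hn0 : 0 < (n : ℝ) := by
      have : (a : ℝ) ≤ n := by exact_mod_cast h1
      linarith
    have := (rpow_second_diff_bounds hc hc2 hn0).1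
    have h3 : 0 ≤ c * (c - 1) * ((n : ℝ) + 2) ^ (c - 2) := by
      have : 0 < c - 1 := by linarith
      positivity
    have h5 := mul_le_mul_of_nonneg_left (h3.trans this) hy.le
    push_cast
    linarith

/-- Uniform bound for the exponential sum over all integers in `(X/8, X]`. -/
theorem exists_kernel_bound {c : ℝ} (hc : 1 < c) (hc2 : c < 2) :
    ∃ C > 0, ∀ X z : ℝ, 8 ≤ X → z ≠ 0 →
      ‖∑ n ∈ Finset.Ioc ⌊X / 8⌋₊ ⌊X⌋₊, expi (z * (n : ℝ) ^ c)‖ ≤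
        C * (X ^ (1 - c) / |z| + √(|z| * X ^ c)) := by
  obtain ⟨C₁, hC₁, h₁⟩ := exists_monomial_second_bound hc hc2
  have hc0 : 0 < c := by linarith
  have e8 : (0:ℝ) < 8 ^ (c - 1) := by positivity
  refine ⟨3 * 8 ^ (c - 1) + C₁ * (1 + 2 * c * 18 ^ (c - 1) * 8), by positivity,
    fun X z hX hz => ?_⟩
  have hred : ‖∑ n ∈ Finset.Ioc ⌊X / 8⌋₊ ⌊X⌋₊, expi (z * (n : ℝ) ^ c)‖
      = ‖∑ n ∈ Finset.Ico (⌊X / 8⌋₊ + 1) (⌊X⌋₊ + 1), expi (|z| * (n : ℝ) ^ c)‖ := by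
    have : Finset.Ioc ⌊X / 8⌋₊ ⌊X⌋₊ = Finset.Ico (⌊X / 8⌋₊ + 1) (⌊X⌋₊ + 1) := by
      ext n
      simp only [Finset.mem_Ioc, Finset.mem_Ico]
      omega
    rw [this]
    rcases abs_choice z with h | h
    · rw [h]
    · rw [h, ← norm_sum_expi_neg]
      simp
  rw [hred]
  set y := |z| with hy
  have hy0 : 0 < y := abs_pos.mpr hz
  have hX0 : 0 < X := by linarith
  set N := X / 8 with hN
  have hN1 : 1 ≤ N := by rw [hN, le_div_iff₀ (by norm_num)]; linarith
  have hN0 : 0 < N := by linarith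
  have ha : N ≤ ((⌊X / 8⌋₊ + 1 : ℕ) : ℝ) := by
    push_cast
    exact (Nat.lt_floor_add_one _).le
  have hb : ((⌊X⌋₊ + 1 : ℕ) : ℝ) ≤ 16 * N + 1 := by
    push_cast
    have := Nat.floor_le hX0.le
    have : X = 8 * N := by rw [hN]; ring
    linarith
  have hTX : y * N ^ c ≤ y * X ^ c := by
    have : N ^ c ≤ X ^ c := Real.rpow_le_rpow hN0.le (by rw [hN]; linarith) hc0.le
    gcongr
  have hq : 0 ≤ X ^ (1 - c) / y := by positivity
  rcases le_or_gt (y * (c * (18 * N) ^ (c - 1))) (1 / 2) with hcase | hcase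
  · refine (monomial_first_bound hc hc2 hy0 hN1 hcase _ _ ha hb).trans ?_
    have e : 3 / (y * N ^ (c - 1)) = 3 * 8 ^ (c - 1) * (X ^ (1 - c) / y) := by
      have hx : X = 8 * N := by rw [hN]; ring
      rw [show 1 - c = -(c - 1) by ring, Real.rpow_neg hX0.le, hx,
        Real.mul_rpow (by norm_num) hN0.le]
      field_simp
    rw [e]
    have p1 : 0 ≤ 3 * 8 ^ (c - 1) * √(y * X ^ c) := by positivity
    have p2 : 0 ≤ C₁ * (1 + 2 * c * 18 ^ (c - 1) * 8) * (X ^ (1 - c) / y + √(y * X ^ c)) := by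
      positivity
    linarith
  · refine (h₁ y N hy0 hN1 _ _ ha hb).trans ?_
    have hT0 : 0 < y * N ^ c := by positivity
    have hs0 : 0 < √(y * N ^ c) := sqrt_pos.mpr hT0
    have hNle : N ≤ (2 * c * 18 ^ (c - 1)) * (y * N ^ c) := by
      rw [Real.mul_rpow (by norm_num) hN0.le] at hcase
      have : N ^ c = N ^ (c - 1) * N := by
        rw [← Real.rpow_add_one hN0.ne']
        congr 1
        ring
      rw [this]
      nlinarith
    have h3 : N / √(y * N ^ c) ≤ (2 * c * 18 ^ (c - 1)) * √(y * N ^ c) := by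
      rw [div_le_iff₀ hs0, mul_assoc, mul_self_sqrt hT0.le]
      exact hNle
    have h4 : √(y * N ^ c) ≤ √(y * X ^ c) := sqrt_le_sqrt hTX
    have hk : 0 ≤ 2 * c * (18:ℝ) ^ (c - 1) := by positivity
    calc C₁ * (√(y * N ^ c) + N / √(y * N ^ c))
        ≤ C₁ * (√(y * X ^ c) + (2 * c * 18 ^ (c - 1)) * √(y * X ^ c)) := by
          have := mul_le_mul_of_nonneg_left h4 hk
          gcongr
          linarith
      _ = C₁ * (1 + 2 * c * 18 ^ (c - 1)) * √(y * X ^ c) := by ring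
      _ ≤ _ := by
          have p1 : 0 ≤ 3 * 8 ^ (c - 1) * (X ^ (1 - c) / y + √(y * X ^ c)) := by positivity
          have p2 : 0 ≤ C₁ * (1 + 2 * c * 18 ^ (c - 1) * 8) * (X ^ (1 - c) / y) := by positivity
          have p3 : 0 ≤ C₁ * (2 * c * 18 ^ (c - 1) * 7) * √(y * X ^ c) := by positivity
          linarith

lemma sum_mul_symm_le {ι : Type*} (s : Finset ι) (β : ι → ℝ) (G : ι → ι → ℝ) (W : ℝ)
    (hG0 : ∀ i j, 0 ≤ G i j) (hG : ∀ i j, G i j = G j i) (hW : ∀ i ∈ s, ∑ j ∈ s, G i j ≤ W) :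
    ∑ i ∈ s, ∑ j ∈ s, β i * β j * G i j ≤ W * ∑ i ∈ s, β i ^ 2 := by
  have h1 : ∑ i ∈ s, ∑ j ∈ s, β i * β j * G i j ≤
      ∑ i ∈ s, ∑ j ∈ s, (β i ^ 2 * G i j / 2 + β j ^ 2 * G i j / 2) := by
    refine Finset.sum_le_sum fun i _ => Finset.sum_le_sum fun j _ => ?_
    nlinarith [mul_nonneg (sq_nonneg (β i - β j)) (hG0 i j)]
  have h2 : ∑ i ∈ s, ∑ j ∈ s, β j ^ 2 * G i j / 2 = ∑ i ∈ s, ∑ j ∈ s, β i ^ 2 * G i j / 2 := by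
    rw [Finset.sum_comm]
    refine Finset.sum_congr rfl fun i _ => Finset.sum_congr rfl fun j _ => ?_
    rw [hG]
  simp_rw [Finset.sum_add_distrib] at h1
  rw [h2] at h1
  refine h1.trans ?_
  rw [← Finset.sum_add_distrib, Finset.mul_sum]
  refine Finset.sum_le_sum fun i hi => ?_
  rw [← Finset.sum_add_distrib]
  have : ∑ j ∈ s, (β i ^ 2 * G i j / 2 + β i ^ 2 * G i j / 2) = β i ^ 2 * ∑ j ∈ s, G i j := by
    rw [Finset.mul_sum]
    exact Finset.sum_congr rfl fun j _ => by ring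
  rw [this]
  nlinarith [mul_le_mul_of_nonneg_left (hW i hi) (sq_nonneg (β i))]

lemma sum_norm_sq_le {ι κ : Type*} (A : Finset ι) (s : Finset κ) (b : κ → ℂ) (w : ι → κ → ℂ)
    (W : ℝ)
    (hW : ∀ k ∈ s, ∑ l ∈ s, ‖∑ m ∈ A, w m k * (starRingEnd ℂ) (w m l)‖ ≤ W) :
    ∑ m ∈ A, ‖∑ k ∈ s, b k * w m k‖ ^ 2 ≤ W * ∑ k ∈ s, ‖b k‖ ^ 2 := by
  have h1 : ((∑ m ∈ A, ‖∑ k ∈ s, b k * w m k‖ ^ 2 : ℝ) : ℂ) =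
      ∑ k ∈ s, ∑ l ∈ s, b k * (starRingEnd ℂ) (b l) * ∑ m ∈ A, w m k * (starRingEnd ℂ) (w m l) := by
    push_cast
    simp_rw [← Complex.mul_conj', map_sum, Finset.sum_mul_sum, Finset.mul_sum]
    rw [Finset.sum_comm]
    refine Finset.sum_congr rfl fun k _ => ?_
    rw [Finset.sum_comm]
    refine Finset.sum_congr rfl fun l _ => Finset.sum_congr rfl fun m _ => ?_
    rw [map_mul]
    ring
  have h2 : ∑ m ∈ A, ‖∑ k ∈ s, b k * w m k‖ ^ 2 =
      ‖((∑ m ∈ A, ‖∑ k ∈ s, b k * w m k‖ ^ 2 : ℝ) : ℂ)‖ := by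
    rw [Complex.norm_real, Real.norm_of_nonneg]
    positivity
  rw [h2, h1]
  refine le_trans ?_ (sum_mul_symm_le s (fun k => ‖b k‖)
    (fun k l => ‖∑ m ∈ A, w m k * (starRingEnd ℂ) (w m l)‖) W (fun _ _ => norm_nonneg _) ?_ hW)
  · refine (norm_sum_le _ _).trans (Finset.sum_le_sum fun k _ => ?_)
    refine (norm_sum_le _ _).trans (Finset.sum_le_sum fun l _ => ?_)
    rw [norm_mul, norm_mul, RCLike.norm_conj]
  · intro k l
    rw [← RCLike.norm_conj, map_sum]
    congr 1
    refine Finset.sum_congr rfl fun m _ => ?_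
    rw [map_mul, Complex.conj_conj, mul_comm]

/-- Cauchy–Schwarz for a bilinear form whose second variable is cut into blocks of length `Q`. -/
lemma bilinear_blocks (A B : Finset ℕ) (a b : ℕ → ℂ) (w : ℕ → ℕ → ℂ) (Q : ℕ) (D W : ℝ)
    (hD : ((B.image (· / Q)).card : ℝ) ≤ D)
    (hW : ∀ k ∈ B, ∑ l ∈ B with l / Q = k / Q,
      ‖∑ m ∈ A, w m k * (starRingEnd ℂ) (w m l)‖ ≤ W) :
    ‖∑ m ∈ A, ∑ k ∈ B, a m * (b k * w m k)‖ ^ 2 ≤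
      D * (∑ m ∈ A, ‖a m‖ ^ 2) * (W * ∑ k ∈ B, ‖b k‖ ^ 2) := by
  set J := B.image (· / Q) with hJ
  set F : ℕ → ℕ → ℂ := fun j m => ∑ k ∈ B with k / Q = j, b k * w m k with hF
  have hmaps : ∀ k ∈ B, k / Q ∈ J := fun k hk => Finset.mem_image_of_mem _ hk
  have e1 : ∑ m ∈ A, ∑ k ∈ B, a m * (b k * w m k) = ∑ p ∈ A ×ˢ J, a p.1 * F p.2 p.1 := by
    rw [Finset.sum_product]
    refine Finset.sum_congr rfl fun m _ => ?_
    rw [← Finset.mul_sum]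
    have h1 := Finset.sum_fiberwise_of_maps_to hmaps (fun k => b k * w m k)
    rw [← h1, Finset.mul_sum]
  have e2 : ‖∑ p ∈ A ×ˢ J, a p.1 * F p.2 p.1‖ ≤ ∑ p ∈ A ×ˢ J, ‖a p.1‖ * ‖F p.2 p.1‖ := by
    refine (norm_sum_le _ _).trans (Finset.sum_le_sum fun p _ => ?_)
    rw [norm_mul]
  have e3 := Finset.sum_mul_sq_le_sq_mul_sq (A ×ˢ J) (fun p => ‖a p.1‖) (fun p => ‖F p.2 p.1‖)
  have e4 : ∑ p ∈ A ×ˢ J, ‖a p.1‖ ^ 2 = J.card * ∑ m ∈ A, ‖a m‖ ^ 2 := by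
    rw [Finset.sum_product_right]
    simp
  have e5 : ∑ p ∈ A ×ˢ J, ‖F p.2 p.1‖ ^ 2 ≤ W * ∑ k ∈ B, ‖b k‖ ^ 2 := by
    have h1 := Finset.sum_fiberwise_of_maps_to hmaps (fun k => ‖b k‖ ^ 2)
    rw [Finset.sum_product_right, ← h1, Finset.mul_sum]
    refine Finset.sum_le_sum fun j _ => ?_
    have h2 := sum_norm_sq_le A (B.filter (fun k => k / Q = j)) b w W (fun k hk => by
      rw [Finset.mem_filter] at hk
      have := hW k hk.1
      rwa [hk.2] at this)
    exact h2
  rw [e1]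
  calc _ ≤ (∑ p ∈ A ×ˢ J, ‖a p.1‖ * ‖F p.2 p.1‖) ^ 2 := by gcongr
    _ ≤ _ := e3
    _ ≤ _ := by
      rw [e4]
      have hD0 : 0 ≤ D := le_trans (Nat.cast_nonneg _) hD
      gcongr

lemma sum_inv_sqrt_le (Q : ℕ) : ∑ d ∈ Finset.Icc 1 Q, 1 / √(d : ℝ) ≤ 2 * √(Q : ℝ) := by
  induction Q with
  | zero => simp
  | succ n ih =>
    rw [Finset.sum_Icc_succ_top (by omega)]
    have h0 : (0:ℝ) ≤ n := by positivity
    have h1 : √(n:ℝ) * √(n:ℝ) = n := mul_self_sqrt h0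
    have h2 : √((n + 1 : ℕ):ℝ) * √((n+1 : ℕ):ℝ) = n + 1 := by
      rw [mul_self_sqrt (by positivity)]; push_cast; ring
    have h3 : 0 < √((n + 1 : ℕ):ℝ) := sqrt_pos.mpr (by positivity)
    have h4 : 0 ≤ √(n:ℝ) := sqrt_nonneg _
    have : 1 / √((n + 1 : ℕ):ℝ) ≤ 2 * √((n+1:ℕ):ℝ) - 2 * √(n:ℝ) := by
      rw [div_le_iff₀ h3]
      nlinarith [sq_nonneg (√((n+1:ℕ):ℝ) - √(n:ℝ))]
    linarith

lemma sum_block_inv_sqrt_le (B : Finset ℕ) (k Q : ℕ) (hQ : 0 < Q) :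
    ∑ l ∈ (B.filter (fun l => l / Q = k / Q)).erase k, 1 / √(|(k:ℝ) - l|) ≤ 4 * √(Q : ℝ) := by
  set s := (B.filter (fun l => l / Q = k / Q)).erase k with hs
  have hmem : ∀ l ∈ s, l ≠ k ∧ l / Q = k / Q := fun l hl => by
    rw [hs, Finset.mem_erase, Finset.mem_filter] at hl
    exact ⟨hl.1, hl.2.2⟩
  have hdiff : ∀ l ∈ s, (l ≤ k + Q ∧ k ≤ l + Q) := fun l hl => by
    have h := (hmem l hl).2
    have h1 := Nat.div_add_mod l Q
    have h2 := Nat.div_add_mod k Q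
    have h3 := Nat.mod_lt l hQ
    have h4 := Nat.mod_lt k hQ
    rw [h] at h1
    omega
  rw [← Finset.sum_filter_add_sum_filter_not s (fun l => l < k)]
  have c1 : ∑ l ∈ s with l < k, 1 / √(|(k:ℝ) - l|) ≤ 2 * √(Q:ℝ) := by
    refine le_trans ?_ (sum_inv_sqrt_le Q)
    have : ∑ l ∈ s with l < k, 1 / √(|(k:ℝ) - l|) =
        ∑ d ∈ (s.filter (fun l => l < k)).image (fun l => k - l), 1 / √(d:ℝ) := by
      rw [Finset.sum_image]
      · refine Finset.sum_congr rfl fun l hl => ?_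
        rw [Finset.mem_filter] at hl
        rw [Nat.cast_sub hl.2.le, abs_of_nonneg]
        have : (l:ℝ) ≤ k := by exact_mod_cast hl.2.le
        linarith
      · intro l hl l' hl' h
        simp only [Finset.coe_filter, Set.mem_ofPred_eq] at hl hl'
        simp only at h
        omega
    rw [this]
    refine Finset.sum_le_sum_of_subset_of_nonneg ?_ fun _ _ _ => by positivity
    intro d hd
    rw [Finset.mem_image] at hd
    obtain ⟨l, hl, rfl⟩ := hd
    rw [Finset.mem_filter] at hl
    have := hdiff l hl.1
    rw [Finset.mem_Icc]
    omega
  have c2 : ∑ l ∈ s with ¬ l < k, 1 / √(|(k:ℝ) - l|) ≤ 2 * √(Q:ℝ) := by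
    refine le_trans ?_ (sum_inv_sqrt_le Q)
    have : ∑ l ∈ s with ¬ l < k, 1 / √(|(k:ℝ) - l|) =
        ∑ d ∈ (s.filter (fun l => ¬ l < k)).image (fun l => l - k), 1 / √(d:ℝ) := by
      rw [Finset.sum_image]
      · refine Finset.sum_congr rfl fun l hl => ?_
        rw [Finset.mem_filter] at hl
        rw [Nat.cast_sub (not_lt.mp hl.2), abs_sub_comm, abs_of_nonneg]
        have : (k:ℝ) ≤ l := by exact_mod_cast not_lt.mp hl.2
        linarith
      · intro l hl l' hl' h
        simp only [Finset.coe_filter, Set.mem_ofPred_eq] at hl hl'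
        simp only at h
        omega
    rw [this]
    refine Finset.sum_le_sum_of_subset_of_nonneg ?_ fun _ _ _ => by positivity
    intro d hd
    rw [Finset.mem_image] at hd
    obtain ⟨l, hl, rfl⟩ := hd
    rw [Finset.mem_filter] at hl
    have := hdiff l hl.1
    have := (hmem l hl.1).1
    rw [Finset.mem_Icc]
    omega
  linarith

lemma exists_monomial_bound_ordConnected {c : ℝ} (hc : 1 < c) (hc2 : c < 2) :
    ∃ C > 0, ∀ z M : ℝ, z ≠ 0 → 1 ≤ M → ∀ S : Finset ℕ,
      (∀ x ∈ S, ∀ z ∈ S, ∀ y, x ≤ y → y ≤ z → y ∈ S) →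
      (∀ n ∈ S, M ≤ n ∧ (n:ℝ) ≤ 16 * M) →
      ‖∑ n ∈ S, expi (z * (n:ℝ) ^ c)‖ ≤ C * (√(|z| * M ^ c) + M / √(|z| * M ^ c)) := by
  obtain ⟨C, hC, h⟩ := exists_monomial_second_bound hc hc2
  refine ⟨C, hC, fun z M hz hM S hS hr => ?_⟩
  obtain ⟨a, b, rfl⟩ := exists_Ico_of_ordConnected S hS
  have habs : ‖∑ n ∈ Finset.Ico a b, expi (z * (n:ℝ) ^ c)‖ =
      ‖∑ n ∈ Finset.Ico a b, expi (|z| * (n:ℝ) ^ c)‖ := by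
    rcases abs_cases z with ⟨e, _⟩ | ⟨e, _⟩
    · rw [e]
    · rw [e]
      simp_rw [neg_mul]
      rw [norm_sum_expi_neg]
  rw [habs]
  rcases le_or_gt b a with hab | hab
  · rw [Finset.Ico_eq_empty_of_le hab, Finset.sum_empty, norm_zero]
    positivity
  · refine h |z| M (abs_pos.mpr hz) hM a b (hr a (by simp [hab])).1 ?_
    have := (hr (b - 1) (by simp; omega)).2
    rw [Nat.cast_sub (by omega)] at this
    push_cast at this
    linarith

lemma rpow_abs_sub_bounds {c : ℝ} (hc : 1 < c) {u v a b : ℝ} (hu : 0 < u)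
    (ha : u ≤ a ∧ a ≤ v) (hb : u ≤ b ∧ b ≤ v) :
    c * u ^ (c - 1) * |a - b| ≤ |a ^ c - b ^ c| ∧
      |a ^ c - b ^ c| ≤ c * v ^ (c - 1) * |a - b| := by
  wlog hab : a < b generalizing a b
  · rcases eq_or_lt_of_le (not_lt.mp hab) with rfl | h
    · simp
    · have := this hb ha h
      rwa [abs_sub_comm, abs_sub_comm (a ^ c)]
  obtain ⟨ξ, hξ, h⟩ := exists_hasDerivAt_eq_slope (fun t : ℝ => t ^ c)
    (fun t => c * t ^ (c - 1)) hab
    (ContinuousOn.rpow_const continuousOn_id fun t ht => Or.inr (by linarith))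
    (fun t ht => Real.hasDerivAt_rpow_const (Or.inl (by linarith [ht.1])))
  rw [eq_div_iff (by linarith)] at h
  have hξ0 : u ≤ ξ := by linarith [hξ.1]
  have hξ1 : ξ ≤ v := by linarith [hξ.2]
  have h1 : u ^ (c - 1) ≤ ξ ^ (c - 1) := rpow_le_rpow hu.le hξ0 (by linarith)
  have h2 : ξ ^ (c - 1) ≤ v ^ (c - 1) := rpow_le_rpow (by linarith) hξ1 (by linarith)
  have hba : 0 < b - a := by linarith
  have hξ2 : 0 ≤ ξ ^ (c - 1) := rpow_nonneg (by linarith) _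
  rw [abs_sub_comm, abs_sub_comm (a ^ c), abs_of_pos hba, ← h, abs_of_nonneg (by positivity)]
  constructor <;> gcongr

/-- The oscillating weight `e(y n^c)`, restricted to `X/8 < n ≤ X`. -/
noncomputable def osc (c X y : ℝ) (n : ℕ) : ℂ :=
  if X / 8 < (n:ℝ) ∧ (n:ℝ) ≤ X then expi (y * (n:ℝ) ^ c) else 0

lemma norm_osc_le (c X y : ℝ) (n : ℕ) : ‖osc c X y n‖ ≤ 1 := by
  unfold osc
  split_ifs
  · rw [norm_expi]
  · simp

lemma osc_mul_conj (c X y : ℝ) (m k l : ℕ) :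
    osc c X y (m * k) * (starRingEnd ℂ) (osc c X y (m * l)) =
      if (X / 8 < ((m * k : ℕ):ℝ) ∧ ((m * k : ℕ):ℝ) ≤ X) ∧
        (X / 8 < ((m * l : ℕ):ℝ) ∧ ((m * l : ℕ):ℝ) ≤ X)
      then expi (y * ((k:ℝ) ^ c - (l:ℝ) ^ c) * (m:ℝ) ^ c) else 0 := by
  unfold osc
  by_cases h1 : X / 8 < ((m * k : ℕ):ℝ) ∧ ((m * k : ℕ):ℝ) ≤ X
  · by_cases h2 : X / 8 < ((m * l : ℕ):ℝ) ∧ ((m * l : ℕ):ℝ) ≤ X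
    · rw [if_pos h1, if_pos h2, if_pos ⟨h1, h2⟩, ← expi_neg, ← expi_add]
      congr 1
      push_cast
      rw [mul_rpow (by positivity) (by positivity), mul_rpow (by positivity) (by positivity)]
      ring
    · rw [if_neg h2, map_zero, mul_zero, if_neg (fun h => h2 h.2)]
  · rw [if_neg h1, zero_mul, if_neg (fun h => h1 h.1)]

lemma exists_bilinear_bound {c : ℝ} (hc : 1 < c) (hc2 : c < 2) :
    ∃ C > 0, ∀ X y M N : ℝ, 0 < y → 1 ≤ M → 1 ≤ N → ∀ Q : ℕ, 1 ≤ Q → (Q:ℝ) ≤ 16 * N →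
      ∀ A B : Finset ℕ, (∀ x ∈ A, ∀ z ∈ A, ∀ y, x ≤ y → y ≤ z → y ∈ A) →
      (∀ m ∈ A, M ≤ m ∧ (m:ℝ) ≤ 16 * M) → (∀ k ∈ B, N ≤ k ∧ (k:ℝ) ≤ 16 * N) →
      ∀ a b : ℕ → ℂ,
      ‖∑ m ∈ A, ∑ k ∈ B, a m * (b k * osc c X y (m * k))‖ ^ 2 ≤
        C * (∑ m ∈ A, ‖a m‖ ^ 2) * (∑ k ∈ B, ‖b k‖ ^ 2) *
        (M * N / Q + N * √(y * M ^ c * N ^ c * Q / N) +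
          M * N * √(N / (y * M ^ c * N ^ c * Q))) := by
  obtain ⟨C, hC, hmon⟩ := exists_monomial_bound_ordConnected hc hc2
  set K : ℝ := c * 16 ^ (c - 1) with hK
  have hK0 : 0 < K := by positivity
  have hK1 : 1 ≤ K := by
    have : (1:ℝ) ≤ 16 ^ (c - 1) := one_le_rpow (by norm_num) (by linarith)
    nlinarith
  set C' : ℝ := 16 + C * √K + 4 * C with hC'
  have hC'0 : 0 < C' := by positivity
  refine ⟨32 * C', by positivity, fun X y M N hy hM hN Q hQ hQN A B hA hAr hBr a b => ?_⟩
  have hQ0 : (0:ℝ) < Q := by exact_mod_cast hQ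
  set T : ℝ := y * M ^ c * N ^ c with hT
  have hM0 : 0 < M := by linarith
  have hN0 : 0 < N := by linarith
  have hT0 : 0 < T := by positivity
  have hcorr : ∀ k ∈ B, ∀ l ∈ B, k ≠ l → |(k:ℝ) - l| ≤ Q →
      ‖∑ m ∈ A, osc c X y (m * k) * (starRingEnd ℂ) (osc c X y (m * l))‖ ≤
        C * √K * √(T * Q / N) + C * (M * √(N / T)) * (1 / √(|(k:ℝ) - l|)) := by
    intro k hk l hl hkl hd
    set d : ℝ := |(k:ℝ) - l| with hd'
    have hd0 : 0 < d := abs_pos.mpr (sub_ne_zero.mpr (by exact_mod_cast hkl))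
    simp_rw [osc_mul_conj]
    rw [← Finset.sum_filter]
    obtain ⟨lo, hi⟩ := rpow_abs_sub_bounds hc hN0 (hBr k hk) (hBr l hl)
    set z : ℝ := y * ((k:ℝ) ^ c - (l:ℝ) ^ c) with hz
    have hNc : N ^ (c - 1) = N ^ c / N := by rw [rpow_sub hN0, rpow_one]
    have hzabs : |z| = y * |(k:ℝ) ^ c - (l:ℝ) ^ c| := by rw [hz, abs_mul, abs_of_pos hy]
    have zlo : T * d / N ≤ |z| * M ^ c := by
      rw [hzabs, hT]
      have h1 : N ^ (c - 1) * d ≤ |(k:ℝ) ^ c - (l:ℝ) ^ c| := by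
        refine le_trans ?_ lo
        have : 0 ≤ N ^ (c - 1) * d := by positivity
        nlinarith
      calc y * M ^ c * N ^ c * d / N = y * (N ^ (c - 1) * d) * M ^ c := by rw [hNc]; ring
        _ ≤ _ := by gcongr
    have zhi : |z| * M ^ c ≤ K * (T * Q / N) := by
      rw [hzabs, hT]
      calc y * |(k:ℝ) ^ c - (l:ℝ) ^ c| * M ^ c
          ≤ y * (c * (16 * N) ^ (c - 1) * Q) * M ^ c := by
            gcongr
            exact hi.trans (by gcongr)
        _ = _ := by rw [mul_rpow (by norm_num) hN0.le, hNc, hK]; ring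
    have hz0 : z ≠ 0 := by
      intro h0
      rw [h0, abs_zero, zero_mul] at zlo
      have : 0 < T * d / N := by positivity
      linarith
    refine (hmon z M hz0 hM _ ?_ ?_).trans ?_
    · intro x hx w hw v hxv hvw
      rw [Finset.mem_filter] at hx hw ⊢
      have e1 : ((x * k : ℕ):ℝ) ≤ ((v * k : ℕ):ℝ) := by exact_mod_cast Nat.mul_le_mul_right _ hxv
      have e2 : ((v * k : ℕ):ℝ) ≤ ((w * k : ℕ):ℝ) := by exact_mod_cast Nat.mul_le_mul_right _ hvw
      have e3 : ((x * l : ℕ):ℝ) ≤ ((v * l : ℕ):ℝ) := by exact_mod_cast Nat.mul_le_mul_right _ hxv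
      have e4 : ((v * l : ℕ):ℝ) ≤ ((w * l : ℕ):ℝ) := by exact_mod_cast Nat.mul_le_mul_right _ hvw
      exact ⟨hA x hx.1 w hw.1 v hxv hvw, ⟨by linarith [hx.2.1.1], by linarith [hw.2.1.2]⟩,
        ⟨by linarith [hx.2.2.1], by linarith [hw.2.2.2]⟩⟩
    · intro m hm
      exact hAr m (Finset.mem_filter.mp hm).1
    · have s1 : √(|z| * M ^ c) ≤ √K * √(T * Q / N) := by
        rw [← sqrt_mul hK0.le]
        exact sqrt_le_sqrt zhi
      have s2 : M / √(|z| * M ^ c) ≤ M * √(N / T) * (1 / √d) := by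
        have : √(N / T) * (1 / √d) = 1 / √(T * d / N) := by
          rw [← sqrt_one, ← sqrt_div zero_le_one, ← sqrt_mul (by positivity), ← sqrt_div zero_le_one]
          congr 1
          field_simp
        rw [mul_assoc, this, mul_one_div]
        have : 0 < √(T * d / N) := sqrt_pos.mpr (by positivity)
        gcongr
      calc _ ≤ C * (√K * √(T * Q / N) + M * √(N / T) * (1 / √d)) := by gcongr
        _ = _ := by ring
  set W : ℝ := 16 * M + C * √K * (Q * √(T * Q / N)) + 4 * C * (M * √(N / T) * √Q) with hWdef
  have hblock : ∀ k ∈ B, ∑ l ∈ B with l / Q = k / Q,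
      ‖∑ m ∈ A, osc c X y (m * k) * (starRingEnd ℂ) (osc c X y (m * l))‖ ≤ W := by
    intro k hk
    have hdist : ∀ l, l / Q = k / Q → |(k:ℝ) - l| ≤ Q := fun l h => by
      have h1 := Nat.div_add_mod l Q
      have h2 := Nat.div_add_mod k Q
      have h3 := Nat.mod_lt l hQ
      have h4 := Nat.mod_lt k hQ
      rw [h] at h1
      have h5 : k ≤ l + Q := by omega
      have h6 : l ≤ k + Q := by omega
      have h7 : (k:ℝ) ≤ l + Q := by exact_mod_cast h5
      have h8 : (l:ℝ) ≤ k + Q := by exact_mod_cast h6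
      rw [abs_le]
      constructor <;> linarith
    have hkmem : k ∈ B.filter (fun l => l / Q = k / Q) := by simp [hk]
    rw [← Finset.add_sum_erase _ _ hkmem]
    have d1 : ‖∑ m ∈ A, osc c X y (m * k) * (starRingEnd ℂ) (osc c X y (m * k))‖ ≤ 16 * M := by
      refine (norm_sum_le _ _).trans ?_
      have : ∑ m ∈ A, ‖osc c X y (m * k) * (starRingEnd ℂ) (osc c X y (m * k))‖ ≤ ∑ m ∈ A, 1 := by
        refine Finset.sum_le_sum fun m _ => ?_
        rw [norm_mul, RCLike.norm_conj]
        have := norm_osc_le c X y (m * k)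
        have h0 := norm_nonneg (osc c X y (m * k))
        nlinarith
      refine this.trans ?_
      have hsub : A ⊆ Finset.Icc 1 ⌊16 * M⌋₊ := fun m hm => by
        rw [Finset.mem_Icc]
        refine ⟨?_, Nat.le_floor (hAr m hm).2⟩
        have : (1:ℝ) ≤ m := hM.trans (hAr m hm).1
        exact_mod_cast this
      have := Finset.card_le_card hsub
      rw [Nat.card_Icc, Nat.add_sub_cancel] at this
      rw [Finset.sum_const, nsmul_eq_mul, mul_one]
      exact le_trans (by exact_mod_cast this) (Nat.floor_le (by positivity))
    have d2 : ∑ l ∈ (B.filter (fun l => l / Q = k / Q)).erase k,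
        ‖∑ m ∈ A, osc c X y (m * k) * (starRingEnd ℂ) (osc c X y (m * l))‖ ≤
        C * √K * (Q * √(T * Q / N)) + 4 * C * (M * √(N / T) * √Q) := by
      have hcard : ((B.filter (fun l => l / Q = k / Q)).erase k).card ≤ Q := by
        have hsub : (B.filter (fun l => l / Q = k / Q)).erase k ⊆
            Finset.Ico (k / Q * Q) (k / Q * Q + Q) := fun l hl => by
          rw [Finset.mem_erase, Finset.mem_filter] at hl
          rw [Finset.mem_Ico]
          have h1 := Nat.div_add_mod l Q
          have h3 := Nat.mod_lt l hQ
          rw [hl.2.2, mul_comm] at h1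
          omega
        have := Finset.card_le_card hsub
        rwa [Nat.card_Ico, Nat.add_sub_cancel_left] at this
      calc _ ≤ ∑ l ∈ (B.filter (fun l => l / Q = k / Q)).erase k,
            (C * √K * √(T * Q / N) + C * (M * √(N / T)) * (1 / √(|(k:ℝ) - l|))) := by
            refine Finset.sum_le_sum fun l hl => ?_
            rw [Finset.mem_erase, Finset.mem_filter] at hl
            exact hcorr k hk l hl.2.1 (Ne.symm hl.1) (hdist l hl.2.2)
        _ = ((B.filter (fun l => l / Q = k / Q)).erase k).card * (C * √K * √(T * Q / N)) +
            C * (M * √(N / T)) *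
              ∑ l ∈ (B.filter (fun l => l / Q = k / Q)).erase k, 1 / √(|(k:ℝ) - l|) := by
            rw [Finset.sum_add_distrib, Finset.sum_const, nsmul_eq_mul, Finset.mul_sum]
        _ ≤ Q * (C * √K * √(T * Q / N)) + C * (M * √(N / T)) * (4 * √Q) := by
            gcongr
            exact sum_block_inv_sqrt_le B k Q hQ
        _ = _ := by ring
    linarith
  have hD : ((B.image (· / Q)).card : ℝ) ≤ 32 * N / Q := by
    have hsub : B.image (· / Q) ⊆ Finset.range (⌊16 * N⌋₊ / Q + 1) := fun j hj => by
      rw [Finset.mem_image] at hj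
      obtain ⟨k, hk, rfl⟩ := hj
      rw [Finset.mem_range]
      exact Nat.lt_succ_of_le (Nat.div_le_div_right (Nat.le_floor (hBr k hk).2))
    have h1 := Finset.card_le_card hsub
    rw [Finset.card_range] at h1
    have h2 : ((⌊16 * N⌋₊ / Q : ℕ) : ℝ) ≤ 16 * N / Q :=
      Nat.cast_div_le.trans (by gcongr; exact Nat.floor_le (by positivity))
    have h3 : 1 ≤ 16 * N / Q := by rw [le_div_iff₀ hQ0]; linarith
    have h4 : ((B.image (· / Q)).card : ℝ) ≤ (⌊16 * N⌋₊ / Q : ℕ) + 1 := by exact_mod_cast h1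
    have h5 : 32 * N / Q = 16 * N / Q + 16 * N / Q := by ring
    linarith
  refine (bilinear_blocks A B a b (fun m k => osc c X y (m * k)) Q _ W hD hblock).trans ?_
  set SA := ∑ m ∈ A, ‖a m‖ ^ 2
  set SB := ∑ k ∈ B, ‖b k‖ ^ 2
  have hSA : 0 ≤ SA := by positivity
  have hSB : 0 ≤ SB := by positivity
  have key : N / Q * W ≤ C' * (M * N / Q + N * √(T * Q / N) + M * N * √(N / (T * Q))) := by
    have e1 : √(N / T) * √Q / Q = √(N / (T * Q)) := by
      rw [mul_div_assoc, sqrt_div_self', mul_one_div, ← sqrt_div (by positivity), div_div]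
    have e2 : N / Q * W = 16 * (M * N / Q) + C * √K * (N * √(T * Q / N)) +
        4 * C * (M * N * √(N / (T * Q))) := by
      rw [← e1, hWdef]
      field_simp
    rw [e2, hC']
    have p1 : 0 ≤ M * N / Q := by positivity
    have p2 : 0 ≤ N * √(T * Q / N) := by positivity
    have p3 : 0 ≤ M * N * √(N / (T * Q)) := by positivity
    have p4 : 0 ≤ C * √K := by positivity
    nlinarith [mul_nonneg p4 p1, mul_nonneg p4 p2, mul_nonneg p4 p3, mul_nonneg hC.le p1,
      mul_nonneg hC.le p2, mul_nonneg hC.le p3]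
  calc 32 * N / Q * SA * (W * SB) = 32 * SA * SB * (N / Q * W) := by ring
    _ ≤ 32 * SA * SB * (C' * (M * N / Q + N * √(T * Q / N) + M * N * √(N / (T * Q)))) := by gcongr
    _ = _ := by ring

open ArithmeticFunction in
lemma sum_conv_mul (f g : ArithmeticFunction ℝ) (N : ℕ) (F : ℕ → ℂ) (hF : ∀ n, N < n → F n = 0) :
    ∑ n ∈ Finset.Ioc 0 N, ((f * g) n : ℂ) * F n =
      ∑ m ∈ Finset.Ioc 0 N, ∑ k ∈ Finset.Ioc 0 N, (f m : ℂ) * ((g k : ℂ) * F (m * k)) := by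
  rw [← Finset.sum_product']
  have h1 : ∑ p ∈ Finset.Ioc 0 N ×ˢ Finset.Ioc 0 N, (f p.1 : ℂ) * ((g p.2 : ℂ) * F (p.1 * p.2)) =
      ∑ p ∈ (Finset.Ioc 0 N ×ˢ Finset.Ioc 0 N).filter (fun p => p.1 * p.2 ∈ Finset.Ioc 0 N),
        (f p.1 : ℂ) * ((g p.2 : ℂ) * F (p.1 * p.2)) := by
    refine (Finset.sum_filter_of_ne fun p hp hne => ?_).symm
    rw [Finset.mem_product, Finset.mem_Ioc, Finset.mem_Ioc] at hp
    rw [Finset.mem_Ioc]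
    refine ⟨Nat.mul_pos hp.1.1 hp.2.1, ?_⟩
    by_contra h
    exact hne (by rw [hF _ (not_le.mp h)]; simp)
  rw [h1, ← Finset.sum_fiberwise_of_maps_to (g := fun p : ℕ × ℕ => p.1 * p.2)
    (t := Finset.Ioc 0 N) (fun p hp => (Finset.mem_filter.mp hp).2)]
  refine Finset.sum_congr rfl fun n hn => ?_
  rw [mul_apply]
  push_cast
  rw [Finset.sum_mul]
  have h2 : n.divisorsAntidiagonal = ((Finset.Ioc 0 N ×ˢ Finset.Ioc 0 N).filter
      (fun p => p.1 * p.2 ∈ Finset.Ioc 0 N)).filter (fun p => p.1 * p.2 = n) := by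
    ext ⟨a, b⟩
    simp only [Nat.mem_divisorsAntidiagonal, Finset.mem_filter, Finset.mem_product, Finset.mem_Ioc]
    rw [Finset.mem_Ioc] at hn
    constructor
    · rintro ⟨rfl, h⟩
      have ha : 0 < a := Nat.pos_of_ne_zero fun h0 => h (by rw [h0, zero_mul])
      have hb : 0 < b := Nat.pos_of_ne_zero fun h0 => h (by rw [h0, mul_zero])
      have := Nat.le_mul_of_pos_right a hb
      have := Nat.le_mul_of_pos_left b ha
      refine ⟨⟨⟨⟨ha, by omega⟩, hb, by omega⟩, hn⟩, rfl⟩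
    · rintro ⟨-, rfl⟩
      exact ⟨rfl, by omega⟩
  rw [h2]
  refine Finset.sum_congr rfl fun p hp => ?_
  rw [(Finset.mem_filter.mp hp).2, mul_assoc]

lemma sum_Ioc_one_div_le (N : ℕ) : ∑ d ∈ Finset.Ioc 0 N, 1 / (d:ℝ) ≤ 1 + log N := by
  have h := harmonic_le_one_add_log N
  rw [harmonic_eq_sum_Icc] at h
  push_cast at h
  simp_rw [one_div]
  exact h

lemma sum_divisor_sq_le (N : ℕ) :
    ∑ n ∈ Finset.Ioc 0 N, ((n.divisors.card : ℝ)) ^ 2 ≤ N * (1 + log N) ^ 3 := by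
  set H := 1 + log (N:ℝ) with hH
  have hH1 : 0 ≤ H := by
    have : 0 ≤ log (N:ℝ) := log_natCast_nonneg N
    linarith
  have hmul : ∀ x : ℕ, ∑ n ∈ Finset.Ioc 0 x, (n.divisors.card : ℝ) ≤ x * (1 + log x) := by
    intro x
    have h := ArithmeticFunction.sum_Ioc_sigma0_eq_sum_div x
    simp_rw [ArithmeticFunction.sigma_zero_apply] at h
    have h' : ∑ n ∈ Finset.Ioc 0 x, (n.divisors.card : ℝ) = ∑ n ∈ Finset.Ioc 0 x, ((x / n : ℕ):ℝ) := by
      exact_mod_cast h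
    rw [h']
    calc _ ≤ ∑ n ∈ Finset.Ioc 0 x, (x:ℝ) * (1 / (n:ℝ)) := by
          refine Finset.sum_le_sum fun n _ => ?_
          rw [mul_one_div]
          exact Nat.cast_div_le
      _ = x * ∑ n ∈ Finset.Ioc 0 x, 1 / (n:ℝ) := by rw [Finset.mul_sum]
      _ ≤ _ := by gcongr; exact sum_Ioc_one_div_le x
  have hdd : ∑ d ∈ Finset.Ioc 0 N, (d.divisors.card : ℝ) / d ≤ H ^ 2 := by
    have h1 : ∑ d ∈ Finset.Ioc 0 N, (d.divisors.card : ℝ) / d ≤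
        ∑ a ∈ Finset.Ioc 0 N, ∑ b ∈ Finset.Ioc 0 N, (1 / (a:ℝ)) * (1 / (b:ℝ)) := by
      rw [← Finset.sum_product']
      have e : ∀ d ∈ Finset.Ioc 0 N, (d.divisors.card : ℝ) / d =
          ∑ p ∈ d.divisorsAntidiagonal, (1 / (p.1:ℝ)) * (1 / (p.2:ℝ)) := by
        intro d hd
        have : ∀ p ∈ d.divisorsAntidiagonal, (1 / (p.1:ℝ)) * (1 / (p.2:ℝ)) = 1 / d := by
          intro p hp
          rw [Nat.mem_divisorsAntidiagonal] at hp
          rw [one_div_mul_one_div, ← hp.1]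
          push_cast; rfl
        rw [Finset.sum_congr rfl this, Finset.sum_const, nsmul_eq_mul, mul_one_div,
          ← Nat.map_div_right_divisors, Finset.card_map]
      rw [Finset.sum_congr rfl e, ← Finset.sum_biUnion]
      · refine Finset.sum_le_sum_of_subset_of_nonneg ?_ fun _ _ _ => by positivity
        intro p hp
        rw [Finset.mem_biUnion] at hp
        obtain ⟨d, hd, hp⟩ := hp
        rw [Nat.mem_divisorsAntidiagonal] at hp
        rw [Finset.mem_Ioc] at hd
        have ha : 0 < p.1 := Nat.pos_of_ne_zero fun h0 => by rw [h0, zero_mul] at hp; omega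
        have hb : 0 < p.2 := Nat.pos_of_ne_zero fun h0 => by rw [h0, mul_zero] at hp; omega
        have := Nat.le_mul_of_pos_right p.1 hb
        have := Nat.le_mul_of_pos_left p.2 ha
        rw [Finset.mem_product, Finset.mem_Ioc, Finset.mem_Ioc]
        omega
      · intro d _ d' _ hne
        rw [Function.onFun, Finset.disjoint_left]
        intro p hp hp'
        rw [Nat.mem_divisorsAntidiagonal] at hp hp'
        exact hne (hp.1.symm.trans hp'.1)
    refine h1.trans ?_
    rw [← Finset.sum_mul_sum, sq]
    have := sum_Ioc_one_div_le N
    gcongr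
  have hle : ∀ n : ℕ, ((n.divisors.card : ℝ)) ^ 2 ≤
      ((ArithmeticFunction.sigma 0 * ArithmeticFunction.sigma 0) n : ℕ) := by
    intro n
    rw [ArithmeticFunction.mul_apply]
    have h1 : ∀ p ∈ n.divisorsAntidiagonal, n.divisors.card ≤
        ArithmeticFunction.sigma 0 p.1 * ArithmeticFunction.sigma 0 p.2 := by
      intro p hp
      rw [Nat.mem_divisorsAntidiagonal] at hp
      rw [ArithmeticFunction.sigma_zero_apply, ArithmeticFunction.sigma_zero_apply, ← hp.1,
        Nat.divisors_mul]
      exact Finset.card_mul_le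
    have h2 := Finset.sum_le_sum h1
    rw [Finset.sum_const, ← Nat.map_div_right_divisors, Finset.card_map, smul_eq_mul,
      Nat.map_div_right_divisors, ← sq] at h2
    exact_mod_cast h2
  calc _ ≤ ∑ n ∈ Finset.Ioc 0 N,
        (((ArithmeticFunction.sigma 0 * ArithmeticFunction.sigma 0) n : ℕ) : ℝ) :=
        Finset.sum_le_sum fun n _ => hle n
    _ = ∑ d ∈ Finset.Ioc 0 N, (d.divisors.card : ℝ) *
          ∑ k ∈ Finset.Ioc 0 (N / d), (k.divisors.card : ℝ) := by
        rw [← Nat.cast_sum, ArithmeticFunction.sum_Ioc_mul_eq_sum_sum]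
        push_cast
        simp_rw [ArithmeticFunction.sigma_zero_apply]
    _ ≤ ∑ d ∈ Finset.Ioc 0 N, (d.divisors.card : ℝ) * (N / d * H) := by
        refine Finset.sum_le_sum fun d hd => ?_
        rw [Finset.mem_Ioc] at hd
        refine mul_le_mul_of_nonneg_left ((hmul _).trans ?_) (by positivity)
        have h1 : ((N / d : ℕ):ℝ) ≤ N / d := Nat.cast_div_le
        have h2 : 1 ≤ N / d := (Nat.one_le_div_iff hd.1).mpr hd.2
        have h3 : ((N / d : ℕ):ℝ) ≤ N := by exact_mod_cast Nat.div_le_self _ _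
        have h4 : log ((N / d : ℕ):ℝ) ≤ log N := log_le_log (by exact_mod_cast h2) h3
        have h5 : 0 ≤ log ((N / d : ℕ):ℝ) := log_natCast_nonneg _
        gcongr
        linarith
    _ = N * H * ∑ d ∈ Finset.Ioc 0 N, (d.divisors.card : ℝ) / d := by
        rw [Finset.mul_sum]
        refine Finset.sum_congr rfl fun d _ => by ring
    _ ≤ N * H * H ^ 2 := by gcongr
    _ = _ := by ring

section Vaughan

open ArithmeticFunction

/-- The truncation of an arithmetic function to `n ≤ V`. -/
def trunc (f : ArithmeticFunction ℝ) (V : ℕ) : ArithmeticFunction ℝ :=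
  ⟨fun n => if n ≤ V then f n else 0, by simp⟩

lemma trunc_apply (f : ArithmeticFunction ℝ) (V n : ℕ) :
    trunc f V n = if n ≤ V then f n else 0 := rfl

lemma arith_sub_apply (f g : ArithmeticFunction ℝ) (n : ℕ) : (f - g) n = f n - g n := by
  rw [sub_eq_add_neg, sub_eq_add_neg]
  rfl

/-- The Vaughan identity. -/
lemma vaughan_identity (U V : ℕ) :
    (vonMangoldt : ArithmeticFunction ℝ) - trunc vonMangoldt V =
      ArithmeticFunction.log * trunc (moebius : ArithmeticFunction ℝ) U
      - (trunc vonMangoldt V * trunc (moebius : ArithmeticFunction ℝ) U) * (zeta : ArithmeticFunction ℝ)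
      + (vonMangoldt - trunc vonMangoldt V) *
        (((moebius : ArithmeticFunction ℝ) - trunc (moebius : ArithmeticFunction ℝ) U) *
          (zeta : ArithmeticFunction ℝ)) := by
  have h1 : (moebius : ArithmeticFunction ℝ) * (zeta : ArithmeticFunction ℝ) = 1 := coe_moebius_mul_coe_zeta
  have h2 : vonMangoldt * (zeta : ArithmeticFunction ℝ) = ArithmeticFunction.log := vonMangoldt_mul_zeta
  rw [← h2]
  linear_combination (-(vonMangoldt - trunc vonMangoldt V)) * h1

lemma abs_trunc_moebius_le (U n : ℕ) : |trunc (moebius : ArithmeticFunction ℝ) U n| ≤ 1 := by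
  rw [trunc_apply]
  split_ifs
  · rw [intCoe_apply]
    exact_mod_cast abs_moebius_le_one
  · simp

lemma abs_conv_trunc_le (U V n : ℕ) :
    |(trunc vonMangoldt V * trunc (moebius : ArithmeticFunction ℝ) U) n| ≤ Real.log n := by
  rw [mul_apply, ← vonMangoldt_sum, ← Nat.sum_divisorsAntidiagonal (f := fun i _ => vonMangoldt i)]
  refine (Finset.abs_sum_le_sum_abs _ _).trans (Finset.sum_le_sum fun p _ => ?_)
  rw [abs_mul]
  have h1 := abs_trunc_moebius_le U p.2
  have h2 : |trunc vonMangoldt V p.1| ≤ vonMangoldt p.1 := by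
    rw [trunc_apply]
    split_ifs
    · rw [abs_of_nonneg vonMangoldt_nonneg]
    · simp [vonMangoldt_nonneg]
  have h3 : 0 ≤ vonMangoldt p.1 := vonMangoldt_nonneg
  calc _ ≤ vonMangoldt p.1 * 1 := by gcongr
    _ = _ := mul_one _

lemma conv_trunc_eq_zero {U V n : ℕ} (h : U * V < n) :
    (trunc vonMangoldt V * trunc (moebius : ArithmeticFunction ℝ) U) n = 0 := by
  rw [mul_apply]
  refine Finset.sum_eq_zero fun p hp => ?_
  rw [Nat.mem_divisorsAntidiagonal] at hp
  rw [trunc_apply, trunc_apply]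
  split_ifs with h1 h2
  · have := Nat.mul_le_mul h1 h2
    rw [hp.1, mul_comm] at this
    omega
  all_goals simp

lemma abs_moebius_tail_conv_le (U n : ℕ) :
    |(((moebius : ArithmeticFunction ℝ) - trunc (moebius : ArithmeticFunction ℝ) U) *
          (zeta : ArithmeticFunction ℝ)) n| ≤ n.divisors.card := by
  rw [coe_mul_zeta_apply]
  refine (Finset.abs_sum_le_sum_abs _ _).trans ?_
  have : ∀ i ∈ n.divisors,
      |((moebius : ArithmeticFunction ℝ) - trunc (moebius : ArithmeticFunction ℝ) U) i| ≤ 1 := by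
    intro i _
    rw [arith_sub_apply, trunc_apply]
    split_ifs
    · simp
    · rw [sub_zero, intCoe_apply]
      exact_mod_cast abs_moebius_le_one
  refine (Finset.sum_le_sum this).trans ?_
  simp

lemma moebius_tail_conv_eq_zero {U n : ℕ} (h : n ≤ U) :
    (((moebius : ArithmeticFunction ℝ) - trunc (moebius : ArithmeticFunction ℝ) U) *
          (zeta : ArithmeticFunction ℝ)) n = 0 := by
  rw [coe_mul_zeta_apply]
  refine Finset.sum_eq_zero fun i hi => ?_
  have := Nat.divisor_le hi
  rw [arith_sub_apply, trunc_apply, if_pos (by omega), sub_self]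

end Vaughan

lemma norm_sum_log_mul_le (N : ℕ) (F : ℕ → ℂ) (W : ℝ)
    (hW : ∀ j, ‖∑ k ∈ Finset.Ioc 0 N with j < k, F k‖ ≤ W) :
    ‖∑ k ∈ Finset.Ioc 0 N, (Real.log k : ℂ) * F k‖ ≤ Real.log N * W := by
  rcases Nat.eq_zero_or_pos N with rfl | hN
  · simp
  have tel : ∀ k : ℕ, 1 ≤ k → Real.log k =
      ∑ j ∈ Finset.Ico (1 : ℕ) k, (Real.log ((j + 1 : ℕ):ℝ) - Real.log (j:ℝ)) := by
    intro k hk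
    induction k, hk using Nat.le_induction with
    | base => simp
    | succ n hn ih => rw [Finset.sum_Ico_succ_top hn, ← ih]; ring
  have h1 : ∑ k ∈ Finset.Ioc 0 N, (Real.log k : ℂ) * F k =
      ∑ j ∈ Finset.Ico 1 N, ((Real.log ((j + 1 : ℕ):ℝ) - Real.log (j:ℝ) : ℝ) : ℂ) *
        ∑ k ∈ Finset.Ioc 0 N with j < k, F k := by
    have : ∀ k ∈ Finset.Ioc 0 N, (Real.log k : ℂ) * F k =
        ∑ j ∈ Finset.Ico 1 N, if j < k then
          ((Real.log ((j + 1 : ℕ):ℝ) - Real.log (j:ℝ) : ℝ) : ℂ) * F k else 0 := by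
      intro k hk
      rw [Finset.mem_Ioc] at hk
      rw [← Finset.sum_filter, ← Finset.sum_mul, ← Complex.ofReal_sum, tel k hk.1]
      congr 3
      ext j
      simp only [Finset.mem_Ico, Finset.mem_filter]
      omega
    rw [Finset.sum_congr rfl this, Finset.sum_comm]
    refine Finset.sum_congr rfl fun j _ => ?_
    rw [Finset.sum_filter, Finset.mul_sum]
    refine Finset.sum_congr rfl fun k _ => ?_
    split_ifs <;> simp
  rw [h1]
  refine (norm_sum_le _ _).trans ?_
  rw [tel N hN, Finset.sum_mul]
  refine Finset.sum_le_sum fun j hj => ?_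
  rw [Finset.mem_Ico] at hj
  have h2 : 0 ≤ Real.log ((j + 1 : ℕ):ℝ) - Real.log (j:ℝ) :=
    sub_nonneg.mpr (Real.log_le_log (by exact_mod_cast hj.1) (by push_cast; linarith))
  rw [norm_mul, Complex.norm_real, Real.norm_of_nonneg h2]
  exact mul_le_mul_of_nonneg_left (hW j) h2

lemma exists_inner_bound {c : ℝ} (hc : 1 < c) (hc2 : c < 2) :
    ∃ C > 0, ∀ X y : ℝ, 0 < y → ∀ d : ℕ, 1 ≤ d → 8 * (d:ℝ) ≤ X → ∀ j : ℕ,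
      ‖∑ k ∈ Finset.Ioc 0 ⌊X⌋₊ with j < k, osc c X y (d * k)‖ ≤
        C * (√(y * X ^ c) + X / √(y * X ^ c) * (1 / (d:ℝ))) := by
  obtain ⟨C, hC, hmon⟩ := exists_monomial_bound_ordConnected hc hc2
  refine ⟨C * √(8 ^ c), by positivity, fun X y hy d hd hdX j => ?_⟩
  have hd0 : (0:ℝ) < d := by exact_mod_cast hd
  have hX : 0 < X := by linarith
  have h8 : (1:ℝ) ≤ 8 ^ c := one_le_rpow (by norm_num) (by linarith)
  unfold osc
  rw [← Finset.sum_filter]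
  have e : ∀ k : ℕ, y * ((d * k : ℕ):ℝ) ^ c = (y * (d:ℝ) ^ c) * (k:ℝ) ^ c := fun k => by
    push_cast
    rw [mul_rpow (by positivity) (by positivity)]
    ring
  simp_rw [e]
  have hz : 0 < y * (d:ℝ) ^ c := by positivity
  refine (hmon _ (X / (8 * d)) hz.ne' (by rw [le_div_iff₀ (by positivity)]; linarith) _ ?_ ?_).trans ?_
  · intro x hx w hw v hxv hvw
    simp only [Finset.mem_filter, Finset.mem_Ioc] at hx hw ⊢
    have e1 : ((d * x : ℕ):ℝ) ≤ ((d * v : ℕ):ℝ) := by exact_mod_cast Nat.mul_le_mul_left _ hxv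
    have e2 : ((d * v : ℕ):ℝ) ≤ ((d * w : ℕ):ℝ) := by exact_mod_cast Nat.mul_le_mul_left _ hvw
    refine ⟨⟨⟨by omega, by omega⟩, by omega⟩, by linarith [hx.2.1], by linarith [hw.2.2]⟩
  · intro n hn
    simp only [Finset.mem_filter, Finset.mem_Ioc] at hn
    have := hn.2
    push_cast at this
    constructor
    · rw [div_le_iff₀ (by positivity)]
      nlinarith
    · rw [mul_div_assoc', le_div_iff₀ (by positivity)]
      nlinarith
  · have e1 : |y * (d:ℝ) ^ c| * (X / (8 * d)) ^ c = y * X ^ c / 8 ^ c := by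
      rw [abs_of_pos hz, div_rpow hX.le (by positivity), mul_rpow (by norm_num) hd0.le]
      field_simp
    rw [e1]
    have h8' : 1 ≤ √((8:ℝ) ^ c) := one_le_sqrt.mpr h8
    have hs : 0 < √(y * X ^ c) := sqrt_pos.mpr (by positivity)
    rw [sqrt_div (by positivity)]
    set s := √(y * X ^ c)
    set t := √((8:ℝ) ^ c)
    have q1 : s / t ≤ t * s := by
      rw [div_le_iff₀ (by positivity)]
      nlinarith [mul_nonneg hs.le (by nlinarith : (0:ℝ) ≤ t * t - 1)]
    have q2 : X / (8 * d) / (s / t) ≤ t * (X / s * (1 / d)) := by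
      have : X / (8 * d) / (s / t) = t * (X / s * (1 / d)) / 8 := by field_simp
      rw [this]
      have : 0 ≤ t * (X / s * (1 / d)) := by positivity
      linarith
    calc C * (s / t + X / (8 * d) / (s / t)) ≤ C * (t * s + t * (X / s * (1 / d))) := by gcongr
      _ = _ := by ring

/-- Type I sums, with a smooth inner variable whose weight is `1` or `log`. -/
lemma typeI_bound {X s t W L : ℝ} {c y : ℝ} (ht : 0 ≤ t) (hL : 0 ≤ L)
    (α : ℕ → ℝ) (g : ℕ → ℂ) (D : ℕ) (hα : ∀ n ≤ D, |α n| ≤ L) (hα0 : ∀ n, D < n → α n = 0)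
    (hD : D ≤ ⌊X⌋₊) (hW : 0 ≤ W)
    (hg : ∀ d, 1 ≤ d → d ≤ D → ‖∑ k ∈ Finset.Ioc 0 ⌊X⌋₊, g k * osc c X y (d * k)‖ ≤
      W * (s + t * (1 / (d:ℝ)))) :
    ‖∑ d ∈ Finset.Ioc 0 ⌊X⌋₊, ∑ k ∈ Finset.Ioc 0 ⌊X⌋₊, (α d : ℂ) * (g k * osc c X y (d * k))‖ ≤
      L * W * (D * s + t * (1 + Real.log D)) := by
  have h1 : ∑ d ∈ Finset.Ioc 0 ⌊X⌋₊, ∑ k ∈ Finset.Ioc 0 ⌊X⌋₊, (α d : ℂ) * (g k * osc c X y (d * k))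
      = ∑ d ∈ Finset.Ioc 0 D, (α d : ℂ) * ∑ k ∈ Finset.Ioc 0 ⌊X⌋₊, g k * osc c X y (d * k) := by
    simp_rw [← Finset.mul_sum]
    refine (Finset.sum_subset (Finset.Ioc_subset_Ioc_right hD) fun d hd hd' => ?_).symm
    rw [Finset.mem_Ioc] at hd hd'
    rw [hα0 d (by omega)]
    simp
  rw [h1]
  refine (norm_sum_le _ _).trans ?_
  calc _ ≤ ∑ d ∈ Finset.Ioc 0 D, L * (W * (s + t * (1 / (d:ℝ)))) := by
        refine Finset.sum_le_sum fun d hd => ?_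
        rw [Finset.mem_Ioc] at hd
        rw [norm_mul, Complex.norm_real, Real.norm_eq_abs]
        have := hα d hd.2
        have := hg d hd.1 hd.2
        gcongr
    _ = L * W * (D * s + t * ∑ d ∈ Finset.Ioc 0 D, 1 / (d:ℝ)) := by
        simp_rw [← Finset.mul_sum, Finset.sum_add_distrib, ← Finset.mul_sum]
        rw [Finset.sum_const, Nat.card_Ioc, nsmul_eq_mul, Nat.sub_zero, mul_assoc]
    _ ≤ _ := by
        gcongr
        exact sum_Ioc_one_div_le D

set_option maxHeartbeats 1000000 in
/-- Type II estimate for a rectangle `M × N`, `N ≤ M`, `MN = X/16`, where `X = w^20`. -/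
lemma exists_typeII_block {c : ℝ} (hc : 1 < c) (hc2 : c < 2) :
    ∃ C > 0, ∀ w y M N L : ℝ, 2 ≤ w → 0 < y → 1 ≤ M → 1 ≤ N → 0 ≤ L →
      1 ≤ y * (w ^ 20) ^ c → y * (w ^ 20) ^ c ≤ w ^ 27 →
      M * N = w ^ 20 / 16 → N ≤ M → w ^ 2 / 16 ≤ N →
      ∀ A B : Finset ℕ, (∀ x ∈ A, ∀ z ∈ A, ∀ y, x ≤ y → y ≤ z → y ∈ A) →
      (∀ m ∈ A, M ≤ m ∧ (m:ℝ) ≤ 16 * M) → (∀ k ∈ B, N ≤ k ∧ (k:ℝ) ≤ 16 * N) →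
      ∀ a b : ℕ → ℂ, ∑ m ∈ A, ‖a m‖ ^ 2 ≤ 16 * M * L → ∑ k ∈ B, ‖b k‖ ^ 2 ≤ 16 * N * L →
      ‖∑ m ∈ A, ∑ k ∈ B, a m * (b k * osc c (w ^ 20) y (m * k))‖ ^ 2 ≤
        C * L ^ 2 * (w ^ 20) ^ 2 * (1 / √(y * (w ^ 20) ^ c) + 1 / w) := by
  obtain ⟨C, hC, hbil⟩ := exists_bilinear_bound hc hc2
  refine ⟨C * 36, by positivity, fun w y M N L hw hy hM hN hL hT1 hT2 hMN hNM hNw A B hA hAr hBr a b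
    ha hb => ?_⟩
  set T := y * (w ^ 20) ^ c with hT
  have hw0 : 0 < w := by linarith
  have hT0 : 0 < T := by linarith
  have hM0 : 0 < M := by linarith
  have hN0 : 0 < N := by linarith
  set T' := y * M ^ c * N ^ c with hT'
  have hTT' : T' = T / 16 ^ c := by
    rw [hT', mul_assoc, ← mul_rpow hM0.le hN0.le, hMN, div_rpow (by positivity) (by norm_num), hT]
    ring
  have h16 : (1:ℝ) ≤ 16 ^ c := one_le_rpow (by norm_num) (by linarith)
  have h16' : (16:ℝ) ^ c ≤ 256 := by
    have : (16:ℝ) ^ c ≤ 16 ^ (2:ℝ) := rpow_le_rpow_of_exponent_le (by norm_num) hc2.le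
    norm_num at this ⊢
    exact this
  have hT'0 : 0 < T' := by positivity
  have hT'le : T' ≤ T := by rw [hTT']; exact div_le_self hT0.le h16
  have hT'ge : T ≤ 256 * T' := by
    rw [hTT', mul_div_assoc', le_div_iff₀ (by positivity)]
    nlinarith
  have hMsq : w ^ 20 / 16 ≤ M ^ 2 := by rw [← hMN]; nlinarith
  have hNsq : N ^ 2 ≤ w ^ 20 / 16 := by rw [← hMN]; nlinarith
  have hMge : w ^ 10 / 4 ≤ M := by
    refine le_of_sq_le_sq ?_ hM0.le
    calc (w ^ 10 / 4) ^ 2 = w ^ 20 / 16 := by ring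
      _ ≤ _ := hMsq
  have hNle : N ≤ w ^ 10 / 4 := by
    refine le_of_sq_le_sq ?_ (by positivity)
    calc N ^ 2 ≤ w ^ 20 / 16 := hNsq
      _ = _ := by ring
  have hsT : 0 < √T := sqrt_pos.mpr hT0
  obtain ⟨Q, hQ1, hQN, q1, q2, q3⟩ : ∃ Q : ℕ, 1 ≤ Q ∧ (Q:ℝ) ≤ 16 * N ∧ 1 / (Q:ℝ) ≤ 16 / w ∧
      √(T' * Q / N) ≤ 12 / w * M ∧ √(N / (T' * Q)) ≤ 16 / √T + 8 / w := by
    rcases le_or_gt T (w ^ 18) with hle | hgt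
    · have hQ1 : N ≤ (⌈N⌉₊ : ℝ) := Nat.le_ceil N
      have hQ2 : (⌈N⌉₊ : ℝ) ≤ 2 * N := by linarith [Nat.ceil_lt_add_one hN0.le]
      have hQ0 : (0:ℝ) < (⌈N⌉₊ : ℝ) := by linarith
      refine ⟨⌈N⌉₊, Nat.one_le_ceil_iff.mpr hN0, by linarith, ?_, ?_, ?_⟩
      · rw [div_le_div_iff₀ hQ0 hw0]
        nlinarith
      · refine sqrt_le_iff.mpr ⟨by positivity, ?_⟩
        rw [div_le_iff₀ hN0]
        have h1 : T' * ⌈N⌉₊ ≤ w ^ 18 * (2 * N) := by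
          have := hT'le.trans hle
          gcongr
        have h2 : 2 * w ^ 18 ≤ (12 / w * M) ^ 2 := by
          rw [mul_pow, div_pow, div_mul_eq_mul_div, le_div_iff₀ (by positivity)]
          calc 2 * w ^ 18 * w ^ 2 = 2 * w ^ 20 := by ring
            _ ≤ 12 ^ 2 * (w ^ 20 / 16) := by nlinarith [pow_pos hw0 20]
            _ ≤ _ := by gcongr
        calc _ ≤ w ^ 18 * (2 * N) := h1
          _ = (2 * w ^ 18) * N := by ring
          _ ≤ _ := by gcongr
      · have : √(N / (T' * ⌈N⌉₊)) ≤ 16 / √T := by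
          refine sqrt_le_iff.mpr ⟨by positivity, ?_⟩
          rw [div_pow, sq_sqrt hT0.le, div_le_div_iff₀ (by positivity) hT0]
          calc N * T ≤ ⌈N⌉₊ * (256 * T') := by gcongr
            _ = _ := by ring
        have h8 : 0 ≤ 8 / w := by positivity
        linarith
    · have hQ1 : w ≤ (⌈w⌉₊ : ℝ) := Nat.le_ceil w
      have hQ2 : (⌈w⌉₊ : ℝ) ≤ 2 * w := by linarith [Nat.ceil_lt_add_one hw0.le]
      have hQ0 : (0:ℝ) < (⌈w⌉₊ : ℝ) := by linarith
      refine ⟨⌈w⌉₊, Nat.one_le_ceil_iff.mpr hw0, by nlinarith, ?_, ?_, ?_⟩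
      · rw [div_le_div_iff₀ hQ0 hw0]
        nlinarith
      · refine sqrt_le_iff.mpr ⟨by positivity, ?_⟩
        rw [mul_pow, div_pow, div_mul_eq_mul_div, div_le_div_iff₀ hN0 (by positivity)]
        calc T' * ⌈w⌉₊ * w ^ 2 ≤ w ^ 27 * (2 * w) * w ^ 2 := by
              have := hT'le.trans hT2
              gcongr
          _ = 2 * w ^ 30 := by ring
          _ ≤ 144 * (w ^ 20 / 16) * (w ^ 10 / 4) := by nlinarith [pow_pos hw0 30]
          _ ≤ 144 * (w ^ 20 / 16) * M := by gcongr
          _ = 12 ^ 2 * M ^ 2 * N := by rw [← hMN]; ring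
      · have : √(N / (T' * ⌈w⌉₊)) ≤ 8 / w := by
          refine sqrt_le_iff.mpr ⟨by positivity, ?_⟩
          rw [div_pow, div_le_div_iff₀ (by positivity) (by positivity)]
          have hp : w ^ 12 ≤ w ^ 19 := pow_le_pow_right₀ (by linarith) (by norm_num)
          have h18 : w ^ 18 / 256 ≤ T' := by linarith
          calc N * w ^ 2 ≤ w ^ 10 / 4 * w ^ 2 := by gcongr
            _ = w ^ 12 / 4 := by ring
            _ ≤ 8 ^ 2 * (w ^ 18 / 256 * w) := by ring_nf; ring_nf at hp; linarith
            _ ≤ 8 ^ 2 * (T' * ⌈w⌉₊) := by gcongr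
        have h8 : 0 ≤ 16 / √T := by positivity
        linarith
  refine (hbil (w ^ 20) y M N hy hM hN Q hQ1 hQN A B hA hAr hBr a b).trans ?_
  have hQ0 : (0:ℝ) < Q := by exact_mod_cast hQ1
  have key : M * N / Q + N * √(T' * Q / N) + M * N * √(N / (T' * Q)) ≤
      M * N * (36 * (1 / √T + 1 / w)) := by
    have e1 : M * N / Q ≤ M * N * (16 / w) := by
      calc M * N / Q = M * N * (1 / Q) := by ring
        _ ≤ _ := by gcongr
    have e2 : N * √(T' * Q / N) ≤ M * N * (12 / w) := by
      calc _ ≤ N * (12 / w * M) := by gcongr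
        _ = _ := by ring
    have e3 : M * N * √(N / (T' * Q)) ≤ M * N * (16 / √T + 8 / w) := by gcongr
    have e4 : M * N * (36 * (1 / √T + 1 / w)) = M * N * (16 / w) + M * N * (12 / w) +
        M * N * (16 / √T + 8 / w) + M * N * (20 / √T) := by ring
    have : 0 ≤ M * N * (20 / √T) := by positivity
    linarith
  calc _ ≤ C * (16 * M * L) * (16 * N * L) * (M * N * (36 * (1 / √T + 1 / w))) := by gcongr
    _ = C * 36 * L ^ 2 * (16 * (M * N)) ^ 2 * (1 / √T + 1 / w) := by ring
    _ = _ := by rw [hMN]; ring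

lemma osc_eq_zero_of_lt {c X y : ℝ} {n : ℕ} (h : ⌊X⌋₊ < n) : osc c X y n = 0 := by
  unfold osc
  rw [if_neg]
  rintro ⟨-, h2⟩
  exact absurd (Nat.le_floor h2) (not_le.mpr h)

lemma sum_sq_le_of_subset {X M L : ℝ} {α : ℕ → ℝ} (hM : 0 ≤ M) (hL : 0 ≤ L)
    (hα : ∀ x : ℕ, x ≤ ⌊X⌋₊ → ∑ m ∈ Finset.Ioc 0 x, α m ^ 2 ≤ x * L) {A : Finset ℕ}
    (hA : A ⊆ Finset.Ioc 0 ⌊X⌋₊) (hAr : ∀ m ∈ A, (m:ℝ) ≤ 16 * M) :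
    ∑ m ∈ A, ‖(α m : ℂ)‖ ^ 2 ≤ 16 * M * L := by
  have h1 : A ⊆ Finset.Ioc 0 (min ⌊X⌋₊ ⌊16 * M⌋₊) := fun m hm => by
    have h2 := Finset.mem_Ioc.mp (hA hm)
    have h3 := Nat.le_floor (hAr m hm)
    rw [Finset.mem_Ioc]
    omega
  calc ∑ m ∈ A, ‖(α m : ℂ)‖ ^ 2 = ∑ m ∈ A, α m ^ 2 := by simp
    _ ≤ ∑ m ∈ Finset.Ioc 0 (min ⌊X⌋₊ ⌊16 * M⌋₊), α m ^ 2 :=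
        Finset.sum_le_sum_of_subset_of_nonneg h1 fun _ _ _ => sq_nonneg _
    _ ≤ (min ⌊X⌋₊ ⌊16 * M⌋₊ : ℕ) * L := hα _ (min_le_left _ _)
    _ ≤ 16 * M * L := by
        gcongr
        exact le_trans (by exact_mod_cast min_le_right _ _) (Nat.floor_le (by positivity))

lemma exists_typeII_dyadic {c : ℝ} (hc : 1 < c) (hc2 : c < 2) :
    ∃ C > 0, ∀ w y L : ℝ, 4 ≤ w → 0 < y → 0 ≤ L →
      1 ≤ y * (w ^ 20) ^ c → y * (w ^ 20) ^ c ≤ w ^ 27 → ∀ α β : ℕ → ℝ,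
      (∀ m : ℕ, (m:ℝ) ≤ w ^ 2 → α m = 0) → (∀ m : ℕ, (m:ℝ) ≤ w ^ 2 → β m = 0) →
      (∀ x : ℕ, x ≤ ⌊w ^ 20⌋₊ → ∑ m ∈ Finset.Ioc 0 x, α m ^ 2 ≤ x * L) →
      (∀ x : ℕ, x ≤ ⌊w ^ 20⌋₊ → ∑ m ∈ Finset.Ioc 0 x, β m ^ 2 ≤ x * L) → ∀ j : ℕ,
      ‖∑ m ∈ Finset.Ioc 0 ⌊w ^ 20⌋₊ with Nat.log 2 m = j, ∑ k ∈ Finset.Ioc 0 ⌊w ^ 20⌋₊,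
        (α m : ℂ) * ((β k : ℂ) * osc c (w ^ 20) y (m * k))‖ ≤
        C * L * w ^ 20 * √(1 / √(y * (w ^ 20) ^ c) + 1 / w) := by
  obtain ⟨C, hC, hblock⟩ := exists_typeII_block hc hc2
  refine ⟨√C, sqrt_pos.mpr hC, fun w y L hw hy hL hT1 hT2 α β hα0 hβ0 hα hβ j => ?_⟩
  have hw0 : 0 < w := by linarith
  set X := w ^ 20 with hX
  have hX0 : 0 < X := by positivity
  set E := 1 / √(y * X ^ c) + 1 / w with hE
  have hE0 : 0 ≤ E := by positivity
  set M : ℝ := 2 ^ j with hM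
  have hM1 : 1 ≤ M := one_le_pow₀ (by norm_num)
  have hM0 : 0 < M := by linarith
  set N : ℝ := X / (16 * M) with hN
  have hN0 : 0 < N := by positivity
  have hMN : M * N = X / 16 := by rw [hN]; field_simp
  set A := (Finset.Ioc 0 ⌊X⌋₊).filter (fun m => Nat.log 2 m = j) with hA
  set B := (Finset.Ioc 0 ⌊X⌋₊).filter (fun k : ℕ => N ≤ (k:ℝ) ∧ (k:ℝ) ≤ 16 * N) with hB
  have hAr' : ∀ m ∈ A, M ≤ m ∧ (m:ℝ) ≤ 2 * M := by
    intro m hm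
    rw [hA, Finset.mem_filter, Finset.mem_Ioc] at hm
    have h1 := Nat.pow_log_le_self 2 (x := m) (by omega)
    have h2 := Nat.lt_pow_succ_log_self (b := 2) (by norm_num) m
    rw [hm.2] at h1 h2
    refine ⟨by rw [hM]; exact_mod_cast h1, ?_⟩
    have h3 : (m:ℝ) ≤ 2 ^ (j + 1) := by exact_mod_cast h2.le
    rw [hM]
    calc (m:ℝ) ≤ 2 ^ (j + 1) := h3
      _ = _ := by ring
  have hAr : ∀ m ∈ A, M ≤ m ∧ (m:ℝ) ≤ 16 * M := fun m hm =>
    ⟨(hAr' m hm).1, by linarith [(hAr' m hm).2]⟩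
  have hBr : ∀ k ∈ B, N ≤ k ∧ (k:ℝ) ≤ 16 * N := fun k hk => (Finset.mem_filter.mp hk).2
  have hAo : ∀ x ∈ A, ∀ z ∈ A, ∀ y, x ≤ y → y ≤ z → y ∈ A := by
    intro x hx z hz v hxv hvz
    rw [hA, Finset.mem_filter, Finset.mem_Ioc] at hx hz ⊢
    have h1 := Nat.log_mono_right (b := 2) hxv
    have h2 := Nat.log_mono_right (b := 2) hvz
    omega
  have hBo : ∀ x ∈ B, ∀ z ∈ B, ∀ y, x ≤ y → y ≤ z → y ∈ B := by
    intro x hx z hz v hxv hvz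
    rw [hB, Finset.mem_filter, Finset.mem_Ioc] at hx hz ⊢
    have h1 : (x:ℝ) ≤ v := by exact_mod_cast hxv
    have h2 : (v:ℝ) ≤ z := by exact_mod_cast hvz
    exact ⟨by omega, by linarith [hx.2.1], by linarith [hz.2.2]⟩
  have hres : ∑ m ∈ A, ∑ k ∈ Finset.Ioc 0 ⌊X⌋₊, (α m : ℂ) * ((β k : ℂ) * osc c X y (m * k)) =
      ∑ m ∈ A, ∑ k ∈ B, (α m : ℂ) * ((β k : ℂ) * osc c X y (m * k)) := by
    refine Finset.sum_congr rfl fun m hm => ?_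
    refine (Finset.sum_filter_of_ne fun k hk hne => ?_).symm
    have hosc : osc c X y (m * k) ≠ 0 := fun h => hne (by rw [h]; simp)
    unfold osc at hosc
    have hcond : X / 8 < ((m * k : ℕ):ℝ) ∧ ((m * k : ℕ):ℝ) ≤ X := by
      by_contra h
      exact hosc (if_neg h)
    push_cast at hcond
    obtain ⟨l1, l2⟩ := hAr' m hm
    have hk0 : (0:ℝ) ≤ k := by positivity
    constructor
    · rw [hN, div_le_iff₀ (by positivity)]
      nlinarith
    · rw [hN, mul_div_assoc', le_div_iff₀ (by positivity)]
      nlinarith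
  rw [hres]
  have hR0 : 0 ≤ √C * L * X * √E := by positivity
  by_cases hA1 : ∃ m ∈ A, w ^ 2 < (m:ℝ)
  swap
  · push Not at hA1
    rw [Finset.sum_eq_zero fun m hm => by rw [hα0 m (hA1 m hm)]; simp, norm_zero]
    exact hR0
  by_cases hB1 : ∃ k ∈ B, w ^ 2 < (k:ℝ)
  swap
  · push Not at hB1
    rw [Finset.sum_eq_zero fun m hm => Finset.sum_eq_zero fun k hk => by
      rw [hβ0 k (hB1 k hk)]; simp, norm_zero]
    exact hR0
  obtain ⟨m, hm, hmw⟩ := hA1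
  obtain ⟨k, hk, hkw⟩ := hB1
  have hNw : w ^ 2 / 16 ≤ N := by linarith [(hBr k hk).2]
  have hMw : w ^ 2 / 16 ≤ M := by linarith [(hAr m hm).2]
  have hN1 : 1 ≤ N := by nlinarith
  have hsA := sum_sq_le_of_subset hM0.le hL hα (Finset.filter_subset _ _) (fun m hm => (hAr m hm).2)
  have hsB := sum_sq_le_of_subset hN0.le hL hβ (Finset.filter_subset _ _) (fun m hm => (hBr m hm).2)
  have hsq : ‖∑ m ∈ A, ∑ k ∈ B, (α m : ℂ) * ((β k : ℂ) * osc c X y (m * k))‖ ^ 2 ≤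
      C * L ^ 2 * X ^ 2 * E := by
    rcases le_total N M with h | h
    · exact hblock w y M N L (by linarith) hy hM1 hN1 hL hT1 hT2 hMN h hNw A B hAo hAr hBr _ _ hsA hsB
    · rw [Finset.sum_comm]
      have := hblock w y N M L (by linarith) hy hN1 hM1 hL hT1 hT2 (by rw [mul_comm]; exact hMN) h
        hMw B A hBo hBr hAr (fun k => (β k : ℂ)) (fun k => (α k : ℂ)) hsB hsA
      have e : ∑ k ∈ B, ∑ m ∈ A, (α m : ℂ) * ((β k : ℂ) * osc c X y (m * k)) =
          ∑ k ∈ B, ∑ m ∈ A, (β k : ℂ) * ((α m : ℂ) * osc c X y (k * m)) :=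
        Finset.sum_congr rfl fun k _ => Finset.sum_congr rfl fun m _ => by
          rw [mul_comm m k]
          ring
      rw [e]
      exact this
  refine le_of_sq_le_sq ?_ hR0
  calc _ ≤ C * L ^ 2 * X ^ 2 * E := hsq
    _ = (√C * L * X * √E) ^ 2 := by
      rw [mul_pow, mul_pow, mul_pow, sq_sqrt hC.le, sq_sqrt hE0]

lemma natLog_two_add_one_le {X : ℝ} (hX : 3 ≤ X) : ((Nat.log 2 ⌊X⌋₊ + 1 : ℕ) : ℝ) ≤ 3 * log X := by
  have h1 : (⌊X⌋₊ : ℝ) ≤ X := Nat.floor_le (by linarith)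
  have h0 : ⌊X⌋₊ ≠ 0 := by
    have : 3 ≤ ⌊X⌋₊ := Nat.le_floor (by exact_mod_cast hX)
    omega
  have h2 := Nat.pow_log_le_self 2 h0
  have h3 : (2:ℝ) ^ (Nat.log 2 ⌊X⌋₊) ≤ X := le_trans (by exact_mod_cast h2) h1
  have h4 := log_le_log (by positivity) h3
  rw [log_pow] at h4
  have h5 := log_two_gt_d9
  have h6 : 1 ≤ log X := by
    rw [le_log_iff_exp_le (by linarith)]
    linarith [exp_one_lt_d9]
  push_cast
  nlinarith

lemma exists_typeII_bound {c : ℝ} (hc : 1 < c) (hc2 : c < 2) :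
    ∃ C > 0, ∀ w y L : ℝ, 4 ≤ w → 0 < y → 0 ≤ L →
      1 ≤ y * (w ^ 20) ^ c → y * (w ^ 20) ^ c ≤ w ^ 27 → ∀ α β : ℕ → ℝ,
      (∀ m : ℕ, (m:ℝ) ≤ w ^ 2 → α m = 0) → (∀ m : ℕ, (m:ℝ) ≤ w ^ 2 → β m = 0) →
      (∀ x : ℕ, x ≤ ⌊w ^ 20⌋₊ → ∑ m ∈ Finset.Ioc 0 x, α m ^ 2 ≤ x * L) →
      (∀ x : ℕ, x ≤ ⌊w ^ 20⌋₊ → ∑ m ∈ Finset.Ioc 0 x, β m ^ 2 ≤ x * L) →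
      ‖∑ m ∈ Finset.Ioc 0 ⌊w ^ 20⌋₊, ∑ k ∈ Finset.Ioc 0 ⌊w ^ 20⌋₊,
        (α m : ℂ) * ((β k : ℂ) * osc c (w ^ 20) y (m * k))‖ ≤
        C * L * log (w ^ 20) * w ^ 20 * √(1 / √(y * (w ^ 20) ^ c) + 1 / w) := by
  obtain ⟨C, hC, hd⟩ := exists_typeII_dyadic hc hc2
  refine ⟨3 * C, by positivity, fun w y L hw hy hL hT1 hT2 α β hα0 hβ0 hα hβ => ?_⟩
  have hX3 : 3 ≤ w ^ 20 := by
    have : (4:ℝ) ^ 20 ≤ w ^ 20 := by gcongr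
    norm_num at this
    linarith
  have hmaps : ∀ m ∈ Finset.Ioc 0 ⌊w ^ 20⌋₊, Nat.log 2 m ∈ Finset.range (Nat.log 2 ⌊w ^ 20⌋₊ + 1) := by
    intro m hm
    rw [Finset.mem_range]
    exact Nat.lt_succ_of_le (Nat.log_mono_right (Finset.mem_Ioc.mp hm).2)
  rw [← Finset.sum_fiberwise_of_maps_to hmaps]
  refine (norm_sum_le _ _).trans ?_
  refine (Finset.sum_le_sum fun j _ => hd w y L hw hy hL hT1 hT2 α β hα0 hβ0 hα hβ j).trans ?_
  rw [Finset.sum_const, Finset.card_range, nsmul_eq_mul]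
  have := natLog_two_add_one_le hX3
  have hw0 : 0 < w := by linarith
  calc _ ≤ 3 * log (w ^ 20) * (C * L * w ^ 20 * √(1 / √(y * (w ^ 20) ^ c) + 1 / w)) := by gcongr
    _ = _ := by ring

section Assembly
open ArithmeticFunction

lemma le_log_of_two_pow {w : ℝ} (hw : 4 ≤ w) : 1 ≤ Real.log (w ^ 20) := by
  have h : (4:ℝ) ^ 20 ≤ w ^ 20 := by gcongr
  rw [le_log_iff_exp_le (by positivity)]
  norm_num at h
  linarith [exp_one_lt_d9]

/-- Bound for the type I main quantity. -/
lemma typeI_size {w P : ℝ} {D : ℕ} (hw : 4 ≤ w) (hP : 1 ≤ P) (hP2 : P ≤ w ^ 14)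
    (hD : (D:ℝ) ≤ w ^ 4) :
    D * P + w ^ 20 / P * (1 + Real.log D) ≤
      4 * Real.log (w ^ 20) * w ^ 20 * √(1 / P + 1 / w) := by
  have hl := le_log_of_two_pow hw
  have hw0 : 0 < w := by linarith
  have hP0 : 0 < P := by linarith
  set ℓ := Real.log (w ^ 20) with hℓ
  have h1 : D * P ≤ w ^ 20 * (1 / w) := by
    calc D * P ≤ w ^ 4 * w ^ 14 := by gcongr
      _ = w ^ 18 * 1 := by ring
      _ ≤ w ^ 18 * w := by gcongr; linarith
      _ = w ^ 20 * (1 / w) := by field_simp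
  have h2 : Real.log D ≤ ℓ := by
    rcases Nat.eq_zero_or_pos D with rfl | hD0
    · simp; linarith
    · apply Real.log_le_log (by exact_mod_cast hD0)
      exact hD.trans (pow_le_pow_right₀ (by linarith) (by norm_num))
  set E := 1 / P + 1 / w with hE
  have hE0 : 0 ≤ E := by positivity
  have hE2 : E ≤ 4 := by
    have : 1 / P ≤ 1 := by rw [div_le_one hP0]; exact hP
    have : 1 / w ≤ 1 := by rw [div_le_one hw0]; linarith
    linarith
  have hs : √E ≤ 2 := by
    rw [sqrt_le_left (by norm_num)]; linarith
  have hEs : E ≤ 2 * √E := by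
    calc E = √E * √E := (mul_self_sqrt hE0).symm
      _ ≤ 2 * √E := by gcongr
  calc D * P + w ^ 20 / P * (1 + Real.log D)
      ≤ w ^ 20 * (1 / w) * (2 * ℓ) + w ^ 20 / P * (2 * ℓ) := by
        have h3 : w ^ 20 * (1 / w) ≤ w ^ 20 * (1 / w) * (2 * ℓ) :=
          le_mul_of_one_le_right (by positivity) (by linarith)
        have h4 : w ^ 20 / P * (1 + Real.log D) ≤ w ^ 20 / P * (2 * ℓ) := by
          gcongr; linarith
        linarith
    _ = 2 * ℓ * w ^ 20 * E := by rw [hE]; ring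
    _ ≤ 2 * ℓ * w ^ 20 * (2 * √E) := by gcongr
    _ = _ := by ring

lemma vonMangoldt_sub_trunc_abs_le (V n : ℕ) :
    |((vonMangoldt : ArithmeticFunction ℝ) - trunc vonMangoldt V) n| ≤ Real.log n := by
  rw [arith_sub_apply, trunc_apply]
  split_ifs
  · rw [sub_self, abs_zero]
    exact Real.log_natCast_nonneg n
  · rw [sub_zero, abs_of_nonneg vonMangoldt_nonneg]
    exact vonMangoldt_le_log

lemma exists_vonMangoldt_sum_bound {c : ℝ} (hc : 1 < c) (hc2 : c < 2) :
    ∃ C > 0, ∀ w y : ℝ, 4 ≤ w → 0 < y → 1 ≤ y * (w ^ 20) ^ c → y * (w ^ 20) ^ c ≤ w ^ 27 →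
      ‖∑ n ∈ Finset.Ioc 0 ⌊w ^ 20⌋₊, (vonMangoldt n : ℂ) * osc c (w ^ 20) y n‖ ≤
        C * Real.log (w ^ 20) ^ 4 * w ^ 20 * √(1 / √(y * (w ^ 20) ^ c) + 1 / w) := by
  obtain ⟨C₁, hC₁, hI⟩ := exists_inner_bound hc hc2
  obtain ⟨C₂, hC₂, hII⟩ := exists_typeII_bound hc hc2
  refine ⟨8 * C₁ + 8 * C₂, by positivity, fun w y hw hy hT1 hT2 => ?_⟩
  have hl := le_log_of_two_pow hw
  have hw0 : 0 < w := by linarith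
  have hw1 : 1 ≤ w := by linarith
  have hP1 : 1 ≤ √(y * (w ^ 20) ^ c) := one_le_sqrt.mpr hT1
  have hP2 : √(y * (w ^ 20) ^ c) ≤ w ^ 14 := by
    rw [sqrt_le_left (by positivity)]
    refine hT2.trans ?_
    rw [← pow_mul]
    exact pow_le_pow_right₀ hw1 (by norm_num)
  set V := ⌊w ^ 2⌋₊ with hV
  have hVle : (V:ℝ) ≤ w ^ 2 := Nat.floor_le (by positivity)
  have hVV : ((V * V : ℕ):ℝ) ≤ w ^ 4 := by
    push_cast
    calc (V:ℝ) * V ≤ w ^ 2 * w ^ 2 := by gcongr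
      _ = w ^ 4 := by ring
  have hV4 : (V:ℝ) ≤ w ^ 4 := hVle.trans (pow_le_pow_right₀ hw1 (by norm_num))
  have h8 : 8 * w ^ 4 ≤ w ^ 20 := by
    calc 8 * w ^ 4 ≤ 4 ^ 16 * w ^ 4 := by gcongr; norm_num
      _ ≤ w ^ 16 * w ^ 4 := by gcongr
      _ = w ^ 20 := by ring
  have hw4 : (0:ℝ) ≤ w ^ 4 := by positivity
  have hfl : ∀ D : ℕ, (D:ℝ) ≤ w ^ 4 → D ≤ ⌊w ^ 20⌋₊ := fun D hD => Nat.le_floor (by linarith)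
  have hlogN : ∀ n : ℕ, n ≤ ⌊w ^ 20⌋₊ → Real.log n ≤ Real.log (w ^ 20) := fun n hn => by
    rcases Nat.eq_zero_or_pos n with rfl | hn0
    · rw [Nat.cast_zero, Real.log_zero]; linarith
    · exact Real.log_le_log (by exact_mod_cast hn0) ((Nat.le_floor_iff (by positivity)).mp hn)
  set X := w ^ 20 with hX
  set P := √(y * X ^ c) with hP
  set ℓ := Real.log X with hℓ
  set Q := √(1 / P + 1 / w) with hQ
  have hX0 : 0 < X := by positivity
  have hP0 : 0 < P := by linarith
  have hzero : ∀ n, ⌊X⌋₊ < n → osc c X y n = 0 := fun n hn => osc_eq_zero_of_lt hn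
  have h0 : ∑ n ∈ Finset.Ioc 0 ⌊X⌋₊, (vonMangoldt n : ℂ) * osc c X y n =
      ∑ n ∈ Finset.Ioc 0 ⌊X⌋₊,
        ((((vonMangoldt : ArithmeticFunction ℝ) - trunc vonMangoldt V) n : ℝ) : ℂ) * osc c X y n := by
    refine Finset.sum_congr rfl fun n _ => ?_
    rw [arith_sub_apply, trunc_apply]
    split_ifs with h
    · have : osc c X y n = 0 := by
        unfold osc
        rw [if_neg]
        rintro ⟨h3, -⟩
        have : (n:ℝ) ≤ w ^ 4 := le_trans (by exact_mod_cast h) hV4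
        linarith
      rw [this, mul_zero, mul_zero]
    · rw [sub_zero]
  have hsplit : ∑ n ∈ Finset.Ioc 0 ⌊X⌋₊, (vonMangoldt n : ℂ) * osc c X y n =
      (∑ d ∈ Finset.Ioc 0 ⌊X⌋₊, ∑ k ∈ Finset.Ioc 0 ⌊X⌋₊,
        (trunc (moebius : ArithmeticFunction ℝ) V d : ℂ) * ((Real.log k : ℂ) * osc c X y (d * k)))
      - (∑ d ∈ Finset.Ioc 0 ⌊X⌋₊, ∑ k ∈ Finset.Ioc 0 ⌊X⌋₊,
        ((trunc vonMangoldt V * trunc (moebius : ArithmeticFunction ℝ) V) d : ℂ) *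
          (((zeta : ArithmeticFunction ℝ) k : ℂ) * osc c X y (d * k)))
      + ∑ m ∈ Finset.Ioc 0 ⌊X⌋₊, ∑ k ∈ Finset.Ioc 0 ⌊X⌋₊,
        ((((vonMangoldt : ArithmeticFunction ℝ) - trunc vonMangoldt V) m : ℝ) : ℂ) *
        (((((((moebius : ArithmeticFunction ℝ) - trunc (moebius : ArithmeticFunction ℝ) V) *
          (zeta : ArithmeticFunction ℝ)) k : ℝ)) : ℂ) * osc c X y (m * k)) := by
    rw [h0]
    have e : ∀ n, ((((vonMangoldt : ArithmeticFunction ℝ) - trunc vonMangoldt V) n : ℝ) : ℂ) =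
        (((trunc (moebius : ArithmeticFunction ℝ) V * ArithmeticFunction.log) n : ℝ) : ℂ)
        - ((((trunc vonMangoldt V * trunc (moebius : ArithmeticFunction ℝ) V) *
          (zeta : ArithmeticFunction ℝ)) n : ℝ) : ℂ)
        + ((((vonMangoldt - trunc vonMangoldt V) *
          (((moebius : ArithmeticFunction ℝ) - trunc (moebius : ArithmeticFunction ℝ) V) *
          (zeta : ArithmeticFunction ℝ))) n : ℝ) : ℂ) := by
      intro n
      have := congrArg (fun f : ArithmeticFunction ℝ => f n) (vaughan_identity V V)
      simp only [arith_sub_apply, ArithmeticFunction.add_apply] at this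
      rw [mul_comm (trunc (moebius : ArithmeticFunction ℝ) V) ArithmeticFunction.log,
        arith_sub_apply, this]
      push_cast
      rfl
    have e' : ∀ n (z : ℂ), ((((vonMangoldt : ArithmeticFunction ℝ) - trunc vonMangoldt V) n : ℝ) : ℂ) * z =
        (((trunc (moebius : ArithmeticFunction ℝ) V * ArithmeticFunction.log) n : ℝ) : ℂ) * z
        - ((((trunc vonMangoldt V * trunc (moebius : ArithmeticFunction ℝ) V) *
          (zeta : ArithmeticFunction ℝ)) n : ℝ) : ℂ) * z
        + ((((vonMangoldt - trunc vonMangoldt V) *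
          (((moebius : ArithmeticFunction ℝ) - trunc (moebius : ArithmeticFunction ℝ) V) *
          (zeta : ArithmeticFunction ℝ))) n : ℝ) : ℂ) * z := fun n z => by
      rw [e n]; ring
    rw [Finset.sum_congr rfl fun n _ => e' n (osc c X y n)]
    rw [Finset.sum_add_distrib, Finset.sum_sub_distrib, sum_conv_mul _ _ _ _ hzero,
      sum_conv_mul _ _ _ _ hzero, sum_conv_mul _ _ _ _ hzero]
    rfl
  have b1 := typeI_bound (X := X) (s := P) (t := X / P) (W := ℓ * C₁) (L := 1) (c := c) (y := y)
    (by positivity) zero_le_one (fun d => trunc (moebius : ArithmeticFunction ℝ) V d)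
    (fun k => (Real.log k : ℂ)) V (fun n _ => abs_trunc_moebius_le V n)
    (fun n hn => by rw [trunc_apply, if_neg (by omega)]) (hfl V hV4) (by positivity)
    (fun d hd hdV => by
      have hd4 : (d:ℝ) ≤ w ^ 4 := le_trans (by exact_mod_cast hdV) hV4
      have := norm_sum_log_mul_le ⌊X⌋₊ (fun k => osc c X y (d * k)) _
        (hI X y hy d hd (by linarith))
      refine this.trans ?_
      rw [mul_assoc]
      have := hlogN ⌊X⌋₊ le_rfl
      gcongr)
  have b2 := typeI_bound (X := X) (s := P) (t := X / P) (W := C₁) (L := ℓ) (c := c) (y := y)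
    (by positivity) (by linarith)
    (fun d => (trunc vonMangoldt V * trunc (moebius : ArithmeticFunction ℝ) V) d)
    (fun k => (((zeta : ArithmeticFunction ℝ) k : ℝ) : ℂ)) (V * V)
    (fun n hn => (abs_conv_trunc_le V V n).trans (hlogN n (hn.trans (hfl _ hVV))))
    (fun n hn => conv_trunc_eq_zero hn) (hfl _ hVV) (by positivity)
    (fun d hd hdV => by
      have hd4 : (d:ℝ) ≤ w ^ 4 := le_trans (by exact_mod_cast hdV) hVV
      have := hI X y hy d hd (by linarith) 0
      refine le_trans (le_of_eq ?_) this
      congr 1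
      have e2 : (Finset.Ioc 0 ⌊X⌋₊).filter (fun k => 0 < k) = Finset.Ioc 0 ⌊X⌋₊ :=
        Finset.filter_true_of_mem fun k hk => (Finset.mem_Ioc.mp hk).1
      rw [e2]
      refine Finset.sum_congr rfl fun k hk => ?_
      have : k ≠ 0 := by have := (Finset.mem_Ioc.mp hk).1; omega
      simp [natCoe_apply, zeta_apply, this])
  have b3 := hII w y ((1 + ℓ) ^ 3) hw hy (by positivity) hT1 hT2
    (fun n => ((vonMangoldt : ArithmeticFunction ℝ) - trunc vonMangoldt V) n)
    (fun n => ((((moebius : ArithmeticFunction ℝ) - trunc (moebius : ArithmeticFunction ℝ) V) *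
          (zeta : ArithmeticFunction ℝ)) n : ℝ))
    (fun m hm => by
      have hm' : m ≤ V := Nat.le_floor hm
      simp only [arith_sub_apply, trunc_apply, if_pos hm', sub_self])
    (fun m hm => moebius_tail_conv_eq_zero (Nat.le_floor hm))
    (fun x hx => by
      calc _ ≤ ∑ m ∈ Finset.Ioc 0 x, (1 + ℓ) ^ 3 := by
            refine Finset.sum_le_sum fun m hm => ?_
            rw [Finset.mem_Ioc] at hm
            have a1 := vonMangoldt_sub_trunc_abs_le V m
            have a2 := hlogN m (hm.2.trans hx)
            have a3 := abs_nonneg (((vonMangoldt : ArithmeticFunction ℝ) - trunc vonMangoldt V) m)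
            rw [← sq_abs]
            calc _ ≤ (1 + ℓ) ^ 2 := by gcongr; linarith
              _ ≤ (1 + ℓ) ^ 3 := pow_le_pow_right₀ (by linarith) (by norm_num)
        _ = _ := by simp)
    (fun x hx => by
      calc _ ≤ ∑ m ∈ Finset.Ioc 0 x, (m.divisors.card : ℝ) ^ 2 := by
            refine Finset.sum_le_sum fun m hm => ?_
            rw [← sq_abs]
            have := abs_moebius_tail_conv_le V m
            gcongr
        _ ≤ x * (1 + Real.log x) ^ 3 := sum_divisor_sq_le x
        _ ≤ _ := by
            have := hlogN x hx
            have := Real.log_natCast_nonneg x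
            gcongr)
  have t1 := typeI_size hw hP1 hP2 hV4
  have t2 := typeI_size hw hP1 hP2 hVV
  rw [hsplit]
  refine (norm_add_le _ _).trans ?_
  refine (add_le_add_left (norm_sub_le _ _) _).trans ?_
  have hQ0 : 0 ≤ Q := sqrt_nonneg _
  have c1 : 1 * (ℓ * C₁) * (V * P + X / P * (1 + Real.log V)) ≤ 4 * C₁ * (ℓ ^ 4 * X * Q) := by
    calc _ ≤ 1 * (ℓ * C₁) * (4 * ℓ * X * Q) := by gcongr
      _ = 4 * C₁ * (ℓ ^ 2 * X * Q) := by ring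
      _ ≤ 4 * C₁ * (ℓ ^ 4 * X * Q) := by gcongr; norm_num
  have c2 : ℓ * C₁ * (((V * V : ℕ):ℝ) * P + X / P * (1 + Real.log ((V * V : ℕ):ℝ))) ≤
      4 * C₁ * (ℓ ^ 4 * X * Q) := by
    calc _ ≤ ℓ * C₁ * (4 * ℓ * X * Q) := by gcongr
      _ = 4 * C₁ * (ℓ ^ 2 * X * Q) := by ring
      _ ≤ 4 * C₁ * (ℓ ^ 4 * X * Q) := by gcongr; norm_num
  have c3 : C₂ * (1 + ℓ) ^ 3 * ℓ * X * Q ≤ 8 * C₂ * (ℓ ^ 4 * X * Q) := by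
    calc _ ≤ C₂ * (2 * ℓ) ^ 3 * ℓ * X * Q := by gcongr; linarith
      _ = _ := by ring
  calc _ ≤ 4 * C₁ * (ℓ ^ 4 * X * Q) + 4 * C₁ * (ℓ ^ 4 * X * Q) + 8 * C₂ * (ℓ ^ 4 * X * Q) :=
        add_le_add (add_le_add (b1.trans c1) (b2.trans c2)) (b3.trans c3)
    _ = _ := by ring

end Assembly

/-- The weight `log p` on primes. -/
noncomputable def primeWeight (n : ℕ) : ℝ := if n.Prime then Real.log n else 0

/-- The exponential sum `∑ log p · e(x p^c)` over primes `X/8 < p ≤ X`. -/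
noncomputable def primeSum (c X x : ℝ) : ℂ :=
  ∑ n ∈ Finset.Ioc ⌊X / 8⌋₊ ⌊X⌋₊, (primeWeight n : ℂ) * expi (x * (n:ℝ) ^ c)

lemma primeWeight_nonneg (n : ℕ) : 0 ≤ primeWeight n := by
  unfold primeWeight
  split_ifs
  · exact Real.log_natCast_nonneg n
  · exact le_rfl

lemma primeWeight_le_log (n : ℕ) : primeWeight n ≤ Real.log n := by
  unfold primeWeight
  split_ifs
  · exact le_rfl
  · exact Real.log_natCast_nonneg n

lemma primeSum_neg (c X x : ℝ) : primeSum c X (-x) = (starRingEnd ℂ) (primeSum c X x) := by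
  unfold primeSum
  rw [map_sum]
  refine Finset.sum_congr rfl fun n _ => ?_
  rw [map_mul, Complex.conj_ofReal, neg_mul, expi_neg]

lemma mem_dyadic_range {X : ℝ} (hX : 0 ≤ X) {n : ℕ} :
    n ∈ Finset.Ioc ⌊X / 8⌋₊ ⌊X⌋₊ ↔ X / 8 < n ∧ (n:ℝ) ≤ X := by
  rw [Finset.mem_Ioc, Nat.floor_lt (by positivity), Nat.le_floor_iff hX]

lemma primeSum_eq_sum_osc {c X x : ℝ} (hX : 0 ≤ X) :
    primeSum c X x = ∑ n ∈ Finset.Ioc 0 ⌊X⌋₊, (primeWeight n : ℂ) * osc c X x n := by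
  unfold primeSum
  have hsub : Finset.Ioc ⌊X / 8⌋₊ ⌊X⌋₊ ⊆ Finset.Ioc 0 ⌊X⌋₊ :=
    Finset.Ioc_subset_Ioc_left (Nat.zero_le _)
  rw [← Finset.sum_subset hsub]
  · refine Finset.sum_congr rfl fun n hn => ?_
    rw [mem_dyadic_range hX] at hn
    rw [osc, if_pos hn]
  · intro n _ hn
    rw [mem_dyadic_range hX] at hn
    rw [osc, if_neg hn, mul_zero]

lemma norm_vonMangoldt_sub_primeSum_le {c X x : ℝ} (hX : 1 ≤ X) :
    ‖∑ n ∈ Finset.Ioc 0 ⌊X⌋₊, (ArithmeticFunction.vonMangoldt n : ℂ) * osc c X x n - primeSum c X x‖ ≤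
      2 * √X * Real.log X := by
  rw [primeSum_eq_sum_osc (by linarith), ← Finset.sum_sub_distrib]
  refine (norm_sum_le _ _).trans ?_
  refine le_trans ?_ (Chebyshev.psi_sub_theta_le hX)
  rw [Chebyshev.psi_sub_theta_eq_sum_not_prime, Finset.sum_filter]
  refine Finset.sum_le_sum fun n _ => ?_
  rw [← sub_mul, norm_mul]
  have h1 := norm_osc_le c X x n
  unfold primeWeight
  split_ifs with hp
  · rw [ArithmeticFunction.vonMangoldt_apply_prime hp]
    simp
  · rw [Complex.ofReal_zero, sub_zero, Complex.norm_real, Real.norm_of_nonneg ArithmeticFunction.vonMangoldt_nonneg]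
    exact mul_le_of_le_one_right ArithmeticFunction.vonMangoldt_nonneg h1

lemma exists_primeSum_bound {c : ℝ} (hc : 1 < c) (hc2 : c < 2) :
    ∃ C > 0, ∀ X x : ℝ, 4 ^ 20 ≤ X → 1 ≤ |x| * X ^ c → |x| * X ^ c ≤ X ^ (27 / 20 : ℝ) →
      ‖primeSum c X x‖ ≤
        C * Real.log X ^ 4 * X * ((|x| * X ^ c) ^ (-(1 / 4) : ℝ) + X ^ (-(1 / 40) : ℝ)) := by
  obtain ⟨C, hC, hb⟩ := exists_vonMangoldt_sum_bound hc hc2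
  suffices h : ∀ X x : ℝ, 4 ^ 20 ≤ X → 0 < x → 1 ≤ x * X ^ c → x * X ^ c ≤ X ^ (27 / 20 : ℝ) →
      ‖primeSum c X x‖ ≤
        (C + 2) * Real.log X ^ 4 * X * ((x * X ^ c) ^ (-(1 / 4) : ℝ) + X ^ (-(1 / 40) : ℝ)) by
    refine ⟨C + 2, by positivity, fun X x hX h1 h2 => ?_⟩
    have hx0 : 0 < |x| := by
      by_contra h0
      have : |x| = 0 := le_antisymm (not_lt.mp h0) (abs_nonneg x)
      rw [this, zero_mul] at h1
      linarith
    have := h X |x| hX hx0 h1 h2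
    rcases abs_choice x with h3 | h3
    · rw [h3] at this ⊢; exact this
    · rw [h3] at this ⊢
      rwa [primeSum_neg, RCLike.norm_conj] at this
  intro X x hX hx hT1 hT2
  have hX0 : 0 < X := lt_of_lt_of_le (by norm_num) hX
  have hX1 : 1 ≤ X := le_trans (by norm_num) hX
  set w := X ^ (1 / 20 : ℝ) with hw
  have hw0 : 0 < w := by positivity
  have hwX : w ^ 20 = X := by
    rw [hw, ← rpow_natCast, ← rpow_mul hX0.le]; norm_num
  have hw4 : 4 ≤ w := by
    have : (4:ℝ) ^ 20 ≤ w ^ 20 := by rw [hwX]; exact hX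
    exact le_of_pow_le_pow_left₀ (by norm_num) hw0.le this
  have hw27 : w ^ 27 = X ^ (27 / 20 : ℝ) := by
    rw [hw, ← rpow_natCast, ← rpow_mul hX0.le]; norm_num
  have h1 := hb w x hw4 hx (by rw [hwX]; exact hT1) (by rw [hwX, hw27]; exact hT2)
  have hl := le_log_of_two_pow hw4
  rw [hwX] at h1 hl
  have h2 := norm_vonMangoldt_sub_primeSum_le (c := c) (x := x) hX1
  set T := x * X ^ c with hT
  have hT0 : 0 < T := by linarith
  set ℓ := Real.log X with hℓ
  have hq : √(1 / √T + 1 / w) ≤ T ^ (-(1 / 4) : ℝ) + X ^ (-(1 / 40) : ℝ) := by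
    have e1 : 1 / √T = (T ^ (-(1 / 4) : ℝ)) ^ 2 := by
      rw [sqrt_eq_rpow, one_div, ← rpow_neg hT0.le, ← rpow_natCast, ← rpow_mul hT0.le]; norm_num
    have e2 : 1 / w = (X ^ (-(1 / 40) : ℝ)) ^ 2 := by
      rw [hw, one_div, ← rpow_neg hX0.le, ← rpow_natCast, ← rpow_mul hX0.le]; norm_num
    have p1 : 0 < T ^ (-(1 / 4) : ℝ) := by positivity
    have p2 : 0 < X ^ (-(1 / 40) : ℝ) := by positivity
    rw [e1, e2, sqrt_le_left (by positivity)]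
    nlinarith
  have hs : √X ≤ X * X ^ (-(1 / 40) : ℝ) := by
    rw [sqrt_eq_rpow]
    nth_rewrite 2 [← rpow_one X]
    rw [← rpow_add hX0]
    exact rpow_le_rpow_of_exponent_le hX1 (by norm_num)
  set q := T ^ (-(1 / 4) : ℝ) + X ^ (-(1 / 40) : ℝ) with hqdef
  have hs' : √X ≤ X * q := hs.trans (by
    gcongr
    rw [hqdef]
    have : 0 < T ^ (-(1 / 4) : ℝ) := by positivity
    linarith)
  have hq0 : 0 ≤ q := by positivity
  have h3 : 2 * √X * ℓ ≤ 2 * ℓ ^ 4 * X * q := by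
    have : ℓ ≤ ℓ ^ 4 := le_self_pow₀ hl (by norm_num)
    calc 2 * √X * ℓ ≤ 2 * (X * q) * ℓ ^ 4 := by gcongr
      _ = _ := by ring
  have h4 : C * ℓ ^ 4 * X * √(1 / √T + 1 / w) ≤ C * ℓ ^ 4 * X * q := by gcongr
  have h5 := norm_sub_norm_le (primeSum c X x)
    (∑ n ∈ Finset.Ioc 0 ⌊X⌋₊, (ArithmeticFunction.vonMangoldt n : ℂ) * osc c X x n)
  rw [norm_sub_rev] at h5
  calc ‖primeSum c X x‖ ≤ C * ℓ ^ 4 * X * q + 2 * ℓ ^ 4 * X * q := by linarith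
    _ = _ := by ring

lemma sum_inv_abs_sub_le {s : Finset ℕ} {N : ℕ} (hs : s ⊆ Finset.Ioc 0 N) {k : ℕ} (hk : k ∈ s) :
    ∑ l ∈ s.erase k, 1 / |(k:ℝ) - l| ≤ 2 * (1 + Real.log N) := by
  have hkN := Finset.mem_Ioc.mp (hs hk)
  have hmem : ∀ l ∈ s.erase k, l ≠ k ∧ 0 < l ∧ l ≤ N := fun l hl => by
    rw [Finset.mem_erase] at hl
    exact ⟨hl.1, Finset.mem_Ioc.mp (hs hl.2)⟩
  have hdist : ∀ l : ℕ, |(k:ℝ) - l| = (((k - l) + (l - k) : ℕ) : ℝ) := fun l => by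
    rcases le_total l k with h | h
    · have : (l:ℝ) ≤ k := by exact_mod_cast h
      rw [abs_of_nonneg (by linarith), Nat.sub_eq_zero_of_le h, Nat.add_zero, Nat.cast_sub h]
    · have : (k:ℝ) ≤ l := by exact_mod_cast h
      rw [abs_of_nonpos (by linarith), Nat.sub_eq_zero_of_le h, Nat.zero_add, Nat.cast_sub h]
      ring
  have key : ∀ p : ℕ → Prop, ∀ _ : DecidablePred p,
      Set.InjOn (fun l : ℕ => (k - l) + (l - k)) {l | p l} →
      ∑ l ∈ s.erase k with p l, 1 / |(k:ℝ) - l| ≤ 1 + Real.log N := by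
    intro p _ hp
    refine le_trans ?_ (sum_Ioc_one_div_le N)
    have e : ∑ l ∈ s.erase k with p l, 1 / |(k:ℝ) - l| =
        ∑ d ∈ ((s.erase k).filter p).image (fun l => (k - l) + (l - k)), 1 / (d:ℝ) := by
      rw [Finset.sum_image]
      · exact Finset.sum_congr rfl fun l _ => by rw [hdist]
      · intro l hl l' hl' h
        exact hp (Finset.mem_filter.mp hl).2 (Finset.mem_filter.mp hl').2 h
    rw [e]
    refine Finset.sum_le_sum_of_subset_of_nonneg ?_ fun _ _ _ => by positivity
    intro d hd
    rw [Finset.mem_image] at hd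
    obtain ⟨l, hl, rfl⟩ := hd
    rw [Finset.mem_filter] at hl
    have := hmem l hl.1
    rw [Finset.mem_Ioc]
    omega
  rw [← Finset.sum_filter_add_sum_filter_not (s.erase k) (fun l => l < k), two_mul]
  refine add_le_add (key _ _ ?_) (key _ _ ?_)
  · intro l hl l' hl' h
    simp only [Set.mem_ofPred_eq] at hl hl' h
    omega
  · intro l hl l' hl' h
    simp only [Set.mem_ofPred_eq] at hl hl' h
    omega

lemma norm_integral_expi_le (Z : ℝ) {u : ℝ} (hu : u ≠ 0) :
    ‖∫ x in (-Z)..Z, expi (x * u)‖ ≤ 1 / |u| := by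
  have hpi := pi_pos
  have h2 : (2 * π * u : ℂ) * Complex.I ≠ 0 := by
    simp [hu, hpi.ne']
  have e : ∀ x : ℝ, expi (x * u) = Complex.exp (((2 * π * u : ℂ) * Complex.I) * x) := fun x => by
    unfold expi
    congr 1
    push_cast
    ring
  have e' : ∀ x : ℝ, ‖Complex.exp (((2 * π * u : ℂ) * Complex.I) * x)‖ = 1 := fun x => by
    rw [← e, norm_expi]
  simp_rw [e]
  rw [integral_exp_mul_complex h2, norm_div]
  have h3 : ‖(2 * π * u : ℂ) * Complex.I‖ = 2 * π * |u| := by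
    simp [abs_of_pos hpi]
  rw [h3]
  have h4 : ‖Complex.exp (((2 * π * u : ℂ) * Complex.I) * (Z:ℝ)) -
      Complex.exp (((2 * π * u : ℂ) * Complex.I) * ((-Z : ℝ):ℂ))‖ ≤ 2 := by
    refine (norm_sub_le _ _).trans ?_
    rw [e', e']
    norm_num
  have hu0 : 0 < |u| := abs_pos.mpr hu
  calc _ ≤ 2 / (2 * π * |u|) := by gcongr
    _ ≤ 2 / (2 * |u|) := by
      gcongr
      linarith [pi_gt_three]
    _ = 1 / |u| := by field_simp

lemma norm_integral_expi_le_length {Z : ℝ} (hZ : 0 ≤ Z) (u : ℝ) :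
    ‖∫ x in (-Z)..Z, expi (x * u)‖ ≤ 2 * Z := by
  have := intervalIntegral.norm_integral_le_of_norm_le_const (a := -Z) (b := Z) (C := 1)
    (f := fun x => expi (x * u)) (fun x _ => (norm_expi _).le)
  rw [abs_of_nonneg (by linarith)] at this
  linarith

lemma integral_norm_sq_sum_le (s : Finset ℕ) (a f : ℕ → ℝ) (Z : ℝ) :
    ∫ x in (-Z)..Z, ‖∑ n ∈ s, (a n : ℂ) * expi (x * f n)‖ ^ 2 ≤
      ∑ m ∈ s, ∑ n ∈ s, |a m| * |a n| * ‖∫ x in (-Z)..Z, expi (x * (f m - f n))‖ := by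
  have h1 : ((∫ x in (-Z)..Z, ‖∑ n ∈ s, (a n : ℂ) * expi (x * f n)‖ ^ 2 : ℝ) : ℂ) =
      ∑ m ∈ s, ∑ n ∈ s, (a m : ℂ) * (a n : ℂ) * ∫ x in (-Z)..Z, expi (x * (f m - f n)) := by
    rw [← intervalIntegral.integral_ofReal]
    have e : ∀ x : ℝ, ((‖∑ n ∈ s, (a n : ℂ) * expi (x * f n)‖ ^ 2 : ℝ) : ℂ) =
        ∑ m ∈ s, ∑ n ∈ s, (a m : ℂ) * (a n : ℂ) * expi (x * (f m - f n)) := by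
      intro x
      push_cast
      rw [← Complex.mul_conj', map_sum, Finset.sum_mul_sum]
      refine Finset.sum_congr rfl fun m _ => Finset.sum_congr rfl fun n _ => ?_
      rw [map_mul, Complex.conj_ofReal, ← expi_neg, mul_sub, sub_eq_add_neg, expi_add]
      ring
    simp_rw [e]
    have hcont : ∀ u : ℝ, Continuous fun x : ℝ => expi (x * u) := fun u =>
      continuous_expi.comp (by fun_prop)
    rw [intervalIntegral.integral_finsetSum]
    · refine Finset.sum_congr rfl fun m _ => ?_
      rw [intervalIntegral.integral_finsetSum]
      · refine Finset.sum_congr rfl fun n _ => ?_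
        rw [intervalIntegral.integral_const_mul]
      · intro n _
        exact ((hcont _).const_mul _).intervalIntegrable _ _
    · intro m _
      exact (continuous_finsetSum _ fun n _ => (hcont _).const_mul _).intervalIntegrable _ _
  refine (le_abs_self _).trans ?_
  rw [← Real.norm_eq_abs, ← Complex.norm_real, h1]
  refine (norm_sum_le _ _).trans (Finset.sum_le_sum fun m _ => ?_)
  refine (norm_sum_le _ _).trans (Finset.sum_le_sum fun n _ => ?_)
  rw [norm_mul, norm_mul, Complex.norm_real, Complex.norm_real, Real.norm_eq_abs, Real.norm_eq_abs]

lemma primeWeight_le_of_mem {X : ℝ} (hX : 1 ≤ X) {n : ℕ} (hn : n ∈ Finset.Ioc ⌊X / 8⌋₊ ⌊X⌋₊) :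
    primeWeight n ≤ Real.log X := by
  rw [mem_dyadic_range (by linarith)] at hn
  refine (primeWeight_le_log n).trans (Real.log_le_log ?_ hn.2)
  linarith

lemma card_dyadic_range_le {X : ℝ} (hX : 0 ≤ X) : ((Finset.Ioc ⌊X / 8⌋₊ ⌊X⌋₊).card : ℝ) ≤ X := by
  rw [Nat.card_Ioc]
  exact le_trans (by exact_mod_cast Nat.sub_le _ _) (Nat.floor_le hX)

lemma sum_primeWeight_sq_le {X : ℝ} (hX : 1 ≤ X) :
    ∑ n ∈ Finset.Ioc ⌊X / 8⌋₊ ⌊X⌋₊, primeWeight n ^ 2 ≤ X * Real.log X ^ 2 := by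
  calc _ ≤ ∑ n ∈ Finset.Ioc ⌊X / 8⌋₊ ⌊X⌋₊, Real.log X ^ 2 :=
        Finset.sum_le_sum fun n hn => by
          have := primeWeight_le_of_mem hX hn
          have := primeWeight_nonneg n
          gcongr
    _ = ((Finset.Ioc ⌊X / 8⌋₊ ⌊X⌋₊).card : ℝ) * Real.log X ^ 2 := by simp
    _ ≤ _ := by
      gcongr
      exact card_dyadic_range_le (by linarith)

lemma one_le_log_of_eight_le {X : ℝ} (hX : 8 ≤ X) : 1 ≤ Real.log X := by
  rw [le_log_iff_exp_le (by linarith)]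
  linarith [exp_one_lt_d9]

lemma exists_second_moment_bound {c : ℝ} (hc : 1 < c) :
    ∃ C > 0, ∀ X Z : ℝ, 8 ≤ X → 0 ≤ Z →
      ∫ x in (-Z)..Z, ‖primeSum c X x‖ ^ 2 ≤ C * X * Real.log X ^ 3 * (Z + X ^ (1 - c)) := by
  refine ⟨2 + 4 * 8 ^ (c - 1) , by positivity, fun X Z hX hZ => ?_⟩
  have hl := one_le_log_of_eight_le hX
  have hX0 : 0 < X := by linarith
  have hX1 : 1 ≤ X := by linarith
  set s := Finset.Ioc ⌊X / 8⌋₊ ⌊X⌋₊ with hs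
  set B := 8 ^ (c - 1) * X ^ (1 - c) with hB
  have hB0 : 0 ≤ B := by positivity
  set G : ℕ → ℕ → ℝ := fun m n => if m = n then 2 * Z else B * (1 / |(m:ℝ) - n|) with hG
  have hsub : s ⊆ Finset.Ioc 0 ⌊X⌋₊ := Finset.Ioc_subset_Ioc_left (Nat.zero_le _)
  have hpair : ∀ m ∈ s, ∀ n ∈ s, ‖∫ x in (-Z)..Z, expi (x * ((m:ℝ) ^ c - (n:ℝ) ^ c))‖ ≤ G m n := by
    intro m hm n hn
    simp only [hG]
    split_ifs with h
    · exact norm_integral_expi_le_length hZ _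
    · rw [hs, mem_dyadic_range hX0.le] at hm hn
      have hb := (rpow_abs_sub_bounds hc (u := X / 8) (by positivity) ⟨hm.1.le, hm.2⟩ ⟨hn.1.le, hn.2⟩).1
      have hmn : 0 < |(m:ℝ) - n| := by
        rw [abs_pos, sub_ne_zero]
        exact_mod_cast h
      have hu : (X / 8) ^ (c - 1) = B⁻¹ := by
        rw [hB, div_rpow hX0.le (by norm_num), mul_inv, ← rpow_neg hX0.le, neg_sub, div_eq_inv_mul]
      have hBp : 0 < B := by positivity
      have h2 : B⁻¹ * |(m:ℝ) - n| ≤ |(m:ℝ) ^ c - (n:ℝ) ^ c| := by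
        refine le_trans ?_ hb
        rw [hu]
        have : 0 ≤ B⁻¹ * |(m:ℝ) - n| := by positivity
        nlinarith
      have hne : (m:ℝ) ^ c - (n:ℝ) ^ c ≠ 0 := by
        rw [← abs_pos]
        exact lt_of_lt_of_le (by positivity) h2
      refine (norm_integral_expi_le Z hne).trans ?_
      calc 1 / |(m:ℝ) ^ c - (n:ℝ) ^ c| ≤ 1 / (B⁻¹ * |(m:ℝ) - n|) :=
            one_div_le_one_div_of_le (by positivity) h2
        _ = _ := by field_simp
  have hlogfl : Real.log ⌊X⌋₊ ≤ Real.log X :=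
    Real.log_le_log (by exact_mod_cast Nat.floor_pos.mpr hX1) (Nat.floor_le hX0.le)
  have hrow : ∀ i ∈ s, ∑ j ∈ s, G i j ≤ 2 * Z + B * (4 * Real.log X) := by
    intro i hi
    rw [← Finset.add_sum_erase s _ hi]
    have e : ∑ j ∈ s.erase i, G i j = B * ∑ j ∈ s.erase i, 1 / |(i:ℝ) - j| := by
      rw [Finset.mul_sum]
      refine Finset.sum_congr rfl fun j hj => ?_
      simp only [hG]
      rw [if_neg (Finset.ne_of_mem_erase hj).symm]
    rw [e]
    have := sum_inv_abs_sub_le hsub hi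
    simp only [hG, if_true]
    gcongr
    linarith
  have hsum := sum_mul_symm_le s primeWeight G _
    (fun i j => by simp only [hG]; split_ifs <;> positivity)
    (fun i j => by simp only [hG, eq_comm (a := i), abs_sub_comm (i:ℝ)]) hrow
  have h1 := integral_norm_sq_sum_le s primeWeight (fun n => (n:ℝ) ^ c) Z
  have h2 : ∑ m ∈ s, ∑ n ∈ s, |primeWeight m| * |primeWeight n| *
      ‖∫ x in (-Z)..Z, expi (x * ((m:ℝ) ^ c - (n:ℝ) ^ c))‖ ≤
      ∑ m ∈ s, ∑ n ∈ s, primeWeight m * primeWeight n * G m n := by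
    refine Finset.sum_le_sum fun m hm => Finset.sum_le_sum fun n hn => ?_
    have p1 := primeWeight_nonneg m
    have p2 := primeWeight_nonneg n
    rw [abs_of_nonneg p1, abs_of_nonneg p2]
    have := hpair m hm n hn
    gcongr
  have h3 := sum_primeWeight_sq_le hX1
  have hXc : 0 ≤ X ^ (1 - c) := by positivity
  have h8 : 0 ≤ (8:ℝ) ^ (c - 1) := by positivity
  calc _ ≤ (2 * Z + B * (4 * Real.log X)) * ∑ n ∈ s, primeWeight n ^ 2 := h1.trans (h2.trans hsum)
    _ ≤ (2 * Z * Real.log X + B * (4 * Real.log X)) * (X * Real.log X ^ 2) := by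
        have : 2 * Z ≤ 2 * Z * Real.log X := le_mul_of_one_le_right (by positivity) hl
        gcongr
    _ = X * Real.log X ^ 3 * (2 * Z + 4 * 8 ^ (c - 1) * X ^ (1 - c)) := by rw [hB]; ring
    _ ≤ X * Real.log X ^ 3 * ((2 + 4 * 8 ^ (c - 1)) * (Z + X ^ (1 - c))) := by
        gcongr
        nlinarith [mul_nonneg h8 hZ]
    _ = _ := by ring

lemma integrable_of_continuous_of_bound {α E : Type*} [TopologicalSpace α] [SecondCountableTopology α]
    [MeasurableSpace α] [OpensMeasurableSpace α] [NormedAddCommGroup E]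
    {μ : Measure α} [IsFiniteMeasure μ] {f : α → E} (hf : Continuous f) {B : ℝ}
    (hB : ∀ x, ‖f x‖ ≤ B) : Integrable f μ :=
  Integrable.of_bound hf.aestronglyMeasurable B (Filter.Eventually.of_forall hB)

lemma sum_norm_sq_integral_expi_le (μ : Measure ℝ) [IsFiniteMeasure μ] (s : Finset ℕ) (f : ℕ → ℝ)
    {g : ℝ → ℂ} (hg : Continuous g) {D : ℝ} (hD : ∀ x, ‖g x‖ ≤ D) :
    ∑ n ∈ s, ‖∫ x, expi (x * f n) * g x ∂μ‖ ^ 2 ≤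
      ∫ z, ‖g z.1‖ * ‖g z.2‖ * ‖∑ n ∈ s, expi ((z.1 - z.2) * f n)‖ ∂(μ.prod μ) := by
  have hD0 : 0 ≤ D := (norm_nonneg _).trans (hD 0)
  have hce : ∀ u : ℝ, Continuous fun x : ℝ => expi (x * u) := fun u =>
    continuous_expi.comp (by fun_prop)
  have hterm : ∀ n, ((‖∫ x, expi (x * f n) * g x ∂μ‖ ^ 2 : ℝ) : ℂ) =
      ∫ z, (expi (z.1 * f n) * g z.1) * (starRingEnd ℂ) (expi (z.2 * f n) * g z.2) ∂(μ.prod μ) := by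
    intro n
    rw [integral_prod_mul (fun x => expi (x * f n) * g x)
      (fun y => (starRingEnd ℂ) (expi (y * f n) * g y)), integral_conj, Complex.mul_conj']
    push_cast
    rfl
  have hInt : ∀ n, Integrable (fun z : ℝ × ℝ =>
      (expi (z.1 * f n) * g z.1) * (starRingEnd ℂ) (expi (z.2 * f n) * g z.2)) (μ.prod μ) := by
    intro n
    refine integrable_of_continuous_of_bound (B := D * D) ?_ fun z => ?_
    · have h1 := (hce (f n)).mul hg
      exact (h1.comp continuous_fst).mul (Complex.continuous_conj.comp (h1.comp continuous_snd))
    · rw [norm_mul, RCLike.norm_conj, norm_mul, norm_mul, norm_expi, norm_expi, one_mul, one_mul]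
      have := hD z.1
      have := hD z.2
      gcongr
  have h1 : ((∑ n ∈ s, ‖∫ x, expi (x * f n) * g x ∂μ‖ ^ 2 : ℝ) : ℂ) =
      ∫ z, g z.1 * (starRingEnd ℂ) (g z.2) * ∑ n ∈ s, expi ((z.1 - z.2) * f n) ∂(μ.prod μ) := by
    rw [Complex.ofReal_sum, Finset.sum_congr rfl fun n _ => hterm n,
      ← integral_finsetSum _ fun n _ => hInt n]
    refine integral_congr_ae (Filter.Eventually.of_forall fun z => ?_)
    simp only
    rw [Finset.mul_sum]
    refine Finset.sum_congr rfl fun n _ => ?_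
    rw [map_mul, ← expi_neg, sub_mul, sub_eq_add_neg, expi_add]
    ring
  refine (le_abs_self _).trans ?_
  rw [← Real.norm_eq_abs, ← Complex.norm_real, h1]
  refine (norm_integral_le_integral_norm _).trans (le_of_eq ?_)
  refine integral_congr_ae (Filter.Eventually.of_forall fun z => ?_)
  simp only [norm_mul, RCLike.norm_conj]

lemma integral_schur_le (μ : Measure ℝ) [IsFiniteMeasure μ] {g : ℝ → ℂ} (hg : Continuous g) {D : ℝ}
    (hD : ∀ x, ‖g x‖ ≤ D) {k : ℝ → ℝ} (hk : Continuous k) {A : ℝ} (hk0 : ∀ z, 0 ≤ k z)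
    (hkA : ∀ z, k z ≤ A) (heven : ∀ z, k (-z) = k z) {κ B : ℝ}
    (hκ : ∀ᵐ x ∂μ, ∫ y, k (x - y) ∂μ ≤ κ) :
    ∫ z, ‖g z.1‖ * ‖g z.2‖ * (k (z.1 - z.2) + B) ∂(μ.prod μ) ≤
      κ * ∫ x, ‖g x‖ ^ 2 ∂μ + B * (∫ x, ‖g x‖ ∂μ) ^ 2 := by
  have hD0 : 0 ≤ D := (norm_nonneg _).trans (hD 0)
  have hA0 : 0 ≤ A := (hk0 0).trans (hkA 0)
  have i1 : Integrable (fun z : ℝ × ℝ => ‖g z.1‖ * ‖g z.2‖ * k (z.1 - z.2)) (μ.prod μ) := by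
    refine integrable_of_continuous_of_bound (B := D * D * A) (by fun_prop) fun z => ?_
    rw [norm_mul, norm_mul, norm_norm, norm_norm, Real.norm_of_nonneg (hk0 _)]
    have := hD z.1; have := hD z.2; have := hkA (z.1 - z.2); have := hk0 (z.1 - z.2)
    gcongr
  have i2 : Integrable (fun z : ℝ × ℝ => ‖g z.1‖ * ‖g z.2‖ * B) (μ.prod μ) := by
    refine integrable_of_continuous_of_bound (B := D * D * |B|) (by fun_prop) fun z => ?_
    rw [norm_mul, norm_mul, norm_norm, norm_norm, Real.norm_eq_abs]
    have := hD z.1; have := hD z.2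
    gcongr
  have i3 : Integrable (fun z : ℝ × ℝ => ‖g z.1‖ ^ 2 * k (z.1 - z.2)) (μ.prod μ) := by
    refine integrable_of_continuous_of_bound (B := D ^ 2 * A) (by fun_prop) fun z => ?_
    rw [norm_mul, norm_pow, norm_norm, Real.norm_of_nonneg (hk0 _)]
    have := hD z.1; have := hkA (z.1 - z.2); have := hk0 (z.1 - z.2)
    gcongr
  have i4 : Integrable (fun z : ℝ × ℝ => ‖g z.2‖ ^ 2 * k (z.1 - z.2)) (μ.prod μ) := by
    refine integrable_of_continuous_of_bound (B := D ^ 2 * A) (by fun_prop) fun z => ?_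
    rw [norm_mul, norm_pow, norm_norm, Real.norm_of_nonneg (hk0 _)]
    have := hD z.2; have := hkA (z.1 - z.2); have := hk0 (z.1 - z.2)
    gcongr
  have e4 : ∫ z, ‖g z.2‖ ^ 2 * k (z.1 - z.2) ∂(μ.prod μ) =
      ∫ z, ‖g z.1‖ ^ 2 * k (z.1 - z.2) ∂(μ.prod μ) := by
    rw [← integral_prod_swap]
    refine integral_congr_ae (Filter.Eventually.of_forall fun z => ?_)
    simp only [Prod.fst_swap, Prod.snd_swap]
    rw [← heven, neg_sub]
  have b3 : ∫ z, ‖g z.1‖ ^ 2 * k (z.1 - z.2) ∂(μ.prod μ) ≤ κ * ∫ x, ‖g x‖ ^ 2 ∂μ := by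
    rw [integral_prod _ i3, ← integral_const_mul]
    refine integral_mono_ae i3.integral_prod_left ?_ ?_
    · refine integrable_of_continuous_of_bound (B := |κ| * D ^ 2) (by fun_prop) fun x => ?_
      rw [norm_mul, norm_pow, norm_norm, Real.norm_eq_abs]
      have := hD x
      gcongr
    · filter_upwards [hκ] with x hx
      rw [integral_const_mul, mul_comm]
      gcongr
  have e2 : ∫ z, ‖g z.1‖ * ‖g z.2‖ * B ∂(μ.prod μ) = B * (∫ x, ‖g x‖ ∂μ) ^ 2 := by
    rw [integral_mul_const, integral_prod_mul (fun x => ‖g x‖) (fun x => ‖g x‖)]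
    ring
  have b1 : ∫ z, ‖g z.1‖ * ‖g z.2‖ * k (z.1 - z.2) ∂(μ.prod μ) ≤
      ∫ z, (‖g z.1‖ ^ 2 * k (z.1 - z.2) * (1 / 2) + ‖g z.2‖ ^ 2 * k (z.1 - z.2) * (1 / 2)) ∂(μ.prod μ) := by
    refine integral_mono i1 ((i3.mul_const _).add (i4.mul_const _)) fun z => ?_
    have := hk0 (z.1 - z.2)
    simp only
    nlinarith [mul_nonneg (sq_nonneg (‖g z.1‖ - ‖g z.2‖)) this]
  rw [integral_add (i3.mul_const _) (i4.mul_const _), integral_mul_const, integral_mul_const, e4] at b1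
  simp_rw [mul_add]
  rw [integral_add i1 i2, e2]
  linarith

lemma integral_pow_three_sq_le (μ : Measure ℝ) [IsFiniteMeasure μ] {g : ℝ → ℂ} (hg : Continuous g)
    {D : ℝ} (hD : ∀ x, ‖g x‖ ≤ D) :
    (∫ x, ‖g x‖ ^ 3 ∂μ) ^ 2 ≤ (∫ x, ‖g x‖ ^ 2 ∂μ) * ∫ x, ‖g x‖ ^ 4 ∂μ := by
  have hi : ∀ m : ℕ, Integrable (fun x => ‖g x‖ ^ m) μ := fun m => by
    refine integrable_of_continuous_of_bound (B := D ^ m) (by fun_prop) fun x => ?_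
    rw [norm_pow, norm_norm]
    have := hD x
    gcongr
  have h : ∀ t : ℝ, 0 ≤ (∫ x, ‖g x‖ ^ 4 ∂μ) * (t * t) + (-2 * ∫ x, ‖g x‖ ^ 3 ∂μ) * t +
      ∫ x, ‖g x‖ ^ 2 ∂μ := by
    intro t
    have e : ∫ x, (‖g x‖ - t * ‖g x‖ ^ 2) ^ 2 ∂μ = (∫ x, ‖g x‖ ^ 4 ∂μ) * (t * t) +
        (-2 * ∫ x, ‖g x‖ ^ 3 ∂μ) * t + ∫ x, ‖g x‖ ^ 2 ∂μ := by
      have e1 : ∀ x, (‖g x‖ - t * ‖g x‖ ^ 2) ^ 2 =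
          ‖g x‖ ^ 4 * (t * t) + ‖g x‖ ^ 3 * (-2 * t) + ‖g x‖ ^ 2 := fun x => by ring
      simp_rw [e1]
      have i43 : Integrable (fun x => ‖g x‖ ^ 4 * (t * t) + ‖g x‖ ^ 3 * (-2 * t)) μ :=
        ((hi 4).mul_const _).add ((hi 3).mul_const _)
      rw [integral_add i43 (hi 2),
        integral_add ((hi 4).mul_const _) ((hi 3).mul_const _), integral_mul_const,
        integral_mul_const]
      ring
    rw [← e]
    exact integral_nonneg fun x => sq_nonneg _
  have := discrim_le_zero h
  rw [discrim] at this
  nlinarith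

lemma continuous_primeSum (c X : ℝ) : Continuous (primeSum c X) := by
  unfold primeSum
  refine continuous_finsetSum _ fun n _ => ?_
  exact continuous_const.mul (continuous_expi.comp (by fun_prop))

lemma exists_norm_primeSum_le (c X : ℝ) : ∃ D, ∀ x, ‖primeSum c X x‖ ≤ D := by
  refine ⟨∑ n ∈ Finset.Ioc ⌊X / 8⌋₊ ⌊X⌋₊, ‖(primeWeight n : ℂ)‖, fun x => ?_⟩
  refine (norm_sum_le _ _).trans (Finset.sum_le_sum fun n _ => ?_)
  rw [norm_mul, norm_expi, mul_one]

lemma integral_inv_one_add_le {A Y : ℝ} (hA : 0 < A) (hY : 0 ≤ Y) :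
    ∫ z in (-Y)..Y, 1 / (1 + A * |z|) = 2 / A * Real.log (1 + A * Y) := by
  have hcont : Continuous fun z : ℝ => 1 / (1 + A * |z|) := by
    refine continuous_const.div (by fun_prop) fun z => ?_
    positivity
  have hhalf : ∫ z in (0:ℝ)..Y, 1 / (1 + A * |z|) = 1 / A * Real.log (1 + A * Y) := by
    have e : ∫ z in (0:ℝ)..Y, 1 / (1 + A * |z|) = ∫ z in (0:ℝ)..Y, 1 / (1 + A * z) := by
      refine intervalIntegral.integral_congr fun z hz => ?_
      rw [Set.uIcc_of_le hY] at hz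
      rw [abs_of_nonneg hz.1]
    rw [e]
    have hd : ∀ z ∈ Set.uIcc 0 Y, HasDerivAt (fun z => 1 / A * Real.log (1 + A * z)) (1 / (1 + A * z)) z := by
      intro z hz
      rw [Set.uIcc_of_le hY] at hz
      have hp : 0 < 1 + A * z := by have := hz.1; positivity
      have h1 : HasDerivAt (fun z => 1 + A * z) A z := by
        simpa using ((hasDerivAt_id z).const_mul A).const_add 1
      have := (h1.log hp.ne').const_mul (1 / A)
      have e2 : 1 / A * (A / (1 + A * z)) = 1 / (1 + A * z) := by field_simp
      rwa [e2] at this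
    rw [intervalIntegral.integral_eq_sub_of_hasDerivAt hd]
    · simp
    · refine ContinuousOn.intervalIntegrable fun z hz => ?_
      rw [Set.uIcc_of_le hY] at hz
      have hp : 0 < 1 + A * z := by have := hz.1; positivity
      have h2 : ContinuousAt (fun z : ℝ => 1 + A * z) z := by fun_prop
      exact (continuousAt_const.div h2 hp.ne').continuousWithinAt
  have hneg : ∫ z in (-Y)..0, 1 / (1 + A * |z|) = ∫ z in (0:ℝ)..Y, 1 / (1 + A * |z|) := by
    have := intervalIntegral.integral_comp_neg (a := 0) (b := Y) (fun z => 1 / (1 + A * |z|))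
    simp only [abs_neg, neg_zero] at this
    exact this.symm
  rw [← intervalIntegral.integral_add_adjacent_intervals (hcont.intervalIntegrable (-Y) 0)
    (hcont.intervalIntegrable 0 Y), hneg, hhalf]
  ring

lemma exists_kernel_majorant {c : ℝ} (hc : 1 < c) (hc2 : c < 2) :
    ∃ C > 0, ∀ X Y z : ℝ, 8 ≤ X → |z| ≤ Y →
      ‖∑ n ∈ Finset.Ioc ⌊X / 8⌋₊ ⌊X⌋₊, expi (z * (n:ℝ) ^ c)‖ ≤
        C * X * (1 / (1 + X ^ c * |z|)) + C * √(Y * X ^ c) := by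
  obtain ⟨C, hC, hb⟩ := exists_kernel_bound hc hc2
  refine ⟨2 * C + 2, by positivity, fun X Y z hX hz => ?_⟩
  have hX0 : 0 < X := by linarith
  have hXc : 0 < X ^ c := by positivity
  rcases le_or_gt (X ^ c * |z|) 1 with h | h
  · have h1 : ‖∑ n ∈ Finset.Ioc ⌊X / 8⌋₊ ⌊X⌋₊, expi (z * (n:ℝ) ^ c)‖ ≤ X := by
      refine (norm_sum_le _ _).trans ?_
      simp only [norm_expi]
      rw [Finset.sum_const, nsmul_eq_mul, mul_one]
      exact card_dyadic_range_le hX0.le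
    have h2 : 1 / 2 ≤ 1 / (1 + X ^ c * |z|) :=
      one_div_le_one_div_of_le (by positivity) (by linarith)
    calc _ ≤ X := h1
      _ ≤ (2 * C + 2) * X * (1 / 2) + 0 := by nlinarith
      _ ≤ _ := by gcongr; positivity
  · have hz0 : 0 < |z| := by
      by_contra h0
      have : |z| = 0 := le_antisymm (not_lt.mp h0) (abs_nonneg z)
      rw [this, mul_zero] at h
      linarith
    refine (hb X z hX (abs_pos.mp hz0)).trans ?_
    have e : X ^ (1 - c) / |z| = X * (1 / (X ^ c * |z|)) := by
      rw [rpow_sub hX0, rpow_one]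
      field_simp
    have h2 : 1 / (X ^ c * |z|) ≤ 2 * (1 / (1 + X ^ c * |z|)) := by
      rw [mul_one_div, div_le_div_iff₀ (by positivity) (by positivity)]
      linarith
    have h3 : √(|z| * X ^ c) ≤ √(Y * X ^ c) := by gcongr
    rw [e, mul_add]
    have h4 : C * (X * (1 / (X ^ c * |z|))) ≤ (2 * C + 2) * X * (1 / (1 + X ^ c * |z|)) := by
      calc _ ≤ C * (X * (2 * (1 / (1 + X ^ c * |z|)))) := by gcongr
        _ = (2 * C) * X * (1 / (1 + X ^ c * |z|)) := by ring
        _ ≤ _ := by gcongr; linarith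
    have h5 : C * √(|z| * X ^ c) ≤ (2 * C + 2) * √(Y * X ^ c) := by
      gcongr
      linarith
    exact add_le_add h4 h5

lemma setIntegral_kernel_le {a x A Y : ℝ} (hA : 0 < A) (hY : 0 ≤ Y) {J : Set ℝ}
    (hJa : J ⊆ Set.Icc a (a + Y)) (hx : x ∈ J) :
    ∫ y in J, 1 / (1 + A * |x - y|) ≤ 2 / A * Real.log (1 + A * Y) := by
  have hcont : Continuous fun z : ℝ => 1 / (1 + A * |z|) := by
    refine continuous_const.div (by fun_prop) fun z => ?_
    positivity
  have hcont' : Continuous fun y : ℝ => 1 / (1 + A * |x - y|) := hcont.comp (by fun_prop)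
  rw [← integral_inv_one_add_le hA hY]
  have hsub : J ⊆ Set.Icc (x - Y) (x + Y) := fun y hy => by
    have h1 := hJa hy
    have h2 := hJa hx
    rw [Set.mem_Icc] at *
    constructor <;> linarith
  calc ∫ y in J, 1 / (1 + A * |x - y|) ≤ ∫ y in Set.Icc (x - Y) (x + Y), 1 / (1 + A * |x - y|) := by
        refine setIntegral_mono_set hcont'.continuousOn.integrableOn_Icc ?_ hsub.eventuallyLE
        exact Filter.Eventually.of_forall fun y => by positivity
    _ = ∫ y in (x - Y)..(x + Y), 1 / (1 + A * |x - y|) := by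
        rw [intervalIntegral.integral_of_le (by linarith), integral_Icc_eq_integral_Ioc]
    _ = ∫ z in (-Y)..Y, 1 / (1 + A * |z|) := by
        have := intervalIntegral.integral_comp_sub_left (a := x - Y) (b := x + Y)
          (fun z => 1 / (1 + A * |z|)) x
        rw [this]
        congr 1 <;> ring

lemma exists_fourth_moment_bound {c : ℝ} (hc : 1 < c) (hc2 : c < 2) :
    ∃ C > 0, ∀ X a Y M : ℝ, 8 ≤ X → 0 ≤ Y → Y ≤ 1 → ∀ J : Set ℝ, MeasurableSet J →
      J ⊆ Set.Icc a (a + Y) → (∀ x ∈ J, ‖primeSum c X x‖ ≤ M) →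
      ∫ x in J, ‖primeSum c X x‖ ^ 4 ≤ C * X * Real.log X ^ 3 *
        (X ^ (1 - c) * M ^ 2 + √(Y * X ^ c) * ∫ x in J, ‖primeSum c X x‖ ^ 2) := by
  obtain ⟨C, hC, hker⟩ := exists_kernel_majorant hc hc2
  refine ⟨8 * C, by positivity, fun X a Y M hX hY hY1 J hJ hJa hM => ?_⟩
  have hX0 : 0 < X := by linarith
  have hX1 : 1 ≤ X := by linarith
  have hXc : 0 < X ^ c := by positivity
  have hl := one_le_log_of_eight_le hX
  obtain ⟨D, hD⟩ := exists_norm_primeSum_le c X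
  have hD0 : 0 ≤ D := (norm_nonneg _).trans (hD 0)
  have hScont := continuous_primeSum c X
  set S := primeSum c X with hS
  have hfin : IsFiniteMeasure (volume.restrict J) := by
    constructor
    rw [Measure.restrict_apply_univ]
    exact (measure_mono hJa).trans_lt (by simp)
  set μ := volume.restrict J with hμ
  set s := Finset.Ioc ⌊X / 8⌋₊ ⌊X⌋₊ with hs
  set g : ℝ → ℂ := fun x => (starRingEnd ℂ) (S x) * ((‖S x‖ ^ 2 : ℝ) : ℂ) with hg
  have hgn : ∀ x, ‖g x‖ = ‖S x‖ ^ 3 := fun x => by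
    simp only [hg, norm_mul, RCLike.norm_conj, Complex.norm_real, norm_pow, norm_norm]
    ring
  have hgcont : Continuous g := by
    simp only [hg]
    exact (Complex.continuous_conj.comp hScont).mul
      (Complex.continuous_ofReal.comp (hScont.norm.pow 2))
  have hgD : ∀ x, ‖g x‖ ≤ D ^ 3 := fun x => by
    rw [hgn]
    have := hD x
    gcongr
  have hi : ∀ m : ℕ, Integrable (fun x => ‖S x‖ ^ m) μ := fun m => by
    refine integrable_of_continuous_of_bound (B := D ^ m) (by fun_prop) fun x => ?_
    rw [norm_pow, norm_norm]
    have := hD x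
    gcongr
  set I4 := ∫ x, ‖S x‖ ^ 4 ∂μ with hI4
  set I2 := ∫ x, ‖S x‖ ^ 2 ∂μ with hI2
  have hI40 : 0 ≤ I4 := integral_nonneg fun x => by positivity
  have hI20 : 0 ≤ I2 := integral_nonneg fun x => by positivity
  have hexp : (I4 : ℂ) = ∑ n ∈ s, (primeWeight n : ℂ) * ∫ x, expi (x * (n:ℝ) ^ c) * g x ∂μ := by
    have e : ∀ x, ((‖S x‖ ^ 4 : ℝ) : ℂ) = ∑ n ∈ s, (primeWeight n : ℂ) * (expi (x * (n:ℝ) ^ c) * g x) := by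
      intro x
      have : ∑ n ∈ s, (primeWeight n : ℂ) * (expi (x * (n:ℝ) ^ c) * g x) = S x * g x := by
        rw [hS, primeSum, Finset.sum_mul]
        exact Finset.sum_congr rfl fun n _ => by ring
      rw [this]
      simp only [hg]
      rw [← mul_assoc, Complex.mul_conj']
      push_cast
      ring
    rw [hI4, ← integral_complex_ofReal]
    simp_rw [e]
    rw [integral_finsetSum]
    · exact Finset.sum_congr rfl fun n _ => integral_const_mul _ _
    · intro n _
      refine Integrable.const_mul ?_ _
      refine integrable_of_continuous_of_bound (B := D ^ 3) ?_ fun x => ?_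
      · exact (continuous_expi.comp (by fun_prop)).mul hgcont
      · rw [norm_mul, norm_expi, one_mul]
        exact hgD x
  have hCS : I4 ^ 2 ≤ (∑ n ∈ s, primeWeight n ^ 2) *
      ∑ n ∈ s, ‖∫ x, expi (x * (n:ℝ) ^ c) * g x ∂μ‖ ^ 2 := by
    refine le_trans ?_ (Finset.sum_mul_sq_le_sq_mul_sq s _ _)
    have h1 : I4 ≤ ∑ n ∈ s, primeWeight n * ‖∫ x, expi (x * (n:ℝ) ^ c) * g x ∂μ‖ := by
      calc I4 = ‖(I4 : ℂ)‖ := by rw [Complex.norm_real, Real.norm_of_nonneg hI40]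
        _ ≤ _ := by
          rw [hexp]
          refine (norm_sum_le _ _).trans (Finset.sum_le_sum fun n _ => ?_)
          rw [norm_mul, Complex.norm_real, Real.norm_of_nonneg (primeWeight_nonneg n)]
    gcongr
  set k : ℝ → ℝ := fun z => C * X * (1 / (1 + X ^ c * |z|)) with hk
  have hkcont : Continuous k := by
    simp only [hk]
    refine continuous_const.mul (continuous_const.div (by fun_prop) fun z => ?_)
    positivity
  have hk0 : ∀ z, 0 ≤ k z := fun z => by simp only [hk]; positivity
  have hkA : ∀ z, k z ≤ C * X := fun z => by
    simp only [hk]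
    have : 1 / (1 + X ^ c * |z|) ≤ 1 := by
      rw [div_le_one (by positivity)]
      have : 0 ≤ X ^ c * |z| := by positivity
      linarith
    exact mul_le_of_le_one_right (by positivity) this
  set κ := C * X * (2 / X ^ c * Real.log (1 + X ^ c * Y)) with hκ
  have hrow : ∀ᵐ x ∂μ, ∫ y, k (x - y) ∂μ ≤ κ := by
    refine (ae_restrict_iff' hJ).mpr (Filter.Eventually.of_forall fun x hx => ?_)
    simp only [hk]
    rw [integral_const_mul]
    rw [hκ]
    exact mul_le_mul_of_nonneg_left (setIntegral_kernel_le hXc hY hJa hx) (by positivity)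
  have hdual := sum_norm_sq_integral_expi_le μ s (fun n => (n:ℝ) ^ c) hgcont hgD
  have hmaj : ∫ z, ‖g z.1‖ * ‖g z.2‖ * ‖∑ n ∈ s, expi ((z.1 - z.2) * (n:ℝ) ^ c)‖ ∂(μ.prod μ) ≤
      ∫ z, ‖g z.1‖ * ‖g z.2‖ * (k (z.1 - z.2) + C * √(Y * X ^ c)) ∂(μ.prod μ) := by
    refine integral_mono_ae ?_ ?_ ?_
    · refine integrable_of_continuous_of_bound (B := D ^ 3 * D ^ 3 * s.card) ?_ fun z => ?_
      · refine ((hgcont.comp continuous_fst).norm.mul (hgcont.comp continuous_snd).norm).mul ?_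
        exact (continuous_finsetSum _ fun n _ => continuous_expi.comp (by fun_prop)).norm
      · rw [norm_mul, norm_mul, norm_norm, norm_norm, norm_norm]
        have h1 : ‖∑ n ∈ s, expi ((z.1 - z.2) * (n:ℝ) ^ c)‖ ≤ s.card := by
          refine (norm_sum_le _ _).trans ?_
          simp only [norm_expi]
          simp
        have := hgD z.1
        have := hgD z.2
        gcongr
    · refine integrable_of_continuous_of_bound (B := D ^ 3 * D ^ 3 * (C * X + C * √(Y * X ^ c))) (by fun_prop) fun z => ?_
      rw [norm_mul, norm_mul, norm_norm, norm_norm, Real.norm_of_nonneg (by have := hk0 (z.1 - z.2); positivity)]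
      have := hgD z.1
      have := hgD z.2
      have := hkA (z.1 - z.2)
      gcongr
    · rw [hμ, Measure.prod_restrict]
      refine (ae_restrict_iff' (hJ.prod hJ)).mpr (Filter.Eventually.of_forall fun z hz => ?_)
      have h1 := hJa hz.1
      have h2 := hJa hz.2
      rw [Set.mem_Icc] at h1 h2
      have := hker X Y (z.1 - z.2) hX (abs_le.mpr ⟨by linarith, by linarith⟩)
      simp only [hk]
      gcongr
  have hschur := integral_schur_le μ hgcont hgD hkcont hk0 hkA (fun z => by simp only [hk, abs_neg])
    (B := C * √(Y * X ^ c)) hrow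
  have hcube := integral_pow_three_sq_le μ hScont hD
  have hgsq : ∫ x, ‖g x‖ ^ 2 ∂μ ≤ M ^ 2 * I4 := by
    rw [hI4, ← integral_const_mul]
    refine setIntegral_mono_on ?_ ((hi 4).const_mul _) hJ fun x hx => ?_
    · simp_rw [hgn, ← pow_mul]
      exact hi 6
    · rw [hgn]
      have := hM x hx
      calc (‖S x‖ ^ 3) ^ 2 = ‖S x‖ ^ 2 * ‖S x‖ ^ 4 := by ring
        _ ≤ _ := by gcongr
  have hg1 : (∫ x, ‖g x‖ ∂μ) ^ 2 ≤ I2 * I4 := by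
    simp_rw [hgn]
    exact hcube
  have hκ0 : κ ≤ 8 * C * X ^ (1 - c) * Real.log X := by
    have h1 : Real.log (1 + X ^ c * Y) ≤ 4 * Real.log X := by
      calc Real.log (1 + X ^ c * Y) ≤ Real.log (X ^ (4:ℝ)) := by
            refine Real.log_le_log (by positivity) ?_
            have a1 : X ^ c ≤ X ^ (2:ℝ) := rpow_le_rpow_of_exponent_le hX1 hc2.le
            have a2 : X ^ c * Y ≤ X ^ c * 1 := by gcongr
            rw [show (4:ℝ) = 2 + 2 by norm_num, rpow_add hX0]
            have a3 : (2:ℝ) ≤ X ^ (2:ℝ) := by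
              rw [show (2:ℝ) = (2:ℕ) by norm_num, rpow_natCast]; push_cast; nlinarith
            have a4 : X ^ c * Y ≤ X ^ (2:ℝ) := by linarith
            generalize X ^ (2:ℝ) = q at a3 a4 ⊢
            nlinarith
        _ = 4 * Real.log X := Real.log_rpow hX0 _
    calc κ ≤ C * X * (2 / X ^ c * (4 * Real.log X)) := by rw [hκ]; gcongr
      _ = _ := by rw [rpow_sub hX0, rpow_one]; field_simp; ring
  have hκn : 0 ≤ κ := by
    rw [hκ]
    have : 0 ≤ Real.log (1 + X ^ c * Y) := Real.log_nonneg (by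
      have : 0 ≤ X ^ c * Y := by positivity
      linarith)
    positivity
  set L := Real.log X with hL
  have hfinal : I4 ^ 2 ≤ (X * L ^ 2) * ((8 * C * X ^ (1 - c) * L) * (M ^ 2 * I4) +
      C * √(Y * X ^ c) * (I2 * I4)) := by
    refine hCS.trans ?_
    have h1 := sum_primeWeight_sq_le hX1
    have h2 : ∑ n ∈ s, ‖∫ x, expi (x * (n:ℝ) ^ c) * g x ∂μ‖ ^ 2 ≤
        (8 * C * X ^ (1 - c) * L) * (M ^ 2 * I4) + C * √(Y * X ^ c) * (I2 * I4) := by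
      refine (hdual.trans (hmaj.trans hschur)).trans ?_
      have : 0 ≤ ∫ x, ‖g x‖ ^ 2 ∂μ := integral_nonneg fun x => by positivity
      gcongr
    gcongr
  rcases hI40.eq_or_lt with h0 | h0
  · rw [← h0]
    positivity
  · have h1 : I4 ≤ (X * L ^ 2) * ((8 * C * X ^ (1 - c) * L) * M ^ 2 + C * √(Y * X ^ c) * I2) := by
      have : I4 * I4 ≤ ((X * L ^ 2) * ((8 * C * X ^ (1 - c) * L) * M ^ 2 + C * √(Y * X ^ c) * I2)) * I4 := by
        calc I4 * I4 = I4 ^ 2 := by ring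
          _ ≤ _ := hfinal
          _ = _ := by ring
      exact le_of_mul_le_mul_right this h0
    refine h1.trans ?_
    calc (X * L ^ 2) * ((8 * C * X ^ (1 - c) * L) * M ^ 2 + C * √(Y * X ^ c) * I2)
        ≤ (X * L ^ 2) * ((8 * C * X ^ (1 - c) * L) * M ^ 2 + (8 * C * L) * √(Y * X ^ c) * I2) := by
          gcongr
          nlinarith
      _ = _ := by ring

lemma exists_log_pow_le_rpow (k : ℕ) {ε : ℝ} (hε : 0 < ε) :
    ∃ X₀ : ℝ, ∀ X : ℝ, X₀ ≤ X → Real.log X ^ k ≤ X ^ ε := by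
  have h := (isLittleO_log_rpow_rpow_atTop (k : ℝ) hε).bound (c := 1) one_pos
  obtain ⟨X₀, h0⟩ := Filter.eventually_atTop.1 h
  refine ⟨max X₀ 1, fun X hX => ?_⟩
  have := h0 X (le_trans (le_max_left _ _) hX)
  have hX1 : 1 ≤ X := le_trans (le_max_right _ _) hX
  rw [Real.rpow_natCast, one_mul, Real.norm_eq_abs, Real.norm_of_nonneg (Real.rpow_nonneg (by linarith) _)] at this
  exact (le_abs_self _).trans this

lemma exists_fourth_moment_interval {c : ℝ} (hc : 1 < c) (hc2 : c < 2) :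
    ∃ C > 0, ∀ X a b Y M : ℝ, 8 ≤ X → Y ≤ 1 → a ≤ b → b ≤ a + Y →
      (∀ x, a ≤ x → x ≤ b → ‖primeSum c X x‖ ≤ M) →
      ∫ x in a..b, ‖primeSum c X x‖ ^ 4 ≤ C * X * Real.log X ^ 3 *
        (X ^ (1 - c) * M ^ 2 + √(Y * X ^ c) * ∫ x in a..b, ‖primeSum c X x‖ ^ 2) := by
  obtain ⟨C, hC, hb⟩ := exists_fourth_moment_bound hc hc2
  refine ⟨C, hC, fun X a b Y M hX hY hab hbY hM => ?_⟩
  rw [intervalIntegral.integral_of_le hab, intervalIntegral.integral_of_le hab]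
  exact hb X a Y M hX (by linarith) hY _ measurableSet_Ioc
    (fun x hx => ⟨hx.1.le, hx.2.trans hbY⟩) (fun x hx => hM x hx.1.le hx.2)

/-- The contribution of the initial range of the minor arcs to the fourth moment. -/
lemma exists_minor_arc_near {c : ℝ} (hc1 : 1 < c) (hc2 : c < 39 / 29) :
    ∃ C > 0, ∃ X₀ : ℝ, ∀ X : ℝ, X₀ ≤ X →
      X ^ (-c) * Real.log X ^ 24 ≤ X ^ (-(1/25) : ℝ) ∧
      ∫ x in (X ^ (-c) * Real.log X ^ 24)..(X ^ (-(1/25) : ℝ)), ‖primeSum c X x‖ ^ 4 ≤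
        C * (X ^ (4 - c) / Real.log X) := by
  obtain ⟨C₁, hC₁, h4⟩ := exists_fourth_moment_interval hc1 (by linarith)
  obtain ⟨C₂, hC₂, h2⟩ := exists_second_moment_bound hc1
  obtain ⟨C₃, hC₃, hs⟩ := exists_primeSum_bound hc1 (by linarith)
  obtain ⟨X₁, hX₁⟩ := exists_log_pow_le_rpow 6 (ε := 1/40) (by norm_num)
  obtain ⟨X₂, hX₂⟩ := exists_log_pow_le_rpow 7 (ε := 1/2000) (by norm_num)
  obtain ⟨X₃, hX₃⟩ := exists_log_pow_le_rpow 24 (ε := 9/10) (by norm_num)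
  refine ⟨C₁ * (4 * C₃ ^ 2 + 2 * C₂), by positivity,
    max (max X₁ X₂) (max X₃ (4 ^ 20)), fun X hX => ?_⟩
  simp only [max_le_iff] at hX
  obtain ⟨⟨hXa, hXb⟩, hXc, hXd⟩ := hX
  have hX8 : 8 ≤ X := le_trans (by norm_num) hXd
  have hX0 : 0 < X := by linarith
  have hl1 := one_le_log_of_eight_le hX8
  set l := Real.log X with hl
  have hl0 : 0 < l := by linarith
  set L := X ^ (-c) * l ^ 24 with hL
  set Y := X ^ (-(1/25) : ℝ) with hY
  have hL0 : 0 < L := by positivity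
  have hLY : L ≤ Y := by
    calc L ≤ X ^ (-c) * X ^ (9/10 : ℝ) := mul_le_mul_of_nonneg_left (hX₃ X hXc) (by positivity)
      _ = X ^ (-c + 9/10) := by rw [← Real.rpow_add hX0]
      _ ≤ Y := Real.rpow_le_rpow_of_exponent_le (by linarith) (by linarith)
  refine ⟨hLY, ?_⟩
  have hY1 : Y ≤ 1 := Real.rpow_le_one_of_one_le_of_nonpos (by linarith) (by norm_num)
  have hYX : Y * X ^ c = X ^ (c - 1/25) := by
    rw [hY, ← Real.rpow_add hX0]; congr 1; ring
  have hM : ∀ x, L ≤ x → x ≤ Y → ‖primeSum c X x‖ ≤ C₃ * l ^ 4 * X * (2 * (l ^ 6)⁻¹) := by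
    intro x hx1 hx2
    have hx0 : 0 < x := hL0.trans_le hx1
    have hT1 : l ^ 24 ≤ |x| * X ^ c := by
      rw [abs_of_pos hx0]
      calc l ^ 24 = L * X ^ c := by
            rw [hL, Real.rpow_neg hX0.le]; field_simp
        _ ≤ _ := by gcongr
    have hT2 : |x| * X ^ c ≤ X ^ (27/20 : ℝ) := by
      rw [abs_of_pos hx0]
      calc x * X ^ c ≤ Y * X ^ c := by gcongr
        _ = X ^ (c - 1/25) := hYX
        _ ≤ _ := Real.rpow_le_rpow_of_exponent_le (by linarith) (by linarith)
    refine (hs X x hXd ((one_le_pow₀ hl1).trans hT1) hT2).trans ?_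
    refine mul_le_mul_of_nonneg_left ?_ (by positivity)
    have e1 : (|x| * X ^ c) ^ (-(1/4) : ℝ) ≤ (l ^ 6)⁻¹ := by
      calc (|x| * X ^ c) ^ (-(1/4) : ℝ) ≤ (l ^ 24) ^ (-(1/4) : ℝ) :=
            Real.rpow_le_rpow_of_nonpos (by positivity) hT1 (by norm_num)
        _ = (l ^ 6)⁻¹ := by
            rw [← Real.rpow_natCast l 24, ← Real.rpow_mul hl0.le, ← Real.rpow_natCast l 6,
              ← Real.rpow_neg hl0.le]
            norm_num
    have e2 : X ^ (-(1/40) : ℝ) ≤ (l ^ 6)⁻¹ := by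
      rw [Real.rpow_neg hX0.le]
      exact inv_anti₀ (by positivity) (hX₁ X hXa)
    linarith
  have hI2 : ∫ x in L..Y, ‖primeSum c X x‖ ^ 2 ≤ C₂ * X * l ^ 3 * (Y + X ^ (1 - c)) := by
    refine le_trans ?_ (h2 X Y hX8 (hL0.le.trans hLY))
    refine intervalIntegral.integral_mono_interval (by linarith) hLY le_rfl
      (Filter.Eventually.of_forall fun x => by positivity) ?_
    exact ((continuous_primeSum c X).norm.pow 2).intervalIntegrable _ _
  refine (h4 X L Y Y _ hX8 hY1 hLY (by linarith) hM).trans ?_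
  have hsq : √(Y * X ^ c) = X ^ (c / 2 - 1/50) := by
    rw [hYX, Real.sqrt_eq_rpow, ← Real.rpow_mul hX0.le]; congr 1; ring
  have t1 : X * l ^ 3 * (X ^ (1 - c) * (C₃ * l ^ 4 * X * (2 * (l ^ 6)⁻¹)) ^ 2) =
      4 * C₃ ^ 2 * (X ^ (4 - c) / l) := by
    have : X ^ (4 - c) = X ^ (1 - c) * X ^ 3 := by
      rw [← Real.rpow_natCast, ← Real.rpow_add hX0]; congr 1; push_cast; ring
    rw [this]; field_simp; norm_num
  have t2 : X * l ^ 3 * (X ^ (c / 2 - 1/50) * (C₂ * X * l ^ 3 * (Y + X ^ (1 - c)))) ≤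
      2 * C₂ * (X ^ (4 - c) / l) := by
    have e7 := hX₂ X hXb
    have e3 : X * X * X ^ (c / 2 - 1/50) * Y * l ^ 7 ≤ X ^ (4 - c) := by
      calc X * X * X ^ (c / 2 - 1/50) * Y * l ^ 7
          ≤ X ^ (1:ℝ) * X ^ (1:ℝ) * X ^ (c / 2 - 1/50) * Y * X ^ (1/2000 : ℝ) := by
            rw [Real.rpow_one]; gcongr
        _ = X ^ (1 + 1 + (c / 2 - 1/50) + -(1/25) + 1/2000) := by
            rw [hY, Real.rpow_add hX0, Real.rpow_add hX0, Real.rpow_add hX0, Real.rpow_add hX0]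
        _ ≤ _ := Real.rpow_le_rpow_of_exponent_le (by linarith) (by linarith)
    have e4 : X * X * X ^ (c / 2 - 1/50) * X ^ (1 - c) * l ^ 7 ≤ X ^ (4 - c) := by
      calc X * X * X ^ (c / 2 - 1/50) * X ^ (1 - c) * l ^ 7
          ≤ X ^ (1:ℝ) * X ^ (1:ℝ) * X ^ (c / 2 - 1/50) * X ^ (1 - c) * X ^ (1/2000 : ℝ) := by
            rw [Real.rpow_one]; gcongr
        _ = X ^ (1 + 1 + (c / 2 - 1/50) + (1 - c) + 1/2000) := by
            rw [Real.rpow_add hX0, Real.rpow_add hX0, Real.rpow_add hX0, Real.rpow_add hX0]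
        _ ≤ _ := Real.rpow_le_rpow_of_exponent_le (by linarith) (by linarith)
    rw [← mul_div_assoc, le_div_iff₀ hl0]
    nlinarith [mul_le_mul_of_nonneg_left e3 hC₂.le, mul_le_mul_of_nonneg_left e4 hC₂.le]
  calc C₁ * X * l ^ 3 * (X ^ (1 - c) * (C₃ * l ^ 4 * X * (2 * (l ^ 6)⁻¹)) ^ 2 +
        √(Y * X ^ c) * ∫ x in L..Y, ‖primeSum c X x‖ ^ 2)
      ≤ C₁ * X * l ^ 3 * (X ^ (1 - c) * (C₃ * l ^ 4 * X * (2 * (l ^ 6)⁻¹)) ^ 2 +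
        X ^ (c / 2 - 1/50) * (C₂ * X * l ^ 3 * (Y + X ^ (1 - c)))) := by
        rw [hsq]; gcongr
    _ = C₁ * (X * l ^ 3 * (X ^ (1 - c) * (C₃ * l ^ 4 * X * (2 * (l ^ 6)⁻¹)) ^ 2) +
        X * l ^ 3 * (X ^ (c / 2 - 1/50) * (C₂ * X * l ^ 3 * (Y + X ^ (1 - c))))) := by ring
    _ ≤ C₁ * (4 * C₃ ^ 2 * (X ^ (4 - c) / l) + 2 * C₂ * (X ^ (4 - c) / l)) := by
        rw [t1]; gcongr
    _ = _ := by ring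

set_option maxHeartbeats 600000 in
/-- The contribution of the far range of the minor arcs to the fourth moment. -/
lemma exists_minor_arc_far {c : ℝ} (hc1 : 1 < c) (hc2 : c < 39 / 29) :
    ∃ C > 0, ∃ X₀ : ℝ, ∀ X : ℝ, X₀ ≤ X →
      ∫ x in (X ^ (-(1/25) : ℝ))..(X ^ (1/1000 : ℝ)), ‖primeSum c X x‖ ^ 4 ≤
        C * (X ^ (4 - c) / Real.log X) := by
  obtain ⟨C₁, hC₁, h4⟩ := exists_fourth_moment_interval hc1 (by linarith)
  obtain ⟨C₂, hC₂, h2⟩ := exists_second_moment_bound hc1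
  obtain ⟨C₃, hC₃, hs⟩ := exists_primeSum_bound hc1 (by linarith)
  obtain ⟨X₂, hX₂⟩ := exists_log_pow_le_rpow 12 (ε := 1/2000) (by norm_num)
  obtain ⟨X₃, hX₃⟩ := Filter.eventually_atTop.1
    ((tendsto_rpow_atTop (y := 1/1000) (by norm_num)).eventually_ge_atTop 2)
  refine ⟨C₁ * (8 * C₃ ^ 2 + 3 * C₂), by positivity,
    max X₂ (max (4 ^ 20) X₃), fun X hX => ?_⟩
  simp only [max_le_iff] at hX
  obtain ⟨hXb, hXd, hXe⟩ := hX
  have hX8 : 8 ≤ X := le_trans (by norm_num) hXd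
  have hX0 : 0 < X := by linarith
  have hl1 := one_le_log_of_eight_le hX8
  set l := Real.log X with hl
  have hl0 : 0 < l := by linarith
  set Y := X ^ (-(1/25) : ℝ) with hY
  set H := X ^ (1/1000 : ℝ) with hH
  have hY0 : 0 < Y := by positivity
  have hH1 : 1 ≤ H := Real.one_le_rpow (by linarith) (by norm_num)
  have hH2 : 2 ≤ H := hX₃ X hXe
  have hY1 : Y ≤ 1 := Real.rpow_le_one_of_one_le_of_nonpos (by linarith) (by norm_num)
  have hYX : Y * X ^ c = X ^ (c - 1/25) := by
    rw [hY, ← Real.rpow_add hX0]; congr 1; ring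
  have hM : ∀ x, Y ≤ x → x ≤ 2 * H →
      ‖primeSum c X x‖ ≤ C₃ * l ^ 4 * X * (2 * X ^ (-(1/40) : ℝ)) := by
    intro x hx1 hx2
    have hx0 : 0 < x := hY0.trans_le hx1
    have hT1 : X ^ (1/10 : ℝ) ≤ |x| * X ^ c := by
      rw [abs_of_pos hx0]
      calc X ^ (1/10 : ℝ) ≤ X ^ (c - 1/25) :=
            Real.rpow_le_rpow_of_exponent_le (by linarith) (by linarith)
        _ = Y * X ^ c := hYX.symm
        _ ≤ _ := by gcongr
    have hT2 : |x| * X ^ c ≤ X ^ (27/20 : ℝ) := by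
      rw [abs_of_pos hx0]
      calc x * X ^ c ≤ H * H * X ^ c := by gcongr; nlinarith
        _ = X ^ (1/1000 + 1/1000 + c) := by
            rw [Real.rpow_add hX0, Real.rpow_add hX0]
        _ ≤ _ := Real.rpow_le_rpow_of_exponent_le (by linarith) (by linarith)
    have hX1 : 1 ≤ X ^ (1/10 : ℝ) := Real.one_le_rpow (by linarith) (by norm_num)
    refine (hs X x hXd (hX1.trans hT1) hT2).trans ?_
    refine mul_le_mul_of_nonneg_left ?_ (by positivity)
    have e1 : (|x| * X ^ c) ^ (-(1/4) : ℝ) ≤ X ^ (-(1/40) : ℝ) := by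
      calc (|x| * X ^ c) ^ (-(1/4) : ℝ) ≤ (X ^ (1/10 : ℝ)) ^ (-(1/4) : ℝ) :=
            Real.rpow_le_rpow_of_nonpos (by positivity) hT1 (by norm_num)
        _ = X ^ (-(1/40) : ℝ) := by
            rw [← Real.rpow_mul hX0.le]; norm_num
    linarith
  set K := ⌈H / Y⌉₊ with hK
  have hKH : H ≤ K * Y := by
    have := Nat.le_ceil (H / Y)
    rwa [div_le_iff₀ hY0] at this
  have hHY1 : 1 ≤ H / Y := by rw [le_div_iff₀ hY0]; linarith
  have hK2 : (K : ℝ) ≤ H / Y + 1 := (Nat.ceil_lt_add_one (by positivity)).le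
  have hK1 : 1 ≤ K := by
    have : (1:ℝ) ≤ K := hHY1.trans (Nat.le_ceil _)
    exact_mod_cast this
  have hKY : K * Y ≤ 2 * H := by
    calc K * Y ≤ (H / Y + 1) * Y := by gcongr
      _ = H + Y := by field_simp
      _ ≤ _ := by linarith
  have hKX : (K : ℝ) ≤ 2 * (H * X ^ (1/25 : ℝ)) := by
    have : H / Y = H * X ^ (1/25 : ℝ) := by
      rw [hY, Real.rpow_neg hX0.le]; field_simp
    rw [← this]; linarith
  have hInt : ∀ k : ℕ, ∀ u v, IntervalIntegrable (fun x => ‖primeSum c X x‖ ^ k) volume u v :=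
    fun k u v => ((continuous_primeSum c X).norm.pow k).intervalIntegrable _ _
  have hpiece : ∀ k ∈ Finset.Ico 1 K,
      ∫ x in ((k:ℕ) * Y)..((k + 1 : ℕ) * Y), ‖primeSum c X x‖ ^ 4 ≤ C₁ * X * l ^ 3 *
        (X ^ (1 - c) * (C₃ * l ^ 4 * X * (2 * X ^ (-(1/40) : ℝ))) ^ 2 + √(Y * X ^ c) *
          ∫ x in ((k:ℕ) * Y)..((k + 1 : ℕ) * Y), ‖primeSum c X x‖ ^ 2) := by
    intro k hk
    rw [Finset.mem_Ico] at hk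
    have hk1 : (1:ℝ) ≤ k := by exact_mod_cast hk.1
    have hk2 : ((k + 1 : ℕ):ℝ) ≤ K := by exact_mod_cast hk.2
    refine h4 X _ _ Y _ hX8 hY1 (by push_cast; nlinarith) (by push_cast; linarith) ?_
    intro x hx1 hx2
    refine hM x (le_trans (by nlinarith) hx1) (hx2.trans (le_trans ?_ hKY))
    gcongr
  have hsum : ∀ j : ℕ, ∑ k ∈ Finset.Ico 1 K,
      ∫ x in ((k:ℕ) * Y)..((k + 1 : ℕ) * Y), ‖primeSum c X x‖ ^ j =
      ∫ x in Y..(K * Y), ‖primeSum c X x‖ ^ j := by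
    intro j
    have := intervalIntegral.sum_integral_adjacent_intervals_Ico (μ := volume)
      (f := fun x => ‖primeSum c X x‖ ^ j) (a := fun k : ℕ => (k:ℝ) * Y) hK1
      (fun k _ => hInt j _ _)
    simpa using this
  have hI2 : ∫ x in Y..(K * Y), ‖primeSum c X x‖ ^ 2 ≤ C₂ * X * l ^ 3 * (3 * H) := by
    have hYK : Y ≤ K * Y := by
      have : (1:ℝ) ≤ K := by exact_mod_cast hK1
      nlinarith
    have h1 : ∫ x in Y..(K * Y), ‖primeSum c X x‖ ^ 2 ≤
        ∫ x in (-(2 * H))..(2 * H), ‖primeSum c X x‖ ^ 2 :=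
      intervalIntegral.integral_mono_interval (by linarith) hYK hKY
        (Filter.Eventually.of_forall fun x => by positivity) (hInt 2 _ _)
    refine (h1.trans (h2 X (2 * H) hX8 (by positivity))).trans ?_
    have : X ^ (1 - c) ≤ 1 := Real.rpow_le_one_of_one_le_of_nonpos (by linarith) (by linarith)
    gcongr
    linarith
  have hsq : √(Y * X ^ c) = X ^ (c / 2 - 1/50) := by
    rw [hYX, Real.sqrt_eq_rpow, ← Real.rpow_mul hX0.le]; congr 1; ring
  have e12 := hX₂ X hXb
  have e7 : l ^ 7 ≤ X ^ (1/2000 : ℝ) := le_trans (pow_le_pow_right₀ hl1 (by norm_num)) e12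
  have e3 : X * X ^ (1 - c) * X * X * X ^ (-(1/40) : ℝ) * X ^ (-(1/40) : ℝ) * H *
      X ^ (1/25 : ℝ) * l ^ 12 ≤ X ^ (4 - c) := by
    calc X * X ^ (1 - c) * X * X * X ^ (-(1/40) : ℝ) * X ^ (-(1/40) : ℝ) * H *
          X ^ (1/25 : ℝ) * l ^ 12
        ≤ X ^ (1:ℝ) * X ^ (1 - c) * X ^ (1:ℝ) * X ^ (1:ℝ) * X ^ (-(1/40) : ℝ) *
          X ^ (-(1/40) : ℝ) * H * X ^ (1/25 : ℝ) * X ^ (1/2000 : ℝ) := by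
          rw [Real.rpow_one]; gcongr
      _ = X ^ (1 + (1 - c) + 1 + 1 + -(1/40) + -(1/40) + 1/1000 + 1/25 + 1/2000) := by
          rw [Real.rpow_add hX0, Real.rpow_add hX0, Real.rpow_add hX0, Real.rpow_add hX0,
            Real.rpow_add hX0, Real.rpow_add hX0, Real.rpow_add hX0, Real.rpow_add hX0]
      _ ≤ _ := Real.rpow_le_rpow_of_exponent_le (by linarith) (by linarith)
  have e4 : X * X * X ^ (c / 2 - 1/50) * H * l ^ 7 ≤ X ^ (4 - c) := by
    calc X * X * X ^ (c / 2 - 1/50) * H * l ^ 7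
        ≤ X ^ (1:ℝ) * X ^ (1:ℝ) * X ^ (c / 2 - 1/50) * H * X ^ (1/2000 : ℝ) := by
          rw [Real.rpow_one]; gcongr
      _ = X ^ (1 + 1 + (c / 2 - 1/50) + 1/1000 + 1/2000) := by
          rw [Real.rpow_add hX0, Real.rpow_add hX0, Real.rpow_add hX0, Real.rpow_add hX0]
      _ ≤ _ := Real.rpow_le_rpow_of_exponent_le (by linarith) (by linarith)
  have t1 : X * l ^ 3 * (2 * (H * X ^ (1/25 : ℝ)) *
      (X ^ (1 - c) * (C₃ * l ^ 4 * X * (2 * X ^ (-(1/40) : ℝ))) ^ 2)) ≤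
      8 * C₃ ^ 2 * (X ^ (4 - c) / l) := by
    rw [← mul_div_assoc, le_div_iff₀ hl0]
    calc _ = 8 * C₃ ^ 2 * (X * X ^ (1 - c) * X * X * X ^ (-(1/40) : ℝ) * X ^ (-(1/40) : ℝ) * H *
          X ^ (1/25 : ℝ) * l ^ 12) := by ring
      _ ≤ _ := mul_le_mul_of_nonneg_left e3 (by positivity)
  have t2 : X * l ^ 3 * (X ^ (c / 2 - 1/50) * (C₂ * X * l ^ 3 * (3 * H))) ≤
      3 * C₂ * (X ^ (4 - c) / l) := by
    rw [← mul_div_assoc, le_div_iff₀ hl0]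
    calc _ = 3 * C₂ * (X * X * X ^ (c / 2 - 1/50) * H * l ^ 7) := by ring
      _ ≤ _ := mul_le_mul_of_nonneg_left e4 (by positivity)
  have hYH : Y ≤ H := hY1.trans hH1
  calc ∫ x in Y..H, ‖primeSum c X x‖ ^ 4
      ≤ ∫ x in Y..(K * Y), ‖primeSum c X x‖ ^ 4 :=
        intervalIntegral.integral_mono_interval le_rfl hYH hKH
          (Filter.Eventually.of_forall fun x => by positivity) (hInt 4 _ _)
    _ = ∑ k ∈ Finset.Ico 1 K,
      ∫ x in ((k:ℕ) * Y)..((k + 1 : ℕ) * Y), ‖primeSum c X x‖ ^ 4 := (hsum 4).symm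
    _ ≤ ∑ k ∈ Finset.Ico 1 K, C₁ * X * l ^ 3 *
        (X ^ (1 - c) * (C₃ * l ^ 4 * X * (2 * X ^ (-(1/40) : ℝ))) ^ 2 + √(Y * X ^ c) *
          ∫ x in ((k:ℕ) * Y)..((k + 1 : ℕ) * Y), ‖primeSum c X x‖ ^ 2) :=
        Finset.sum_le_sum hpiece
    _ = C₁ * X * l ^ 3 * (((K - 1 : ℕ) : ℝ) *
        (X ^ (1 - c) * (C₃ * l ^ 4 * X * (2 * X ^ (-(1/40) : ℝ))) ^ 2) + √(Y * X ^ c) *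
          ∫ x in Y..(K * Y), ‖primeSum c X x‖ ^ 2) := by
        rw [← Finset.mul_sum, Finset.sum_add_distrib, Finset.sum_const, Nat.card_Ico,
          nsmul_eq_mul, ← Finset.mul_sum, hsum 2]
    _ ≤ C₁ * X * l ^ 3 * (2 * (H * X ^ (1/25 : ℝ)) *
        (X ^ (1 - c) * (C₃ * l ^ 4 * X * (2 * X ^ (-(1/40) : ℝ))) ^ 2) + X ^ (c / 2 - 1/50) *
          (C₂ * X * l ^ 3 * (3 * H))) := by
        rw [hsq]
        have : ((K - 1 : ℕ) : ℝ) ≤ 2 * (H * X ^ (1/25 : ℝ)) :=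
          le_trans (by exact_mod_cast Nat.sub_le K 1) hKX
        gcongr
    _ = C₁ * (X * l ^ 3 * (2 * (H * X ^ (1/25 : ℝ)) *
        (X ^ (1 - c) * (C₃ * l ^ 4 * X * (2 * X ^ (-(1/40) : ℝ))) ^ 2)) +
        X * l ^ 3 * (X ^ (c / 2 - 1/50) * (C₂ * X * l ^ 3 * (3 * H)))) := by ring
    _ ≤ C₁ * (8 * C₃ ^ 2 * (X ^ (4 - c) / l) + 3 * C₂ * (X ^ (4 - c) / l)) := by gcongr
    _ = _ := by ring

theorem exists_minor_arc_bound {c : ℝ} (hc1 : 1 < c) (hc2 : c < 39 / 29) :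
    ∃ C > 0, ∃ X₀ : ℝ, ∀ X : ℝ, X₀ ≤ X →
      ∫ x in (X ^ (-c) * Real.log X ^ 24)..(X ^ (1/1000 : ℝ)), ‖primeSum c X x‖ ^ 4 ≤
        C * (X ^ (4 - c) / Real.log X) := by
  obtain ⟨C₁, hC₁, X₁, h1⟩ := exists_minor_arc_near hc1 hc2
  obtain ⟨C₂, hC₂, X₂, h2⟩ := exists_minor_arc_far hc1 hc2
  refine ⟨C₁ + C₂, by positivity, max X₁ X₂, fun X hX => ?_⟩
  have a1 := (h1 X (le_trans (le_max_left _ _) hX)).2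
  have a2 := h2 X (le_trans (le_max_right _ _) hX)
  have hInt : ∀ u v, IntervalIntegrable (fun x => ‖primeSum c X x‖ ^ 4) volume u v :=
    fun u v => ((continuous_primeSum c X).norm.pow 4).intervalIntegrable _ _
  rw [← intervalIntegral.integral_add_adjacent_intervals (hInt _ _) (hInt (X ^ (-(1/25) : ℝ)) _)]
  linarith

/-- The difference between a term of the zeta series and the corresponding integral. -/
noncomputable def zetaTerm (n : ℕ) (s : ℂ) : ℂ :=
  ((n : ℂ) + 1) ^ (-s) - (((n : ℂ) + 1 + 1) ^ (1 - s) - ((n : ℂ) + 1) ^ (1 - s)) / (1 - s)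

lemma zetaTerm_eq_integral (n : ℕ) {s : ℂ} (hs : s ≠ 1) :
    zetaTerm n s =
      ∫ u in ((n : ℝ) + 1)..((n : ℝ) + 1 + 1), (((n : ℂ) + 1) ^ (-s) - (u : ℂ) ^ (-s)) := by
  have hn : (0:ℝ) < (n : ℝ) + 1 := by positivity
  have h0 : (0:ℝ) ∉ Set.uIcc ((n : ℝ) + 1) ((n : ℝ) + 1 + 1) := by
    rw [Set.uIcc_of_le (by linarith)]
    exact fun h => absurd h.1 (by linarith)
  have hs' : -s ≠ -1 := fun h => hs (neg_injective h)
  rw [intervalIntegral.integral_sub, integral_cpow (Or.inr ⟨hs', h0⟩), intervalIntegral.integral_const,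
    zetaTerm]
  · push_cast
    rw [show -s + 1 = 1 - s by ring]
    simp
  · exact intervalIntegrable_const
  · exact intervalIntegral.intervalIntegrable_cpow (Or.inr h0)

lemma norm_cpow_sub_cpow_le {m u : ℝ} (hm : 0 < m) (hu : m ≤ u) (hu' : u ≤ m + 1) {s : ℂ}
    (hs : 0 < s.re) :
    ‖(m : ℂ) ^ (-s) - (u : ℂ) ^ (-s)‖ ≤ ‖s‖ * m ^ (-s.re - 1) ∧
      ‖(m : ℂ) ^ (-s) - (u : ℂ) ^ (-s)‖ ≤ 2 * m ^ (-s.re) := by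
  have hu0 : 0 < u := by linarith
  constructor
  · have hd : ∀ v ∈ Set.Icc m u, HasDerivWithinAt (fun v : ℝ => (v : ℂ) ^ (-s))
        (-s * (v : ℂ) ^ (-s - 1)) (Set.Icc m u) v := by
      intro v hv
      have hv0 : v ≠ 0 := by have := hv.1; linarith
      have hs0 : -s ≠ 0 := by
        intro h
        rw [neg_eq_zero] at h
        simp [h] at hs
      exact (hasDerivAt_ofReal_cpow_const hv0 hs0).hasDerivWithinAt
    have hb : ∀ v ∈ Set.Ico m u, ‖-s * (v : ℂ) ^ (-s - 1)‖ ≤ ‖s‖ * m ^ (-s.re - 1) := by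
      intro v hv
      have hv0 : 0 < v := by have := hv.1; linarith
      rw [norm_mul, norm_neg, Complex.norm_cpow_eq_rpow_re_of_pos hv0]
      have : (-s - 1).re = -s.re - 1 := by simp
      rw [this]
      exact mul_le_mul_of_nonneg_left
        (Real.rpow_le_rpow_of_nonpos hm hv.1 (by linarith)) (norm_nonneg _)
    have := norm_image_sub_le_of_norm_deriv_le_segment' hd hb u (Set.right_mem_Icc.2 hu)
    rw [norm_sub_rev]
    refine this.trans ?_
    have h3 : 0 ≤ ‖s‖ * m ^ (-s.re - 1) := by positivity
    nlinarith
  · refine (norm_sub_le _ _).trans ?_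
    rw [Complex.norm_cpow_eq_rpow_re_of_pos hm, Complex.norm_cpow_eq_rpow_re_of_pos hu0,
      Complex.neg_re]
    have := Real.rpow_le_rpow_of_nonpos hm hu (z := -s.re) (by linarith)
    linarith

lemma norm_zetaTerm_le (n : ℕ) {s : ℂ} (hs : 0 < s.re) (hs1 : s ≠ 1) {θ : ℝ} (h0 : 0 ≤ θ)
    (h1 : θ ≤ 1) : ‖zetaTerm n s‖ ≤ 2 * ‖s‖ ^ θ * ((n : ℝ) + 1) ^ (-s.re - θ) := by
  set m : ℝ := (n : ℝ) + 1 with hm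
  have hm0 : 0 < m := by positivity
  have key : ∀ B, (∀ u, m ≤ u → u ≤ m + 1 → ‖(m : ℂ) ^ (-s) - (u : ℂ) ^ (-s)‖ ≤ B) →
      ‖zetaTerm n s‖ ≤ B := by
    intro B hB
    rw [zetaTerm_eq_integral n hs1]
    have := intervalIntegral.norm_integral_le_of_norm_le_const (a := m) (b := m + 1) (C := B)
      (f := fun u : ℝ => ((n : ℂ) + 1) ^ (-s) - (u : ℂ) ^ (-s)) (fun u hu => by
        rw [Set.uIoc_of_le (by linarith)] at hu
        have := hB u hu.1.le hu.2
        rw [hm] at this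
        push_cast at this
        exact this)
    simpa using this
  have k1 := key _ fun u h h' => (norm_cpow_sub_cpow_le hm0 h h' hs).1
  have k2 := key _ fun u h h' => (norm_cpow_sub_cpow_le hm0 h h' hs).2
  calc ‖zetaTerm n s‖ = ‖zetaTerm n s‖ ^ θ * ‖zetaTerm n s‖ ^ (1 - θ) := by
        rw [← Real.rpow_add_of_nonneg (norm_nonneg _) h0 (by linarith)]; simp
    _ ≤ (‖s‖ * m ^ (-s.re - 1)) ^ θ * (2 * m ^ (-s.re)) ^ (1 - θ) := by gcongr
    _ = 2 ^ (1 - θ) * ‖s‖ ^ θ * m ^ (-s.re - θ) := by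
        rw [Real.mul_rpow (norm_nonneg _) (by positivity), Real.mul_rpow (by norm_num) (by positivity),
          ← Real.rpow_mul hm0.le, ← Real.rpow_mul hm0.le]
        have : m ^ (-s.re - θ) = m ^ ((-s.re - 1) * θ) * m ^ (-s.re * (1 - θ)) := by
          rw [← Real.rpow_add hm0]; congr 1; ring
        rw [this]; ring
    _ ≤ _ := by
        gcongr
        calc (2:ℝ) ^ (1 - θ) ≤ 2 ^ (1:ℝ) :=
              Real.rpow_le_rpow_of_exponent_le (by norm_num) (by linarith)
          _ = 2 := Real.rpow_one 2

lemma summable_nat_add_one_rpow {p : ℝ} (hp : p < -1) : Summable fun n : ℕ => ((n : ℝ) + 1) ^ p := by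
  have := (summable_nat_add_iff 1).2 (Real.summable_nat_rpow.2 hp)
  simpa using this

lemma summable_zetaTerm {s : ℂ} (hs : 0 < s.re) (hs1 : s ≠ 1) : Summable fun n => zetaTerm n s := by
  refine Summable.of_norm_bounded (g := fun n : ℕ => 2 * ‖s‖ ^ (1:ℝ) * ((n : ℝ) + 1) ^ (-s.re - 1))
    ((summable_nat_add_one_rpow (by linarith)).mul_left _) fun n =>
    norm_zetaTerm_le n hs hs1 zero_le_one le_rfl

lemma tsum_zetaTerm_of_one_lt_re {s : ℂ} (hs : 1 < s.re) :
    ∑' n, zetaTerm n s = riemannZeta₀ s := by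
  have hs1 : s ≠ 1 := by rintro rfl; simp at hs
  have hs1' : 1 - s ≠ 0 := sub_ne_zero.2 hs1.symm
  have hA : Summable fun n => zetaTerm n s := summable_zetaTerm (by linarith) hs1
  have hB : Summable fun n : ℕ => ((n : ℂ) + 1) ^ (-s) := by
    have := (summable_nat_add_iff 1).2 (Complex.summable_one_div_nat_cpow.2 hs)
    simpa [Complex.cpow_neg] using this
  have hz : riemannZeta s = ∑' n : ℕ, ((n : ℂ) + 1) ^ (-s) := by
    rw [zeta_eq_tsum_one_div_nat_add_one_cpow hs]
    simp [Complex.cpow_neg]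
  have hC := hB.sub hA
  have hC' : ∀ n : ℕ, ((n : ℂ) + 1) ^ (-s) - zetaTerm n s =
      (((n + 1 : ℕ) : ℂ) + 1) ^ (1 - s) / (1 - s) - ((n : ℂ) + 1) ^ (1 - s) / (1 - s) := by
    intro n; rw [zetaTerm]; push_cast; ring
  have hlim := hC.hasSum.tendsto_sum_nat
  simp_rw [hC'] at hlim
  simp_rw [Finset.sum_range_sub (fun n : ℕ => ((n : ℂ) + 1) ^ (1 - s) / (1 - s))] at hlim
  have hzero : Filter.Tendsto (fun n : ℕ => ((n : ℂ) + 1) ^ (1 - s) / (1 - s)) Filter.atTop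
      (nhds 0) := by
    rw [← zero_div (1 - s)]
    refine Filter.Tendsto.div_const ?_ _
    rw [tendsto_zero_iff_norm_tendsto_zero]
    have h1 : (fun n : ℕ => ‖((n : ℂ) + 1) ^ (1 - s)‖) =
        fun n : ℕ => (((n + 1 : ℕ) : ℝ)) ^ (-(s.re - 1)) := by
      funext n
      have : ((n : ℂ) + 1) = (((n + 1 : ℕ) : ℝ) : ℂ) := by push_cast; ring
      rw [this, Complex.norm_cpow_eq_rpow_re_of_pos (by positivity)]
      congr 1; simp
    rw [h1]
    exact (tendsto_rpow_neg_atTop (by linarith)).comp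
      (tendsto_natCast_atTop_atTop.comp (Filter.tendsto_add_atTop_nat 1))
  have hu := tendsto_nhds_unique hlim (hzero.sub_const _)
  have e1 : ∑' n : ℕ, (((n : ℂ) + 1) ^ (-s) - zetaTerm n s) = riemannZeta s - ∑' n, zetaTerm n s := by
    rw [hB.tsum_sub hA, hz]
  simp_rw [hC'] at e1
  rw [e1] at hu
  have h0 := riemannZeta_eq_inv_sub_add hs1
  have h2 : (s - 1)⁻¹ = - (1 - s)⁻¹ := by rw [← inv_neg]; congr 1; ring
  rw [h2] at h0
  simp at hu
  linear_combination h0 - hu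

lemma differentiableAt_zetaTerm (n : ℕ) {s : ℂ} (hs : s ≠ 1) :
    DifferentiableAt ℂ (zetaTerm n) s := by
  have h1 : ((n : ℂ) + 1) ≠ 0 := by exact_mod_cast Nat.succ_ne_zero n
  have h2 : ((n : ℂ) + 1 + 1) ≠ 0 := by exact_mod_cast Nat.succ_ne_zero (n + 1)
  have h3 : 1 - s ≠ 0 := sub_ne_zero.2 hs.symm
  unfold zetaTerm
  refine DifferentiableAt.sub ?_ (DifferentiableAt.div (DifferentiableAt.sub ?_ ?_) ?_ h3)
  · exact DifferentiableAt.const_cpow (by fun_prop) (Or.inl h1)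
  · exact DifferentiableAt.const_cpow (by fun_prop) (Or.inl h2)
  · exact DifferentiableAt.const_cpow (by fun_prop) (Or.inl h1)
  · fun_prop

lemma tsum_zetaTerm {s : ℂ} (hs : 0 < s.re) (him : s.im ≠ 0) :
    ∑' n, zetaTerm n s = riemannZeta₀ s := by
  obtain ⟨κ, hκ, hκs⟩ : ∃ κ : ℝ, |κ| = 1 ∧ 0 < κ * s.im := by
    rcases lt_or_gt_of_ne him with h | h
    · exact ⟨-1, by simp, by linarith⟩
    · exact ⟨1, by simp, by linarith⟩
  set δ := min (s.re / 2) 1 with hδ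
  have hδ0 : 0 < δ := lt_min (by linarith) one_pos
  set U : Set ℂ := {z | δ < z.re} ∩ {z | 0 < κ * z.im} ∩ Metric.ball 0 (‖s‖ + 4) with hU
  have hUo : IsOpen U :=
    ((isOpen_lt continuous_const Complex.continuous_re).inter
      (isOpen_lt continuous_const (continuous_const.mul Complex.continuous_im))).inter
      Metric.isOpen_ball
  have hUc : Convex ℝ U := by
    refine Convex.inter (Convex.inter (convex_halfSpace_re_gt δ) ?_) (convex_ball _ _)
    exact convex_halfSpace_gt (𝕜 := ℝ) (f := fun z : ℂ => κ * z.im)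
      ⟨fun x y => by simp [mul_add], fun a x => by simp; ring⟩ 0
  have hU1 : ∀ z ∈ U, z ≠ 1 := by
    rintro z hz rfl
    have := hz.1.2
    simp at this
  have hsU : s ∈ U := by
    refine ⟨⟨?_, hκs⟩, ?_⟩
    · change δ < s.re
      exact (min_le_left _ _).trans_lt (half_lt_self hs)
    · simp
  set p : ℂ := ⟨2, κ⟩ with hp
  have hpU : p ∈ U := by
    refine ⟨⟨?_, ?_⟩, ?_⟩
    · change δ < 2
      exact (min_le_right _ _).trans_lt (by norm_num)
    · change 0 < κ * κ
      rw [← abs_mul_abs_self, hκ]; norm_num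
    · rw [Metric.mem_ball, dist_zero_right]
      refine lt_of_le_of_lt (Complex.norm_le_abs_re_add_abs_im p) ?_
      simp only [hp, hκ]
      have := norm_nonneg s
      norm_num
      linarith
  have hG : DifferentiableOn ℂ (fun z => ∑' n, zetaTerm n z) U := by
    refine Complex.differentiableOn_tsum_of_summable_norm
      (u := fun n : ℕ => 2 * (‖s‖ + 4) ^ (1:ℝ) * ((n : ℝ) + 1) ^ (-δ - 1))
      ((summable_nat_add_one_rpow (by linarith)).mul_left _)
      (fun n z hz => (differentiableAt_zetaTerm n (hU1 z hz)).differentiableWithinAt) hUo ?_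
    intro n z hz
    have hzδ : δ < z.re := hz.1.1
    have hzn : ‖z‖ < ‖s‖ + 4 := by simpa using hz.2
    refine (norm_zetaTerm_le n (hδ0.trans hzδ) (hU1 z hz) zero_le_one le_rfl).trans ?_
    have hn : (1:ℝ) ≤ (n:ℝ) + 1 := by have : (0:ℝ) ≤ n := n.cast_nonneg; linarith
    have : ((n : ℝ) + 1) ^ (-z.re - 1) ≤ ((n : ℝ) + 1) ^ (-δ - 1) :=
      Real.rpow_le_rpow_of_exponent_le hn (by linarith)
    gcongr
  have hev : (fun z => ∑' n, zetaTerm n z) =ᶠ[nhds p] riemannZeta₀ := by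
    have : {z : ℂ | 1 < z.re} ∈ nhds p :=
      (isOpen_lt continuous_const Complex.continuous_re).mem_nhds (by simp [hp])
    filter_upwards [this] with z hz using tsum_zetaTerm_of_one_lt_re hz
  exact (hG.analyticOnNhd hUo).eqOn_of_preconnected_of_eventuallyEq
    (differentiable_riemannZeta₀.differentiableOn.analyticOnNhd hUo) hUc.isPreconnected hpU hev hsU

theorem exists_norm_riemannZeta₀_le {θ : ℝ} (h0 : 0 < θ) (h1 : θ ≤ 1) :
    ∃ C > 0, ∀ s : ℂ, 1 - θ / 2 ≤ s.re → ‖riemannZeta₀ s‖ ≤ C * ‖s‖ ^ θ := by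
  have hsum := summable_nat_add_one_rpow (p := -1 - θ / 2) (by linarith)
  set K := ∑' n : ℕ, ((n : ℝ) + 1) ^ (-1 - θ / 2) with hK
  have hK0 : 0 ≤ K := tsum_nonneg fun n => by positivity
  have key : ∀ s : ℂ, 1 - θ / 2 ≤ s.re → s.im ≠ 0 → ‖riemannZeta₀ s‖ ≤ (2 * K + 1) * ‖s‖ ^ θ := by
    intro s hs him
    have hs0 : 0 < s.re := by linarith
    have hs1 : s ≠ 1 := by rintro rfl; simp at him
    rw [← tsum_zetaTerm hs0 him]
    have hb : ∀ n, ‖zetaTerm n s‖ ≤ 2 * ‖s‖ ^ θ * ((n : ℝ) + 1) ^ (-1 - θ / 2) := by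
      intro n
      refine (norm_zetaTerm_le n hs0 hs1 h0.le h1).trans ?_
      have hn : (1:ℝ) ≤ (n:ℝ) + 1 := by have : (0:ℝ) ≤ n := n.cast_nonneg; linarith
      have := Real.rpow_le_rpow_of_exponent_le hn (show -s.re - θ ≤ -1 - θ / 2 by linarith)
      gcongr
    refine (tsum_of_norm_bounded (hsum.mul_left (2 * ‖s‖ ^ θ)).hasSum hb).trans ?_
    rw [tsum_mul_left, ← hK]
    have : 0 ≤ ‖s‖ ^ θ := by positivity
    linarith
  refine ⟨2 * K + 1, by positivity, fun s hs => ?_⟩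
  by_cases him : s.im = 0
  · have hl : Filter.Tendsto (fun u : ℝ => s + u * Complex.I) (nhdsWithin 0 {0}ᶜ) (nhds s) := by
      have : Continuous (fun u : ℝ => s + u * Complex.I) := by fun_prop
      have h2 := this.tendsto 0
      simp only [Complex.ofReal_zero, zero_mul, add_zero] at h2
      exact h2.mono_left nhdsWithin_le_nhds
    have hf : Filter.Tendsto (fun z => ‖riemannZeta₀ z‖) (nhds s) (nhds ‖riemannZeta₀ s‖) :=
      (differentiable_riemannZeta₀.continuous.norm).tendsto s
    have hg : Filter.Tendsto (fun z : ℂ => (2 * K + 1) * ‖z‖ ^ θ) (nhds s)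
        (nhds ((2 * K + 1) * ‖s‖ ^ θ)) :=
      (continuous_const.mul (continuous_norm.rpow_const fun _ => Or.inr h0.le)).tendsto s
    refine le_of_tendsto_of_tendsto (hf.comp hl) (hg.comp hl) ?_
    filter_upwards [self_mem_nhdsWithin] with u hu
    refine key _ (by simpa using hs) ?_
    simpa [him] using hu
  · exact key s hs him

lemma exists_norm_iteratedDeriv_le {f : ℂ → ℂ} (hf : Differentiable ℂ f) {r C a : ℝ} (hr : 0 < r)
    (hr1 : r ≤ 1) (ha : 0 ≤ a) (hC : 0 < C)
    (h : ∀ z : ℂ, 1 - r ≤ z.re → z.re ≤ 3 → ‖f z‖ ≤ C * (2 + |z.im|) ^ a) (k : ℕ) :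
    ∃ D > 0, ∀ s : ℂ, 1 ≤ s.re → s.re ≤ 2 → ‖iteratedDeriv k f s‖ ≤ D * (2 + |s.im|) ^ a := by
  refine ⟨k.factorial * (C * 2 ^ a) / r ^ k, by positivity, fun s hs1 hs2 => ?_⟩
  have hb : ∀ z ∈ Metric.sphere s r, ‖f z‖ ≤ C * (2 ^ a * (2 + |s.im|) ^ a) := by
    intro z hz
    rw [mem_sphere_iff_norm] at hz
    have h1 : |z.re - s.re| ≤ r := by
      rw [← Complex.sub_re, ← hz]; exact Complex.abs_re_le_norm _
    have h2 : |z.im - s.im| ≤ r := by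
      rw [← Complex.sub_im, ← hz]; exact Complex.abs_im_le_norm _
    rw [abs_le] at h1
    refine (h z (by linarith) (by linarith)).trans ?_
    rw [← Real.mul_rpow (by norm_num) (by positivity)]
    have h3 : |z.im| ≤ |s.im| + r := by
      have := abs_sub_abs_le_abs_sub z.im s.im; linarith
    gcongr
    have := abs_nonneg s.im
    linarith
  refine (Complex.norm_iteratedDeriv_le_of_forall_mem_sphere_norm_le k hr hf.diffContOnCl hb).trans
    (le_of_eq ?_)
  ring

lemma norm_le_two_mul {z : ℂ} (h1 : 0 ≤ z.re) (h2 : z.re ≤ 3) : ‖z‖ ≤ 2 * (2 + |z.im|) := by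
  have := Complex.norm_le_abs_re_add_abs_im z
  rw [abs_of_nonneg h1] at this
  have := abs_nonneg z.im
  linarith

lemma exists_norm_riemannZeta₀_le_im {ε : ℝ} (h0 : 0 < ε) (h1 : ε ≤ 1) :
    ∃ C > 0, ∀ z : ℂ, 1 - ε / 2 ≤ z.re → z.re ≤ 3 → ‖riemannZeta₀ z‖ ≤ C * (2 + |z.im|) ^ ε := by
  obtain ⟨C, hC, h⟩ := exists_norm_riemannZeta₀_le h0 h1
  refine ⟨C * 2 ^ ε, by positivity, fun z hz1 hz2 => (h z hz1).trans ?_⟩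
  rw [mul_assoc, ← Real.mul_rpow (by norm_num) (by positivity)]
  have := norm_le_two_mul (z := z) (by linarith) hz2
  gcongr

lemma exists_norm_riemannZeta₁_le_im {ε : ℝ} (h0 : 0 < ε) (h1 : ε ≤ 1) :
    ∃ C > 0, ∀ z : ℂ, 1 - ε / 2 ≤ z.re → z.re ≤ 3 →
      ‖riemannZeta₁ z‖ ≤ C * (2 + |z.im|) ^ (1 + ε) := by
  obtain ⟨C, hC, h⟩ := exists_norm_riemannZeta₀_le_im h0 h1
  refine ⟨1 + 3 * C, by positivity, fun z hz1 hz2 => ?_⟩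
  have ht : 1 ≤ 2 + |z.im| := by have := abs_nonneg z.im; linarith
  have ht0 : 0 < 2 + |z.im| := by linarith
  have hz := h z hz1 hz2
  have h3 : ‖z - 1‖ ≤ 3 * (2 + |z.im|) := by
    have h4 := norm_sub_le z 1
    have h5 := norm_le_two_mul (z := z) (by linarith) hz2
    rw [norm_one] at h4
    linarith
  have h6 : (1:ℝ) ≤ (2 + |z.im|) ^ (1 + ε) := Real.one_le_rpow ht (by linarith)
  calc ‖riemannZeta₁ z‖ ≤ 1 + ‖z - 1‖ * ‖riemannZeta₀ z‖ := by
        rw [riemannZeta₁]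
        refine (norm_add_le _ _).trans ?_
        rw [norm_one, norm_mul]
    _ ≤ 1 + 3 * (2 + |z.im|) * (C * (2 + |z.im|) ^ ε) := by gcongr
    _ = 1 + 3 * C * (2 + |z.im|) ^ (1 + ε) := by
        rw [Real.rpow_add ht0, Real.rpow_one]; ring
    _ ≤ _ := by linarith

lemma norm_zeta_product_ge_one {x : ℝ} (hx : 0 < x) (y : ℝ) :
    1 ≤ ‖riemannZeta (1 + x)‖ ^ 3 * ‖riemannZeta (1 + x + Complex.I * y)‖ ^ 4 *
      ‖riemannZeta (1 + x + 2 * Complex.I * y)‖ := by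
  have := DirichletCharacter.norm_LFunction_product_ge_one (N := 1) 1 hx y
  simpa [DirichletCharacter.LFunction_modOne_eq, norm_mul, norm_pow] using this

lemma exists_norm_riemannZeta_le_im {ε : ℝ} (h0 : 0 < ε) (h1 : ε ≤ 1) :
    ∃ C > 0, (∀ z : ℂ, 1 ≤ z.re → z.re ≤ 2 → 1 ≤ |z.im| →
      ‖riemannZeta z‖ ≤ C * (2 + |z.im|) ^ ε ∧ ‖deriv riemannZeta z‖ ≤ C * (2 + |z.im|) ^ ε) ∧
      ∀ x : ℝ, 0 < x → x ≤ 1 → ‖riemannZeta (1 + x)‖ ≤ C / x := by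
  obtain ⟨C, hC, h⟩ := exists_norm_riemannZeta₀_le_im h0 h1
  obtain ⟨D, hD, hd⟩ := exists_norm_iteratedDeriv_le differentiable_riemannZeta₀ (r := ε / 2)
    (by linarith) (by linarith) h0.le hC h 1
  refine ⟨1 + 2 * C * 2 + D, by positivity, fun z hz1 hz2 him => ?_, fun x hx0 hx1 => ?_⟩
  · have hz : z ≠ 1 := by rintro rfl; norm_num at him
    have hn : 1 ≤ ‖z - 1‖ := by
      have := Complex.abs_im_le_norm (z - 1)
      simp at this
      linarith
    have ht : (1:ℝ) ≤ (2 + |z.im|) ^ ε := Real.one_le_rpow (by linarith) h0.le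
    have hi : ‖(z - 1)⁻¹‖ ≤ 1 := by
      rw [norm_inv]; exact inv_le_one_of_one_le₀ hn
    constructor
    · rw [riemannZeta_eq_inv_sub_add hz]
      refine (norm_add_le _ _).trans ?_
      have := h z (by linarith) (by linarith)
      nlinarith
    · have h2 := hd z hz1 hz2
      rw [iteratedDeriv_one] at h2
      have h3 : deriv riemannZeta z = - ((z - 1)⁻¹) ^ 2 + deriv riemannZeta₀ z := by
        rw [deriv_riemannZeta_eq_neg_inv_sub_sq_add hz]
      rw [h3]
      refine (norm_add_le _ _).trans ?_
      rw [norm_neg, norm_pow]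
      have : ‖(z - 1)⁻¹‖ ^ 2 ≤ 1 := pow_le_one₀ (norm_nonneg _) hi
      nlinarith
  · have hz : (1 + x : ℂ) ≠ 1 := by
      intro h; simp at h; linarith
    rw [riemannZeta_eq_inv_sub_add hz]
    refine (norm_add_le _ _).trans ?_
    have h2 := h (1 + x) (by simp; linarith) (by simp; linarith)
    have h3 : (2 + |(1 + x : ℂ).im|) ^ ε ≤ 2 := by
      simp only [Complex.add_im, Complex.one_im, Complex.ofReal_im, add_zero, abs_zero]
      calc (2:ℝ) ^ ε ≤ 2 ^ (1:ℝ) := Real.rpow_le_rpow_of_exponent_le (by norm_num) h1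
        _ = 2 := Real.rpow_one 2
    have h4 : ‖((1 + x : ℂ) - 1)⁻¹‖ = 1 / x := by
      rw [add_sub_cancel_left, norm_inv, Complex.norm_real, Real.norm_of_nonneg hx0.le, one_div]
    rw [h4]
    have h5 : C * (2 + |(1 + x : ℂ).im|) ^ ε ≤ C * 2 := by gcongr
    rw [le_div_iff₀ hx0, add_mul, one_div, inv_mul_cancel₀ hx0.ne']
    nlinarith [norm_nonneg (riemannZeta₀ (1 + x))]

lemma exists_zeta_pow_four_ge {ε : ℝ} (h0 : 0 < ε) (h1 : ε ≤ 1) :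
    ∃ c > 0, ∀ x y : ℝ, 0 < x → x ≤ 1 → 1 ≤ |y| →
      c * x ^ 3 * (2 + |y|) ^ (-ε) ≤ ‖riemannZeta (1 + x + Complex.I * y)‖ ^ 4 := by
  obtain ⟨C, hC, h, h'⟩ := exists_norm_riemannZeta_le_im h0 h1
  refine ⟨(C ^ 3 * (C * 2 ^ ε))⁻¹, by positivity, fun x y hx hx1 hy => ?_⟩
  have hp := norm_zeta_product_ge_one hx y
  have e1 := h' x hx hx1
  have e2 : ‖riemannZeta (1 + x + 2 * Complex.I * y)‖ ≤ C * (2 ^ ε * (2 + |y|) ^ ε) := by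
    refine (h _ (by simp; linarith) (by simp; linarith) ?_).1.trans ?_
    · simp [abs_mul]; linarith
    · rw [← Real.mul_rpow (by norm_num) (by positivity)]
      gcongr
      simp [abs_mul]
      linarith
  set q := ‖riemannZeta (1 + x + Complex.I * y)‖ ^ 4 with hq
  have hq0 : 0 ≤ q := by positivity
  have e3 : 1 ≤ (C / x) ^ 3 * q * (C * (2 ^ ε * (2 + |y|) ^ ε)) := by
    refine hp.trans ?_
    gcongr
  rw [Real.rpow_neg (by positivity)]
  have ht : 0 < (2 + |y|) ^ ε := by positivity
  have e4 : (C / x) ^ 3 * q * (C * (2 ^ ε * (2 + |y|) ^ ε)) =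
      (C ^ 3 * (C * 2 ^ ε)) * (2 + |y|) ^ ε / x ^ 3 * q := by field_simp
  rw [e4] at e3
  calc (C ^ 3 * (C * 2 ^ ε))⁻¹ * x ^ 3 * ((2 + |y|) ^ ε)⁻¹
      ≤ (C ^ 3 * (C * 2 ^ ε))⁻¹ * x ^ 3 * ((2 + |y|) ^ ε)⁻¹ *
        ((C ^ 3 * (C * 2 ^ ε)) * (2 + |y|) ^ ε / x ^ 3 * q) :=
        le_mul_of_one_le_right (by positivity) e3
    _ = q := by field_simp

lemma exists_norm_riemannZeta_ge {ε : ℝ} (h0 : 0 < ε) (h1 : ε ≤ 1) :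
    ∃ c > 0, ∀ x y : ℝ, 0 < x → x ≤ 1 → 1 ≤ |y| →
      c * (2 + |y|) ^ (-(4 * ε)) ≤ ‖riemannZeta (1 + x + Complex.I * y)‖ := by
  obtain ⟨C, hC, h, -⟩ := exists_norm_riemannZeta_le_im h0 h1
  obtain ⟨c, hc, hl⟩ := exists_zeta_pow_four_ge h0 h1
  set c₁ := min c 1 with hc₁
  have hc₁0 : 0 < c₁ := lt_min hc one_pos
  have hc₁c : c₁ ^ 4 ≤ c := by
    calc c₁ ^ 4 ≤ c₁ ^ 1 := pow_le_pow_of_le_one hc₁0.le (min_le_right _ _) (by norm_num)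
      _ ≤ c := by rw [pow_one]; exact min_le_left _ _
  set κ := min 1 (c₁ / (2 * C)) with hκ
  have hκ0 : 0 < κ := lt_min one_pos (by positivity)
  have hκ1 : κ ≤ 1 := min_le_left _ _
  have hκC : C * κ ≤ c₁ / 2 := by
    calc C * κ ≤ C * (c₁ / (2 * C)) := by gcongr; exact min_le_right _ _
      _ = c₁ / 2 := by field_simp
  refine ⟨c₁ * κ ^ 3 / 2, by positivity, fun x y hx hx1 hy => ?_⟩
  set τ := 2 + |y| with hτ
  have hτ1 : 1 ≤ τ := by linarith
  have hτ0 : 0 < τ := by linarith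
  set v := τ ^ (-ε) with hv
  have hv0 : 0 < v := by positivity
  have hv1 : v ≤ 1 := Real.rpow_le_one_of_one_le_of_nonpos hτ1 (by linarith)
  have hv4 : τ ^ (-(4 * ε)) = v ^ 4 := by
    rw [hv, ← Real.rpow_natCast, ← Real.rpow_mul hτ0.le]; congr 1; push_cast; ring
  have hvinv : τ ^ ε * v = 1 := by
    rw [hv, ← Real.rpow_add hτ0]; simp
  set x₀ := κ ^ 4 * v ^ 5 with hx₀
  have hx₀0 : 0 < x₀ := by positivity
  have hx₀1 : x₀ ≤ 1 := mul_le_one₀ (pow_le_one₀ hκ0.le hκ1) (by positivity)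
    (pow_le_one₀ hv0.le hv1)
  have large : ∀ u : ℝ, x₀ ≤ u → u ≤ 1 →
      c₁ * κ ^ 3 * v ^ 4 ≤ ‖riemannZeta (1 + u + Complex.I * y)‖ := by
    intro u hu hu1
    refine le_of_pow_le_pow_left₀ (n := 4) (by norm_num) (norm_nonneg _) ?_
    refine le_trans ?_ (hl u y (hx₀0.trans_le hu) hu1 hy)
    calc (c₁ * κ ^ 3 * v ^ 4) ^ 4 = c₁ ^ 4 * x₀ ^ 3 * v := by rw [hx₀]; ring
      _ ≤ c * u ^ 3 * v := by gcongr
  rw [hv4]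
  rcases le_or_gt x₀ x with hxx | hxx
  · refine le_trans ?_ (large x hxx hx1)
    have : 0 < c₁ * κ ^ 3 * v ^ 4 := by positivity
    linarith
  · have hL := large x₀ le_rfl hx₀1
    have hd : ∀ u ∈ Set.Icc x x₀, HasDerivWithinAt
        (fun u : ℝ => riemannZeta (1 + u + Complex.I * y))
        (deriv riemannZeta (1 + u + Complex.I * y)) (Set.Icc x x₀) u := by
      intro u hu
      have hne : (1 + u + Complex.I * y : ℂ) ≠ 1 := by
        intro hh
        have := congrArg Complex.im hh
        simp at this
        rw [this] at hy; norm_num at hy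
      have h3 := (differentiableAt_riemannZeta hne).hasDerivAt
      have h4 : HasDerivAt (fun u : ℝ => (1 + u + Complex.I * y : ℂ)) 1 u :=
        ((Complex.ofRealCLM.hasDerivAt (x := u)).const_add 1).add_const _
      have h6 := (h3.comp u h4).hasDerivWithinAt (s := Set.Icc x x₀)
      rw [mul_one] at h6
      exact h6
    have hb : ∀ u ∈ Set.Ico x x₀, ‖deriv riemannZeta (1 + u + Complex.I * y)‖ ≤ C * τ ^ ε := by
      intro u hu
      have h5 := (h (1 + u + Complex.I * y) (by simp; linarith [hu.1])
        (by simp; linarith [hu.2]) (by simpa using hy)).2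
      simpa using h5
    have hm := norm_image_sub_le_of_norm_deriv_le_segment' hd hb x₀ (Set.right_mem_Icc.2 hxx.le)
    have hm2 : C * τ ^ ε * (x₀ - x) ≤ c₁ * κ ^ 3 * v ^ 4 / 2 := by
      calc C * τ ^ ε * (x₀ - x) ≤ C * τ ^ ε * x₀ := by gcongr; linarith
        _ = (C * κ) * κ ^ 3 * v ^ 4 * (τ ^ ε * v) := by rw [hx₀]; ring
        _ = (C * κ) * κ ^ 3 * v ^ 4 := by rw [hvinv, mul_one]
        _ ≤ (c₁ / 2) * κ ^ 3 * v ^ 4 := by gcongr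
        _ = _ := by ring
    have := norm_sub_norm_le (riemannZeta (1 + x₀ + Complex.I * y))
      (riemannZeta (1 + x + Complex.I * y))
    linarith

lemma riemannZeta₁_ne_zero {s : ℂ} (hs : 1 ≤ s.re) : riemannZeta₁ s ≠ 0 := by
  by_cases h : s = 1
  · simp [h]
  · have h2 := riemannZeta_ne_zero_of_one_le_re hs
    rw [riemannZeta_eq_inv_sub_mul h] at h2
    exact right_ne_zero_of_mul h2

theorem exists_norm_riemannZeta₁_ge {ε : ℝ} (h0 : 0 < ε) (h1 : ε ≤ 1) :
    ∃ c > 0, ∀ s : ℂ, 1 < s.re → s.re ≤ 2 → c * (2 + |s.im|) ^ (1 - ε) ≤ ‖riemannZeta₁ s‖ := by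
  obtain ⟨c, hc, h⟩ := exists_norm_riemannZeta_ge (ε := ε / 4) (by linarith) (by linarith)
  set K : Set ℂ := Set.Icc 1 2 ×ℂ Set.Icc (-1) 1 with hK
  have hKc : IsCompact K := isCompact_Icc.reProdIm isCompact_Icc
  have hKne : K.Nonempty := ⟨1, by simp [hK, Complex.mem_reProdIm]⟩
  obtain ⟨z, hzK, hz⟩ := hKc.exists_isMinOn hKne
    (f := fun s => ‖riemannZeta₁ s‖) differentiable_riemannZeta₁.continuous.norm.continuousOn
  have hzpos : 0 < ‖riemannZeta₁ z‖ := norm_pos_iff.2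
    (riemannZeta₁_ne_zero ((Complex.mem_reProdIm.1 hzK).1.1))
  refine ⟨min (c / 3) (‖riemannZeta₁ z‖ / 3), by positivity, fun s hs1 hs2 => ?_⟩
  have ht0 : 0 < 2 + |s.im| := by positivity
  rcases le_or_gt 1 |s.im| with him | him
  · have hs : s = 1 + ((s.re - 1 : ℝ) : ℂ) + Complex.I * (s.im : ℝ) := by
      apply Complex.ext <;> simp
    have h2 := h (s.re - 1) s.im (by linarith) (by linarith) him
    rw [← hs] at h2
    have hne : s ≠ 1 := by rintro rfl; norm_num at him
    have hz1 : riemannZeta₁ s = (s - 1) * riemannZeta s := by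
      rw [riemannZeta_eq_inv_sub_mul hne, ← mul_assoc, mul_inv_cancel₀ (sub_ne_zero.2 hne), one_mul]
    have h3 : (2 + |s.im|) / 3 ≤ ‖s - 1‖ := by
      have := Complex.abs_im_le_norm (s - 1)
      simp at this
      linarith
    rw [hz1, norm_mul]
    calc min (c / 3) (‖riemannZeta₁ z‖ / 3) * (2 + |s.im|) ^ (1 - ε)
        ≤ (c / 3) * (2 + |s.im|) ^ (1 - ε) := by gcongr; exact min_le_left _ _
      _ = ((2 + |s.im|) / 3) * (c * (2 + |s.im|) ^ (-(4 * (ε / 4)))) := by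
          rw [show 1 - ε = 1 + -(4 * (ε / 4)) by ring, Real.rpow_add ht0, Real.rpow_one]; ring
      _ ≤ _ := by gcongr
  · have hsK : s ∈ K := Complex.mem_reProdIm.2 ⟨⟨hs1.le, hs2⟩, abs_le.1 him.le⟩
    refine le_trans ?_ (hz hsK)
    have h4 : (2 + |s.im|) ^ (1 - ε) ≤ 3 := by
      calc (2 + |s.im|) ^ (1 - ε) ≤ (2 + |s.im|) ^ (1:ℝ) :=
            Real.rpow_le_rpow_of_exponent_le (by linarith [abs_nonneg s.im]) (by linarith)
        _ ≤ 3 := by rw [Real.rpow_one]; linarith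
    calc min (c / 3) (‖riemannZeta₁ z‖ / 3) * (2 + |s.im|) ^ (1 - ε)
        ≤ (‖riemannZeta₁ z‖ / 3) * 3 := by gcongr; exact min_le_right _ _
      _ = ‖riemannZeta₁ z‖ := by ring

/-- The negative logarithmic derivative of `ζ` minus `ζ`, with its removable singularity at `1`
removed. -/
noncomputable def zetaDiff (s : ℂ) : ℂ := -(deriv riemannZeta₁ s) / riemannZeta₁ s - riemannZeta₀ s

lemma analyticAt_zetaDiff {s : ℂ} (hs : 1 ≤ s.re) : AnalyticAt ℂ zetaDiff s := by
  have h1 := differentiable_riemannZeta₁.analyticAt s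
  have h0 := differentiable_riemannZeta₀.analyticAt s
  exact ((h1.deriv.neg).div h1 (riemannZeta₁_ne_zero hs)).sub h0

theorem exists_norm_iteratedDeriv_zetaDiff_le (k : ℕ) :
    ∀ {ε : ℝ}, 0 < ε → ε ≤ 1 → ∃ C > 0, ∀ s : ℂ, 1 < s.re → s.re ≤ 2 →
      ‖iteratedDeriv k zetaDiff s‖ ≤ C * (2 + |s.im|) ^ ε := by
  induction k using Nat.strong_induction_on with
  | _ k ih =>
  intro ε h0 h1
  set δ := ε / 4 with hδ
  have hδ0 : 0 < δ := by positivity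
  have hδ1 : δ ≤ 1 := by linarith
  obtain ⟨A, hA, hz0⟩ := exists_norm_riemannZeta₀_le_im hδ0 hδ1
  obtain ⟨B, hB, hz1⟩ := exists_norm_riemannZeta₁_le_im hδ0 hδ1
  obtain ⟨c, hc, hlow⟩ := exists_norm_riemannZeta₁_ge hδ0 hδ1
  have hτ1 : ∀ s : ℂ, 1 ≤ 2 + |s.im| := fun s => by linarith [abs_nonneg s.im]
  have hτ0 : ∀ s : ℂ, 0 < 2 + |s.im| := fun s => by linarith [abs_nonneg s.im]
  have hD : ∀ j, ∃ D > 0, ∀ s : ℂ, 1 ≤ s.re → s.re ≤ 2 →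
      ‖iteratedDeriv j riemannZeta₁ s‖ ≤ D * (2 + |s.im|) ^ (1 + δ) := fun j =>
    exists_norm_iteratedDeriv_le differentiable_riemannZeta₁ (r := δ / 2)
      (by linarith) (by linarith) (by linarith) hB hz1 j
  choose D hD0 hDb using hD
  obtain ⟨E, hE, hEb⟩ := exists_norm_iteratedDeriv_le
    (differentiable_riemannZeta₀.mul differentiable_riemannZeta₁) (r := δ / 2) (C := A * B)
    (a := 1 + 2 * δ) (by linarith) (by linarith) (by linarith) (by positivity) (fun z h2 h3 => by
      rw [Pi.mul_apply, norm_mul]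
      calc ‖riemannZeta₀ z‖ * ‖riemannZeta₁ z‖
          ≤ (A * (2 + |z.im|) ^ δ) * (B * (2 + |z.im|) ^ (1 + δ)) := by
            gcongr
            · exact hz0 z h2 h3
            · exact hz1 z h2 h3
        _ = _ := by
            rw [show 1 + 2 * δ = δ + (1 + δ) by ring, Real.rpow_add (hτ0 z) δ]; ring) k
  have hF : ∀ j, ∃ M > 0, j < k → ∀ s : ℂ, 1 < s.re → s.re ≤ 2 →
      ‖iteratedDeriv j zetaDiff s‖ ≤ M * (2 + |s.im|) ^ δ := by
    intro j
    by_cases hj : j < k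
    · obtain ⟨M, hM, h⟩ := ih j hj hδ0 hδ1
      exact ⟨M, hM, fun _ => h⟩
    · exact ⟨1, one_pos, fun h => absurd h hj⟩
  choose M hM0 hMb using hF
  set Q := D (k + 1) + E + ∑ i ∈ Finset.range k, (k.choose i : ℝ) * M i * D (k - i) with hQ
  have hQ0 : 0 < Q := by
    have : 0 ≤ ∑ i ∈ Finset.range k, (k.choose i : ℝ) * M i * D (k - i) :=
      Finset.sum_nonneg fun i _ => by have := hM0 i; have := hD0 (k - i); positivity
    have := hD0 (k + 1)
    linarith
  refine ⟨Q / c, by positivity, fun s hs1 hs2 => ?_⟩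
  set τ := 2 + |s.im| with hτ
  have hτ0' : 0 < τ := hτ0 s
  have hZ := differentiable_riemannZeta₁.analyticAt s
  have hprod : zetaDiff * riemannZeta₁ =ᶠ[nhds s]
      fun z => -(deriv riemannZeta₁ z) - (riemannZeta₀ * riemannZeta₁) z := by
    have : {z : ℂ | 1 < z.re} ∈ nhds s :=
      (isOpen_lt continuous_const Complex.continuous_re).mem_nhds hs1
    filter_upwards [this] with z hz
    have hne := riemannZeta₁_ne_zero (s := z) (le_of_lt hz)
    simp only [Pi.mul_apply, zetaDiff]
    field_simp
  have hleib := iteratedDeriv_mul (n := k) (analyticAt_zetaDiff hs1.le).contDiffAt hZ.contDiffAt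
  rw [hprod.iteratedDeriv_eq k, Finset.sum_range_succ] at hleib
  have hW : iteratedDeriv k
      (fun z => -(deriv riemannZeta₁ z) - (riemannZeta₀ * riemannZeta₁) z) s =
      -iteratedDeriv (k + 1) riemannZeta₁ s - iteratedDeriv k (riemannZeta₀ * riemannZeta₁) s := by
    have hn : ContDiffAt ℂ k (fun z => -deriv riemannZeta₁ z) s := hZ.deriv.neg.contDiffAt
    rw [iteratedDeriv_fun_sub hn
      ((differentiable_riemannZeta₀.mul differentiable_riemannZeta₁).analyticAt s).contDiffAt,
      iteratedDeriv_fun_neg, iteratedDeriv_succ']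
  rw [hW] at hleib
  simp only [Nat.choose_self, Nat.cast_one, one_mul, Nat.sub_self, iteratedDeriv_zero] at hleib
  have hmain : ‖iteratedDeriv k zetaDiff s‖ * ‖riemannZeta₁ s‖ ≤ Q * τ ^ (1 + 2 * δ) := by
    rw [← norm_mul, ← sub_eq_of_eq_add' hleib]
    refine (norm_sub_le _ _).trans ?_
    have e1 : ‖-iteratedDeriv (k + 1) riemannZeta₁ s -
        iteratedDeriv k (riemannZeta₀ * riemannZeta₁) s‖ ≤ (D (k + 1) + E) * τ ^ (1 + 2 * δ) := by
      refine (norm_sub_le _ _).trans ?_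
      rw [norm_neg, add_mul]
      refine add_le_add ((hDb (k + 1) s hs1.le hs2).trans ?_) (hEb s hs1.le hs2)
      have := hD0 (k + 1)
      have := Real.rpow_le_rpow_of_exponent_le (hτ1 s) (show 1 + δ ≤ 1 + 2 * δ by linarith)
      gcongr
    have e2 : ‖∑ i ∈ Finset.range k, (k.choose i : ℂ) * iteratedDeriv i zetaDiff s *
        iteratedDeriv (k - i) riemannZeta₁ s‖ ≤
        (∑ i ∈ Finset.range k, (k.choose i : ℝ) * M i * D (k - i)) * τ ^ (1 + 2 * δ) := by
      refine (norm_sum_le _ _).trans ?_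
      rw [Finset.sum_mul]
      refine Finset.sum_le_sum fun i hi => ?_
      rw [norm_mul, norm_mul, Complex.norm_natCast]
      have hM0i := hM0 i
      calc (k.choose i : ℝ) * ‖iteratedDeriv i zetaDiff s‖ * ‖iteratedDeriv (k - i) riemannZeta₁ s‖
          ≤ (k.choose i : ℝ) * (M i * τ ^ δ) * (D (k - i) * τ ^ (1 + δ)) := by
            gcongr
            · exact hMb i (Finset.mem_range.1 hi) s hs1 hs2
            · exact hDb _ s hs1.le hs2
        _ = _ := by
            rw [show 1 + 2 * δ = δ + (1 + δ) by ring, Real.rpow_add hτ0' δ]; ring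
    rw [hQ, add_mul]
    exact add_le_add e1 e2
  have hl := hlow s hs1 hs2
  have h5 : ‖iteratedDeriv k zetaDiff s‖ * (c * τ ^ (1 - δ)) ≤ Q * τ ^ (1 + 2 * δ) :=
    le_trans (by gcongr) hmain
  have h6 : τ ^ (1 + 2 * δ) ≤ τ ^ ε * τ ^ (1 - δ) := by
    rw [← Real.rpow_add hτ0']
    exact Real.rpow_le_rpow_of_exponent_le (hτ1 s) (by rw [hδ]; linarith)
  have h7 : 0 < τ ^ (1 - δ) := by positivity
  rw [div_mul_eq_mul_div, le_div_iff₀ hc]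
  refine le_of_mul_le_mul_right ?_ h7
  calc ‖iteratedDeriv k zetaDiff s‖ * c * τ ^ (1 - δ) ≤ Q * τ ^ (1 + 2 * δ) := by linarith
    _ ≤ Q * (τ ^ ε * τ ^ (1 - δ)) := by gcongr
    _ = _ := by ring

/-- A smooth cutoff supported in `[-1, 1]` and equal to `1` on `[-1/2, 1/2]`, together with its
rapidly decaying Lipschitz Fourier transform. -/
theorem exists_smooth_cutoff : ∃ (w : ℝ → ℝ) (g : ℝ → ℂ),
    (∀ t, 0 ≤ w t) ∧ (∀ t, w t ≤ 1) ∧ (∀ t, |t| ≤ 1 / 2 → w t = 1) ∧ (∀ t, 1 ≤ |t| → w t = 0) ∧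
    Continuous g ∧ (∀ k : ℕ, ∃ C > 0, ∀ x, |x| ^ k * ‖g x‖ ≤ C) ∧
    (∀ k : ℕ, Integrable fun x => |x| ^ k * ‖g x‖) ∧
    (∃ L > 0, ∀ x y, ‖g x - g y‖ ≤ L * |x - y|) ∧
    ∀ t, (w t : ℂ) = ∫ x, g x * expi (x * t) := by
  let b : ContDiffBump (0 : ℝ) := ⟨1 / 2, 1, by norm_num, by norm_num⟩
  have hs : ContDiff ℝ ((⊤ : ℕ∞) : WithTop ℕ∞) (fun t => (b t : ℂ)) :=
    Complex.ofRealCLM.contDiff.comp b.contDiff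
  have hsupp : HasCompactSupport (fun t => (b t : ℂ)) :=
    b.hasCompactSupport.comp_left (g := Complex.ofReal) Complex.ofReal_zero
  let W : SchwartzMap ℝ ℂ := hsupp.toSchwartzMap hs
  let G : SchwartzMap ℝ ℂ := FourierTransform.fourier W
  refine ⟨b, G, fun t => b.nonneg, fun t => b.le_one, fun t ht => ?_, fun t ht => ?_,
    G.continuous, fun k => ?_, fun k => ?_, ?_, fun t => ?_⟩
  · exact b.one_of_mem_closedBall (by simpa [Metric.mem_closedBall, b] using ht)
  · exact b.zero_of_le_dist (by simpa using ht)
  · obtain ⟨C, hC, h⟩ := G.decay k 0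
    exact ⟨C, hC, fun x => by simpa using h x⟩
  · simpa using G.integrable_pow_mul volume k
  · obtain ⟨C, hC, h⟩ := G.decay 0 1
    refine ⟨C, hC, fun x y => ?_⟩
    have h1 : ∀ z ∈ Set.univ, ‖deriv G z‖ ≤ C := fun z _ => by
      have := h z
      rwa [pow_zero, one_mul, norm_iteratedFDeriv_eq_norm_iteratedDeriv, iteratedDeriv_one] at this
    simpa using convex_univ.norm_image_sub_le_of_norm_deriv_le (f := G) (x := y) (y := x)
      (fun z _ => G.differentiableAt) h1 (Set.mem_univ _) (Set.mem_univ _)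
  · have h1 : FourierTransformInv.fourierInv G t = W t := by simp [G]
    rw [SchwartzMap.fourierInv_coe, Real.fourierInv_eq'] at h1
    have h2 : W t = (b t : ℂ) := rfl
    rw [← h2, ← h1]
    refine integral_congr_ae (Filter.Eventually.of_forall fun x => ?_)
    simp only [expi, smul_eq_mul]
    rw [mul_comm]
    congr 5
    simp [mul_comm]

/-- Transfer of pointwise bounds for exponential sums to sums against a weight with integrable
Fourier transform. -/
lemma norm_tsum_mul_weight_le {w : ℝ → ℝ} {g : ℝ → ℂ} {B : ℝ → ℝ} {a : ℕ → ℂ} {t : ℕ → ℝ}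
    (hg : Continuous g) (hgi : Integrable fun x => ‖g x‖) (hw : ∀ t, (w t : ℂ) = ∫ x, g x * expi (x * t))
    (ha : Summable fun n => ‖a n‖) (hB : ∀ x, ‖∑' n, a n * expi (x * t n)‖ ≤ B x)
    (hBi : Integrable fun x => ‖g x‖ * B x) :
    ‖∑' n, a n * (w (t n) : ℂ)‖ ≤ ∫ x, ‖g x‖ * B x := by
  have hc : ∀ n, Continuous fun x => a n * (g x * expi (x * t n)) := fun n =>
    continuous_const.mul (hg.mul (continuous_expi.comp (continuous_id.mul continuous_const)))
  have hn : ∀ n x, ‖a n * (g x * expi (x * t n))‖ = ‖a n‖ * ‖g x‖ := fun n x => by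
    rw [norm_mul, norm_mul, norm_expi, mul_one]
  have hi : ∀ n, Integrable fun x => a n * (g x * expi (x * t n)) := fun n => by
    refine (hgi.const_mul ‖a n‖).mono' (hc n).aestronglyMeasurable ?_
    exact Filter.Eventually.of_forall fun x => (hn n x).le
  have hS := hasSum_integral_of_summable_integral_norm hi (by
    simp_rw [hn, integral_const_mul]
    exact ha.mul_right _)
  have h1 : ∀ n, a n * (w (t n) : ℂ) = ∫ x, a n * (g x * expi (x * t n)) := fun n => by
    rw [hw, integral_const_mul]
  simp_rw [h1]
  rw [hS.tsum_eq]
  refine norm_integral_le_of_norm_le hBi (Filter.Eventually.of_forall fun x => ?_)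
  have h2 : ∑' n, a n * (g x * expi (x * t n)) = g x * ∑' n, a n * expi (x * t n) := by
    rw [← tsum_mul_left]
    exact tsum_congr fun n => by ring
  rw [h2, norm_mul]
  exact mul_le_mul_of_nonneg_left (hB x) (norm_nonneg _)

/-- The Dirichlet coefficients of the negative logarithmic derivative of `ζ` minus `ζ`. -/
noncomputable def diffCoeff (n : ℕ) : ℂ := ((ArithmeticFunction.vonMangoldt n - 1 : ℝ) : ℂ)

lemma diffCoeff_eq : diffCoeff = (fun n => ((ArithmeticFunction.vonMangoldt n : ℝ) : ℂ)) - 1 := by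
  ext n; simp [diffCoeff]

lemma abscissa_diffCoeff : LSeries.abscissaOfAbsConv diffCoeff ≤ 1 := by
  have h : ∀ y : ℝ, 1 < y → LSeriesSummable diffCoeff y := fun y hy => by
    rw [diffCoeff_eq]
    refine LSeriesSummable.sub (ArithmeticFunction.LSeriesSummable_vonMangoldt (by simpa using hy)) ?_
    exact LSeriesSummable_one_iff.2 (by simpa using hy)
  exact_mod_cast LSeries.abscissaOfAbsConv_le_of_forall_lt_LSeriesSummable h

lemma zetaDiff_eq_LSeries {s : ℂ} (hs : 1 < s.re) : zetaDiff s = LSeries diffCoeff s := by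
  have h1 : s ≠ 1 := fun h => by rw [h] at hs; simp at hs
  have h2 := sub_ne_zero_of_ne h1
  have h3 := riemannZeta₁_ne_zero hs.le
  rw [diffCoeff_eq, LSeries_sub (ArithmeticFunction.LSeriesSummable_vonMangoldt hs)
    (LSeriesSummable_one_iff.2 hs), ArithmeticFunction.LSeries_vonMangoldt_eq_deriv_riemannZeta_div hs,
    LSeries_one_eq_riemannZeta hs, deriv_riemannZeta_eq_neg_inv_sub_sq_mul_add h1,
    riemannZeta_eq_inv_sub_mul h1, zetaDiff, riemannZeta₁]
  rw [riemannZeta₁] at h3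
  field_simp
  ring

lemma iteratedDeriv_zetaDiff (k : ℕ) {s : ℂ} (hs : 1 < s.re) :
    iteratedDeriv k zetaDiff s = (-1) ^ k * LSeries (LSeries.logMul^[k] diffCoeff) s := by
  have hlt : LSeries.abscissaOfAbsConv diffCoeff < s.re :=
    abscissa_diffCoeff.trans_lt (by exact_mod_cast hs)
  rw [← LSeries_iteratedDeriv k hlt]
  refine Filter.EventuallyEq.iteratedDeriv_eq k ?_
  have : {z : ℂ | 1 < z.re} ∈ nhds s :=
    (isOpen_lt continuous_const Complex.continuous_re).mem_nhds hs
  filter_upwards [this] with z hz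
  exact zetaDiff_eq_LSeries hz

lemma logMul_iterate_apply (f : ℕ → ℂ) (k n : ℕ) :
    LSeries.logMul^[k] f n = (log n : ℂ) ^ k * f n := by
  induction k with
  | zero => simp
  | succ k ih =>
    rw [Function.iterate_succ_apply', LSeries.logMul, ih, pow_succ, ← Complex.natCast_log]
    ring

/-- The real terms of the Dirichlet series `∑ (Λ(n) - 1) (log n)^k n^{-σ}`. -/
noncomputable def diffTerm (k : ℕ) (σ : ℝ) (n : ℕ) : ℝ :=
  (ArithmeticFunction.vonMangoldt n - 1) * log n ^ k * (n : ℝ) ^ (-σ)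

lemma term_logMul_diffCoeff {k : ℕ} (hk : k ≠ 0) (σ τ : ℝ) (n : ℕ) :
    LSeries.term (LSeries.logMul^[k] diffCoeff) (σ - 2 * π * τ * Complex.I) n =
      (diffTerm k σ n : ℂ) * expi (τ * log n) := by
  rcases Nat.eq_zero_or_pos n with rfl | hn
  · simp [diffTerm, hk]
  · have hn' : (0 : ℝ) < n := by exact_mod_cast hn
    have hnc : (n : ℂ) ≠ 0 := by exact_mod_cast hn.ne'
    rw [LSeries.term_of_ne_zero hn.ne', logMul_iterate_apply, diffCoeff, diffTerm, expi,
      div_eq_mul_inv, ← Complex.cpow_neg, Complex.cpow_def_of_ne_zero hnc, Real.rpow_def_of_pos hn',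
      ← Complex.natCast_log]
    push_cast
    rw [show Complex.log n * -(σ - 2 * π * τ * Complex.I) =
      Complex.log n * -σ + 2 * π * (τ * Complex.log n) * Complex.I by ring, Complex.exp_add]
    ring

lemma summable_norm_diffTerm {k : ℕ} (hk : k ≠ 0) {σ : ℝ} (hσ : 1 < σ) :
    Summable fun n => ‖(diffTerm k σ n : ℂ)‖ := by
  have h : LSeriesSummable (LSeries.logMul^[k] diffCoeff) (σ - 2 * π * (0 : ℝ) * Complex.I) := by
    refine LSeriesSummable_of_abscissaOfAbsConv_lt_re ?_
    rw [LSeries.absicssaOfAbsConv_logPowMul]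
    refine abscissa_diffCoeff.trans_lt ?_
    simpa using (by exact_mod_cast hσ : (1 : EReal) < (σ : EReal))
  have h2 := h.norm
  simp_rw [term_logMul_diffCoeff hk, norm_mul, norm_expi, mul_one] at h2
  exact h2

lemma norm_tsum_diffTerm {k : ℕ} (hk : k ≠ 0) {σ : ℝ} (hσ : 1 < σ) (τ : ℝ) :
    ‖∑' n, (diffTerm k σ n : ℂ) * expi (τ * log n)‖ =
      ‖iteratedDeriv k zetaDiff (σ - 2 * π * τ * Complex.I)‖ := by
  rw [iteratedDeriv_zetaDiff k (by simpa using hσ), norm_mul, norm_pow, norm_neg, norm_one, one_pow,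
    one_mul, LSeries]
  simp_rw [term_logMul_diffCoeff hk]

/-- The positive integers `n` with `|log n - log x| < h`, for `h ≤ 1/2`. -/
noncomputable def logWindow (x h : ℝ) : Finset ℕ :=
  (Finset.Icc 1 ⌊2 * x⌋₊).filter fun n => |log n - log x| < h

lemma exp_half_le_two : exp (1 / 2) ≤ 2 := by
  have h : exp (1 / 2) * exp (1 / 2) = exp 1 := by rw [← Real.exp_add]; norm_num
  have := Real.exp_one_lt_d9
  nlinarith [Real.exp_pos (1 / 2)]

lemma exp_neg_half_ge : 1 / 2 ≤ exp (-(1 / 2)) := by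
  have h := inv_anti₀ (Real.exp_pos (1 / 2)) exp_half_le_two
  rw [Real.exp_neg]
  linarith

lemma le_two_mul_of_log {x h t : ℝ} (hx : 0 < x) (hh : h ≤ 1 / 2) (ht : 0 < t)
    (hl : |log t - log x| < h) : t ≤ 2 * x ∧ x / 2 ≤ t := by
  obtain ⟨h1, h2⟩ := abs_lt.1 hl
  have e : t = x * exp (log t - log x) := by
    rw [Real.exp_sub, Real.exp_log ht, Real.exp_log hx]; field_simp
  have a := Real.exp_le_exp.2 (show log t - log x ≤ 1 / 2 by linarith)
  have b := Real.exp_le_exp.2 (show -(1 / 2) ≤ log t - log x by linarith)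
  have := exp_half_le_two
  have := exp_neg_half_ge
  constructor <;> rw [e] <;> nlinarith

lemma mem_logWindow {x h : ℝ} (hx : 0 < x) (hh : h ≤ 1 / 2) {n : ℕ} :
    n ∈ logWindow x h ↔ 1 ≤ n ∧ |log n - log x| < h := by
  simp only [logWindow, Finset.mem_filter, Finset.mem_Icc]
  refine ⟨fun h => ⟨h.1.1, h.2⟩, fun ⟨h1, h2⟩ => ⟨⟨h1, ?_⟩, h2⟩⟩
  have h3 : (0 : ℝ) < n := by exact_mod_cast h1
  exact Nat.le_floor (le_two_mul_of_log hx hh h3 h2).1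

lemma exists_smoothed_error_bound {w : ℝ → ℝ} {g : ℝ → ℂ} (hw0 : ∀ t, 1 ≤ |t| → w t = 0)
    (hg : Continuous g) (hgi : ∀ k : ℕ, Integrable fun x => |x| ^ k * ‖g x‖)
    (hw : ∀ t, (w t : ℂ) = ∫ x, g x * expi (x * t)) {k : ℕ} (hk : k ≠ 0) :
    ∃ C > 0, ∀ x h : ℝ, 0 < x → 1 ≤ log x → 0 < h → h ≤ 1 / 2 →
      |∑ n ∈ logWindow x h, diffTerm k (1 + 1 / log x) n * w ((log n - log x) / h)| ≤ C / h := by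
  obtain ⟨M, hM, hb⟩ := exists_norm_iteratedDeriv_zetaDiff_le k one_pos le_rfl
  have hi0 : Integrable fun x => ‖g x‖ := by simpa using hgi 0
  have hi1 : Integrable fun x => ‖g x‖ * (2 + 2 * π * |x|) := by
    have i1 := (hi0.const_mul 2).add ((hgi 1).const_mul (2 * π))
    refine i1.congr (Filter.Eventually.of_forall fun x => ?_)
    simp only [Pi.add_apply, pow_one]
    ring
  set J := ∫ x, ‖g x‖ * (2 + 2 * π * |x|) with hJ
  have hJ0 : 0 ≤ J := integral_nonneg fun x => by positivity
  refine ⟨M * J + 1, by positivity, fun x h hx0 hx h0 h1 => ?_⟩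
  set σ := 1 + 1 / log x with hσ
  have hlx : 0 < log x := by linarith
  have hσ1 : 1 < σ := by rw [hσ]; have : 0 < 1 / log x := by positivity
                         linarith
  have hσ2 : σ ≤ 2 := by
    have : 1 / log x ≤ 1 := by rw [div_le_one hlx]; exact hx
    linarith
  have key := norm_tsum_mul_weight_le (w := w) (g := g) (a := fun n => (diffTerm k σ n : ℂ))
    (t := fun n => (log n - log x) / h) (B := fun y => M / h * (2 + 2 * π * |y|)) hg hi0 hw
    (summable_norm_diffTerm hk hσ1) (fun y => by
      have e : ∀ n : ℕ, (diffTerm k σ n : ℂ) * expi (y * ((log n - log x) / h)) =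
          expi (-(y * log x / h)) * ((diffTerm k σ n : ℂ) * expi (y / h * log n)) := fun n => by
        rw [show y * ((log n - log x) / h) = -(y * log x / h) + y / h * log n by ring, expi_add]
        ring
      simp_rw [e]
      rw [tsum_mul_left, norm_mul, norm_expi, one_mul, norm_tsum_diffTerm hk hσ1]
      refine (hb _ (by simpa using hσ1) (by simpa using hσ2)).trans ?_
      rw [Real.rpow_one, div_mul_eq_mul_div, mul_div_assoc]
      refine mul_le_mul_of_nonneg_left ?_ hM.le
      have : |((σ : ℂ) - 2 * π * ((y / h : ℝ) : ℂ) * Complex.I).im| = 2 * π * (|y| / h) := by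
        rw [← abs_of_pos h0, ← abs_div, abs_of_pos h0]
        have e3 : ((σ : ℂ) - 2 * π * ((y / h : ℝ) : ℂ) * Complex.I).im = -(2 * π * (y / h)) := by
          simp
        rw [e3, abs_neg, abs_mul, abs_of_pos (by positivity : 0 < 2 * π)]
      rw [this, le_div_iff₀ h0]
      have e4 : (2 + 2 * π * (|y| / h)) * h = 2 * h + 2 * π * |y| := by field_simp
      rw [e4]
      linarith) (by
      refine (hi1.const_mul (M / h)).congr (Filter.Eventually.of_forall fun y => ?_)
      ring)
  have e5 : ∫ y, ‖g y‖ * (M / h * (2 + 2 * π * |y|)) = M / h * J := by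
    rw [hJ, ← integral_const_mul]
    exact integral_congr_ae (Filter.Eventually.of_forall fun y => by ring)
  rw [e5, tsum_eq_sum (s := logWindow x h)] at key
  · have e6 : (∑ n ∈ logWindow x h, (diffTerm k σ n : ℂ) * (w ((log n - log x) / h) : ℂ)) =
        ((∑ n ∈ logWindow x h, diffTerm k σ n * w ((log n - log x) / h) : ℝ) : ℂ) := by push_cast; rfl
    rw [e6, Complex.norm_real, Real.norm_eq_abs] at key
    refine key.trans ?_
    rw [div_mul_eq_mul_div]
    gcongr
    linarith
  · intro n hn
    rw [mem_logWindow hx0 h1] at hn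
    rcases Nat.eq_zero_or_pos n with rfl | hn0
    · simp [diffTerm, hk]
    · have : h ≤ |log n - log x| := by
        by_contra hcon
        exact hn ⟨hn0, not_le.1 hcon⟩
      rw [hw0 _ (by rw [abs_div, abs_of_pos h0, le_div_iff₀ h0, one_mul]; exact this)]
      simp

lemma sum_vonMangoldt_sub_primeWeight_le {x h : ℝ} (hx : 2 ≤ x) :
    ∑ n ∈ logWindow x h, (ArithmeticFunction.vonMangoldt n - primeWeight n) ≤ 8 * (√x * log x) := by
  have h0 : ∀ n : ℕ, 0 ≤ ArithmeticFunction.vonMangoldt n - primeWeight n := fun n => by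
    unfold primeWeight
    split_ifs with hp
    · rw [ArithmeticFunction.vonMangoldt_apply_prime hp]; simp
    · simp
  have h1 : ∑ n ∈ logWindow x h, (ArithmeticFunction.vonMangoldt n - primeWeight n) ≤
      ∑ n ∈ Finset.Ioc 0 ⌊2 * x⌋₊, (ArithmeticFunction.vonMangoldt n - primeWeight n) := by
    refine Finset.sum_le_sum_of_subset_of_nonneg ?_ fun n _ _ => h0 n
    intro n hn
    have := Finset.mem_Icc.1 (Finset.mem_filter.1 hn).1
    exact Finset.mem_Ioc.2 ⟨by omega, this.2⟩
  have h2 : ∑ n ∈ Finset.Ioc 0 ⌊2 * x⌋₊, (ArithmeticFunction.vonMangoldt n - primeWeight n) =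
      Chebyshev.psi (2 * x) - Chebyshev.theta (2 * x) := by
    rw [Finset.sum_sub_distrib, Chebyshev.psi, Chebyshev.theta, Finset.sum_filter]
    rfl
  have h3 := Chebyshev.psi_sub_theta_le (x := 2 * x) (by linarith)
  have h4 : √(2 * x) ≤ 2 * √x := by
    rw [Real.sqrt_le_left (by positivity), mul_pow, Real.sq_sqrt (by linarith)]
    linarith
  have h5 : log (2 * x) ≤ 2 * log x := by
    rw [Real.log_mul (by norm_num) (by linarith)]
    have := Real.log_le_log (by norm_num) hx
    linarith
  have h6 : 0 ≤ log (2 * x) := Real.log_nonneg (by linarith)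
  have h7 : 0 ≤ √x := Real.sqrt_nonneg x
  calc _ ≤ 2 * √(2 * x) * log (2 * x) := by linarith
    _ ≤ 2 * (2 * √x) * (2 * log x) := by gcongr
    _ = _ := by ring

lemma rpow_neg_one_add_ge {x n : ℝ} (hx : 1 ≤ log x) (hx2 : 2 ≤ x) (hn0 : 0 < n)
    (hn : n ≤ 2 * x) :
    exp (-2) / (2 * x) ≤ n ^ (-(1 + 1 / log x)) := by
  have hl : 0 < log x := by linarith
  have h1 : log n ≤ log 2 + log x := by
    rw [← Real.log_mul (by norm_num) (by linarith)]
    exact Real.log_le_log hn0 hn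
  have h2 : log 2 ≤ log x := Real.log_le_log (by norm_num) hx2
  have h3 : log n / log x ≤ 2 := by rw [div_le_iff₀ hl]; linarith
  have h4 : exp (-2) / (2 * x) = exp (-2 - (log 2 + log x)) := by
    rw [Real.exp_sub, Real.exp_add, Real.exp_log (by norm_num), Real.exp_log (by linarith)]
  rw [h4, Real.rpow_def_of_pos hn0]
  refine Real.exp_le_exp.2 ?_
  have : log n * -(1 + 1 / log x) = -log n - log n / log x := by ring
  linarith

lemma smoothed_main_term_ge {w : ℝ → ℝ} (hwn : ∀ t, 0 ≤ w t) (hw1 : ∀ t, |t| ≤ 1 / 2 → w t = 1)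
    (k : ℕ) {x h : ℝ} (hx : 1 ≤ log x) (hx2 : 2 ≤ x) (h0 : 0 < h) (h1 : h ≤ 1 / 2)
    (hxh : 4 ≤ x * h) :
    exp (-2) / 8 * h * log x ^ k ≤
      ∑ n ∈ logWindow x h, log n ^ k * (n : ℝ) ^ (-(1 + 1 / log x)) * w ((log n - log x) / h) := by
  have hx0 : 0 < x := by linarith
  set F := Finset.Ioc ⌊x⌋₊ ⌊x + x * h / 2⌋₊ with hF
  have hmem : ∀ n ∈ F, x < n ∧ (n : ℝ) ≤ x + x * h / 2 := fun n hn => by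
    rw [hF, Finset.mem_Ioc] at hn
    exact ⟨(Nat.floor_lt hx0.le).1 hn.1, (Nat.le_floor_iff (by positivity)).1 hn.2⟩
  have hlog : ∀ n ∈ F, 0 < log n - log x ∧ log n - log x ≤ h / 2 := fun n hn => by
    obtain ⟨a, b⟩ := hmem n hn
    refine ⟨by linarith [Real.log_lt_log hx0 a], ?_⟩
    have h2 := Real.log_le_log (by linarith) b
    rw [show x + x * h / 2 = x * (1 + h / 2) by ring, Real.log_mul hx0.ne' (by positivity)] at h2
    have := Real.log_le_sub_one_of_pos (show 0 < 1 + h / 2 by positivity)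
    linarith
  have hcard : x * h / 4 ≤ (F.card : ℝ) := by
    rw [hF, Nat.card_Ioc, Nat.cast_sub (Nat.floor_mono (by nlinarith))]
    have a := Nat.lt_floor_add_one (x + x * h / 2)
    have b := Nat.floor_le hx0.le
    linarith
  have hsub : F ⊆ logWindow x h := fun n hn => by
    rw [mem_logWindow hx0 h1]
    obtain ⟨a, b⟩ := hlog n hn
    have := (hmem n hn).1
    refine ⟨?_, by rw [abs_of_pos a]; linarith⟩
    have : (1 : ℝ) ≤ n := by linarith
    exact_mod_cast this
  calc exp (-2) / 8 * h * log x ^ k = (x * h / 4) * (log x ^ k * (exp (-2) / (2 * x))) := by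
        field_simp; ring
    _ ≤ F.card * (log x ^ k * (exp (-2) / (2 * x))) := by gcongr
    _ = ∑ n ∈ F, log x ^ k * (exp (-2) / (2 * x)) := by rw [Finset.sum_const, nsmul_eq_mul]
    _ ≤ ∑ n ∈ F, log n ^ k * (n : ℝ) ^ (-(1 + 1 / log x)) * w ((log n - log x) / h) := by
        refine Finset.sum_le_sum fun n hn => ?_
        obtain ⟨a, b⟩ := hlog n hn
        obtain ⟨a', b'⟩ := hmem n hn
        rw [hw1 _ (by rw [abs_of_pos (by positivity), div_le_iff₀ h0]; linarith), mul_one]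
        have := rpow_neg_one_add_ge hx hx2 (by linarith : (0 : ℝ) < n) (by nlinarith)
        gcongr
    _ ≤ _ := Finset.sum_le_sum_of_subset_of_nonneg hsub fun n _ _ => by
        have := hwn ((log n - log x) / h)
        have := Real.log_natCast_nonneg n
        positivity

lemma smoothed_vonMangoldt_le {w : ℝ → ℝ} (hwn : ∀ t, 0 ≤ w t) (hwo : ∀ t, w t ≤ 1)
    (k : ℕ) {x h : ℝ} (hx : 1 ≤ log x) (hx2 : 2 ≤ x) (h1 : h ≤ 1 / 2) :
    ∑ n ∈ logWindow x h, ArithmeticFunction.vonMangoldt n * log n ^ k *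
        (n : ℝ) ^ (-(1 + 1 / log x)) * w ((log n - log x) / h) ≤
      (2 * log x) ^ k * (2 / x) * ∑ n ∈ logWindow x h, ArithmeticFunction.vonMangoldt n := by
  have hx0 : 0 < x := by linarith
  rw [Finset.mul_sum]
  refine Finset.sum_le_sum fun n hn => ?_
  rw [mem_logWindow hx0 h1] at hn
  have hn1 : (1 : ℝ) ≤ n := by exact_mod_cast hn.1
  obtain ⟨a, b⟩ := le_two_mul_of_log hx0 h1 (by linarith) hn.2
  have hL := ArithmeticFunction.vonMangoldt_nonneg (n := n)
  have hln := Real.log_natCast_nonneg n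
  have e1 : log n ≤ 2 * log x := by
    have := Real.log_le_log (by linarith) a
    rw [Real.log_mul (by norm_num) (by linarith)] at this
    have := Real.log_le_log (by norm_num) hx2
    linarith
  have e2 : (n : ℝ) ^ (-(1 + 1 / log x)) ≤ 2 / x := by
    calc (n : ℝ) ^ (-(1 + 1 / log x)) ≤ (n : ℝ) ^ (-1 : ℝ) := by
          refine Real.rpow_le_rpow_of_exponent_le hn1 ?_
          have : 0 ≤ 1 / log x := by positivity
          linarith
      _ = 1 / n := by rw [Real.rpow_neg_one, one_div]
      _ ≤ 2 / x := by rw [div_le_div_iff₀ (by linarith) hx0]; linarith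
  calc _ ≤ ArithmeticFunction.vonMangoldt n * (2 * log x) ^ k * (2 / x) * 1 := by
        have := hwn ((log n - log x) / h)
        have := hwo ((log n - log x) / h)
        gcongr
    _ = _ := by ring

theorem exists_vonMangoldt_window_ge (A : ℕ) : ∃ c₀ > 0, ∃ x₀ : ℝ, ∀ x, x₀ ≤ x → ∀ h : ℝ,
    0 < h → 1 ≤ h * log x ^ A → h ≤ 1 / 2 →
      c₀ * h * x ≤ ∑ n ∈ logWindow x h, ArithmeticFunction.vonMangoldt n := by
  obtain ⟨w, g, hwn, hwo, hw1, hw0, hg, -, hgi, -, hw⟩ := exists_smooth_cutoff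
  obtain ⟨C, hC, herr⟩ := exists_smoothed_error_bound hw0 hg hgi hw (k := 2 * A + 1) (by omega)
  obtain ⟨X₀, hX₀⟩ := exists_log_pow_le_rpow A (ε := 1 / 2) (by norm_num)
  set c₁ := exp (-2) / 8 with hc₁
  have hc₁0 : 0 < c₁ := by positivity
  refine ⟨c₁ / 2 / (2 ^ (2 * A + 1) * 2), by positivity,
    max (max X₀ 16) (exp (1 + 2 * C / c₁)), fun x hx h h0 hA h1 => ?_⟩
  have hx1 : X₀ ≤ x := le_trans (le_trans (le_max_left _ _) (le_max_left _ _)) hx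
  have hx16 : 16 ≤ x := le_trans (le_trans (le_max_right _ _) (le_max_left _ _)) hx
  have hx0 : 0 < x := by linarith
  have hlogx : 1 + 2 * C / c₁ ≤ log x := by
    rw [Real.le_log_iff_exp_le hx0]; exact le_trans (le_max_right _ _) hx
  have hx2 : 2 ≤ x := by linarith
  have hC1 : 0 < 2 * C / c₁ := by positivity
  have hl1 : 1 ≤ log x := by linarith
  have hl0 : 0 < log x := by linarith
  have hxh : 4 ≤ x * h := by
    have a : log x ^ A ≤ √x := by rw [Real.sqrt_eq_rpow]; exact hX₀ x hx1
    have b : 4 ≤ √x := by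
      rw [show (4 : ℝ) = √16 by rw [show (16 : ℝ) = 4 ^ 2 by norm_num, Real.sqrt_sq (by norm_num)]]
      exact Real.sqrt_le_sqrt hx16
    have c : 1 ≤ h * √x := hA.trans (by gcongr)
    calc (4 : ℝ) ≤ √x * (h * √x) := by nlinarith
      _ = x * h := by rw [mul_left_comm, Real.mul_self_sqrt hx0.le, mul_comm]
  have hm := smoothed_main_term_ge hwn hw1 (2 * A + 1) hl1 hx2 h0 h1 hxh
  have hu := smoothed_vonMangoldt_le hwn hwo (2 * A + 1) hl1 hx2 h1
  have he := (abs_le.1 (herr x h hx0 hl1 h0 h1)).1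
  have hsplit : ∑ n ∈ logWindow x h, diffTerm (2 * A + 1) (1 + 1 / log x) n * w ((log n - log x) / h) =
      (∑ n ∈ logWindow x h, ArithmeticFunction.vonMangoldt n * log n ^ (2 * A + 1) *
        (n : ℝ) ^ (-(1 + 1 / log x)) * w ((log n - log x) / h)) -
      ∑ n ∈ logWindow x h, log n ^ (2 * A + 1) * (n : ℝ) ^ (-(1 + 1 / log x)) *
        w ((log n - log x) / h) := by
    rw [← Finset.sum_sub_distrib]
    exact Finset.sum_congr rfl fun n _ => by unfold diffTerm; ring
  rw [hsplit] at he
  have hCh : C / h ≤ c₁ / 2 * h * log x ^ (2 * A + 1) := by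
    rw [div_le_iff₀ h0]
    have h2 : 1 ≤ (h * log x ^ A) ^ 2 := one_le_pow₀ hA
    have h3 : C ≤ c₁ / 2 * log x := by
      have : 2 * C / c₁ ≤ log x := by linarith
      rw [div_le_iff₀ hc₁0] at this
      linarith
    calc C ≤ c₁ / 2 * log x * 1 := by linarith
      _ ≤ c₁ / 2 * log x * (h * log x ^ A) ^ 2 := by gcongr
      _ = _ := by ring
  set S := ∑ n ∈ logWindow x h, ArithmeticFunction.vonMangoldt n
  have hfin : c₁ / 2 * h * log x ^ (2 * A + 1) ≤ (2 * log x) ^ (2 * A + 1) * (2 / x) * S := by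
    rw [← hc₁] at hm
    have h4 : c₁ * h * log x ^ (2 * A + 1) = 2 * (c₁ / 2 * h * log x ^ (2 * A + 1)) := by ring
    rw [h4] at hm
    linarith
  have hl : 0 < log x ^ (2 * A + 1) := by positivity
  refine le_of_mul_le_mul_right ?_ hl
  rw [mul_pow] at hfin
  calc c₁ / 2 / (2 ^ (2 * A + 1) * 2) * h * x * log x ^ (2 * A + 1)
      = (c₁ / 2 * h * log x ^ (2 * A + 1)) * (x / (2 ^ (2 * A + 1) * 2)) := by
        field_simp
    _ ≤ (2 ^ (2 * A + 1) * log x ^ (2 * A + 1) * (2 / x) * S) * (x / (2 ^ (2 * A + 1) * 2)) := by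
        gcongr
    _ = S * log x ^ (2 * A + 1) := by field_simp

/-- Lower bound of the correct order for the number of primes in short logarithmic windows. -/
theorem exists_primeWeight_window_ge (A : ℕ) : ∃ c₀ > 0, ∃ x₀ : ℝ, ∀ x, x₀ ≤ x → ∀ h : ℝ,
    0 < h → 1 ≤ h * log x ^ A → h ≤ 1 / 2 →
      c₀ * h * x ≤ ∑ n ∈ logWindow x h, primeWeight n := by
  obtain ⟨c₀, hc₀, x₀, H⟩ := exists_vonMangoldt_window_ge A
  obtain ⟨X₀, hX₀⟩ := exists_log_pow_le_rpow (A + 2) (ε := 1 / 2) (by norm_num)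
  refine ⟨c₀ / 2, by positivity, max (max X₀ x₀) (exp (1 + 16 / c₀)), fun x hx h h0 hA h1 => ?_⟩
  have hx1 : X₀ ≤ x := le_trans (le_trans (le_max_left _ _) (le_max_left _ _)) hx
  have hx2 : x₀ ≤ x := le_trans (le_trans (le_max_right _ _) (le_max_left _ _)) hx
  have hx3 : exp (1 + 16 / c₀) ≤ x := le_trans (le_max_right _ _) hx
  have hx0 : 0 < x := (Real.exp_pos _).trans_le hx3
  have hlogx : 1 + 16 / c₀ ≤ log x := by rwa [Real.le_log_iff_exp_le hx0]
  have h16 : 0 < 16 / c₀ := by positivity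
  have h2 : 2 ≤ x := by
    have := Real.add_one_le_exp (1 + 16 / c₀)
    linarith
  have hl0 : 0 < log x := by linarith
  have hs : log x ^ (A + 2) ≤ √x := by rw [Real.sqrt_eq_rpow]; exact hX₀ x hx1
  have ha := H x hx2 h h0 hA h1
  have hb := sum_vonMangoldt_sub_primeWeight_le (h := h) h2
  rw [Finset.sum_sub_distrib] at hb
  have hc : 8 * (√x * log x) ≤ c₀ / 2 * h * x := by
    have e1 : 16 / c₀ ≤ log x := by linarith
    rw [div_le_iff₀ hc₀] at e1
    have e2 : log x ≤ h * √x * (1 / log x) := by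
      rw [mul_one_div, le_div_iff₀ hl0]
      calc log x * log x = 1 * log x ^ 2 := by ring
        _ ≤ h * log x ^ A * log x ^ 2 := by gcongr
        _ = h * log x ^ (A + 2) := by ring
        _ ≤ h * √x := by gcongr
    calc 8 * (√x * log x) ≤ 8 * (√x * (h * √x * (1 / log x))) := by gcongr
      _ = 8 * (h * x * (1 / log x)) := by
          rw [show √x * (h * √x * (1 / log x)) = h * (√x * √x) * (1 / log x) by ring,
            Real.mul_self_sqrt hx0.le]
      _ ≤ (c₀ * log x / 2) * (h * x * (1 / log x)) := by
          gcongr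
          linarith
      _ = c₀ / 2 * h * x := by field_simp
  linarith

/-- The integers in `(X/8, X]`. -/
noncomputable def dyadicRange (X : ℝ) : Finset ℕ := Finset.Ioc ⌊X / 8⌋₊ ⌊X⌋₊

/-- Quadruples of integers in `(X/8, X]`. -/
noncomputable def quads (X : ℝ) : Finset (ℕ × ℕ × ℕ × ℕ) :=
  dyadicRange X ×ˢ dyadicRange X ×ˢ dyadicRange X ×ˢ dyadicRange X

/-- The product of the logarithmic prime weights of a quadruple. -/
noncomputable def quadWeight (q : ℕ × ℕ × ℕ × ℕ) : ℝ :=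
  primeWeight q.1 * (primeWeight q.2.1 * (primeWeight q.2.2.1 * primeWeight q.2.2.2))

/-- The sum of the `c`-th powers of a quadruple. -/
noncomputable def powSum (c : ℝ) (q : ℕ × ℕ × ℕ × ℕ) : ℝ :=
  (q.1 : ℝ) ^ c + ((q.2.1 : ℝ) ^ c + ((q.2.2.1 : ℝ) ^ c + (q.2.2.2 : ℝ) ^ c))

lemma quadWeight_nonneg (q : ℕ × ℕ × ℕ × ℕ) : 0 ≤ quadWeight q := by
  unfold quadWeight
  have := primeWeight_nonneg
  exact mul_nonneg (this _) (mul_nonneg (this _) (mul_nonneg (this _) (this _)))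

/-- The smoothed weighted count of prime quadruples with `∑ pᵢ^c` within `δ` of `R`. -/
noncomputable def smoothCount (w : ℝ → ℝ) (c X R δ : ℝ) : ℝ :=
  ∑ q ∈ quads X, quadWeight q * w ((powSum c q - R) / δ)

lemma primeSum_pow_four (c X x : ℝ) :
    primeSum c X x ^ 4 = ∑ q ∈ quads X, (quadWeight q : ℂ) * expi (x * powSum c q) := by
  have h : primeSum c X x = ∑ n ∈ dyadicRange X, (primeWeight n : ℂ) * expi (x * (n : ℝ) ^ c) := rfl
  rw [show primeSum c X x ^ 4 = primeSum c X x * (primeSum c X x * (primeSum c X x * primeSum c X x))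
    by ring, h, Finset.sum_mul_sum, ← Finset.sum_product', Finset.sum_mul_sum, ← Finset.sum_product',
    Finset.sum_mul_sum, ← Finset.sum_product']
  refine Finset.sum_congr rfl fun q _ => ?_
  simp only [quadWeight, powSum, mul_add, expi_add]
  push_cast
  ring

lemma smoothCount_div_eq_integral {w : ℝ → ℝ} {g : ℝ → ℂ} (hg : Continuous g)
    (hgi : Integrable fun x => ‖g x‖) (hw : ∀ t, (w t : ℂ) = ∫ x, g x * expi (x * t))
    (c X R : ℝ) {δ : ℝ} (hδ : 0 < δ) :
    ((smoothCount w c X R δ / δ : ℝ) : ℂ) =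
      ∫ x, g (δ * x) * (primeSum c X x ^ 4 * expi (-(x * R))) := by
  have hgi' : Integrable g := (integrable_norm_iff hg.aestronglyMeasurable).1 hgi
  have hgδ : Integrable fun x => g (δ * x) := hgi'.comp_mul_left' hδ.ne'
  have hone : ∀ u : ℝ, Integrable fun x => g (δ * x) * expi (x * u) := fun u => by
    have hc : Continuous fun x : ℝ => expi (x * u) :=
      continuous_expi.comp (continuous_id.mul continuous_const)
    refine hgδ.mul_bdd (c := 1) hc.aestronglyMeasurable ?_
    exact Filter.Eventually.of_forall fun x => (norm_expi _).le
  have hval : ∀ u : ℝ, ∫ x, g (δ * x) * expi (x * u) = ((w (u / δ) / δ : ℝ) : ℂ) := fun u => by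
    have h := Measure.integral_comp_mul_left (fun y => g y * expi (y * (u / δ))) δ
    rw [← hw, abs_of_pos (inv_pos.2 hδ)] at h
    have e : ∀ x : ℝ, δ * x * (u / δ) = x * u := fun x => by field_simp
    simp_rw [e] at h
    rw [h, Complex.real_smul]
    push_cast
    ring
  have hexp : ∀ x : ℝ, g (δ * x) * (primeSum c X x ^ 4 * expi (-(x * R))) =
      ∑ q ∈ quads X, (quadWeight q : ℂ) * (g (δ * x) * expi (x * (powSum c q - R))) := fun x => by
    rw [primeSum_pow_four, Finset.sum_mul, Finset.mul_sum]
    refine Finset.sum_congr rfl fun q _ => ?_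
    rw [show x * (powSum c q - R) = x * powSum c q + -(x * R) by ring, expi_add]
    ring
  simp_rw [hexp]
  rw [integral_finsetSum _ fun q _ => (hone _).const_mul _]
  simp_rw [integral_const_mul, hval]
  rw [smoothCount, Finset.sum_div]
  push_cast
  exact Finset.sum_congr rfl fun q _ => by ring

lemma norm_integral_Ioi_le {f : ℝ → ℂ} {s : ℝ → ℝ} {a H c₁ c₃ : ℝ} (hf : Integrable f)
    (hs : Continuous s) (ha : 0 ≤ a) (haH : a ≤ H) (hH : 0 < H)
    (h₁ : ∀ x, 0 < x → x ≤ a → ‖f x‖ ≤ c₁) (h₂ : ∀ x, a < x → x ≤ H → ‖f x‖ ≤ s x)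
    (h₃ : ∀ x, H < x → ‖f x‖ ≤ c₃ * x ^ (-2 : ℝ)) :
    ‖∫ x in Set.Ioi 0, f x‖ ≤ c₁ * a + (∫ x in a..H, s x) + c₃ / H := by
  have e1 := intervalIntegral.integral_interval_add_Ioi (a := 0) (b := a) (f := f) (μ := volume)
    hf.integrableOn hf.integrableOn
  have e2 := intervalIntegral.integral_interval_add_Ioi (a := a) (b := H) (f := f) (μ := volume)
    hf.integrableOn hf.integrableOn
  have b1 : ‖∫ x in (0 : ℝ)..a, f x‖ ≤ c₁ * |a - 0| :=
    intervalIntegral.norm_integral_le_of_norm_le_const fun x hx => by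
      rw [Set.uIoc_of_le ha] at hx
      exact h₁ x hx.1 hx.2
  have b2 : ‖∫ x in a..H, f x‖ ≤ ∫ x in a..H, s x :=
    intervalIntegral.norm_integral_le_of_norm_le haH
      (Filter.Eventually.of_forall fun x hx => h₂ x hx.1 hx.2) (hs.intervalIntegrable _ _)
  have b3 : ‖∫ x in Set.Ioi H, f x‖ ≤ ∫ x in Set.Ioi H, c₃ * x ^ (-2 : ℝ) := by
    refine norm_integral_le_of_norm_le
      ((integrableOn_Ioi_rpow_of_lt (by norm_num) hH).const_mul _) ?_
    exact (ae_restrict_mem measurableSet_Ioi).mono fun x hx => h₃ x hx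
  rw [integral_const_mul, integral_Ioi_rpow_of_lt (by norm_num) hH] at b3
  rw [sub_zero, abs_of_nonneg ha] at b1
  have e3 : c₃ * (-H ^ ((-2 : ℝ) + 1) / (-2 + 1)) = c₃ / H := by
    rw [show (-2 : ℝ) + 1 = -1 by norm_num, Real.rpow_neg_one]
    ring
  rw [e3] at b3
  rw [← e1, ← e2]
  refine (norm_add_le _ _).trans ?_
  have := norm_add_le (∫ x in a..H, f x) (∫ x in Set.Ioi H, f x)
  linarith

lemma norm_integral_le_of_three_ranges {f : ℝ → ℂ} {s : ℝ → ℝ} {a H c₁ c₃ : ℝ} (hf : Integrable f)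
    (hs : Continuous s) (ha : 0 ≤ a) (haH : a ≤ H) (hH : 0 < H)
    (h₁ : ∀ x, |x| ≤ a → ‖f x‖ ≤ c₁) (h₂ : ∀ x, a < |x| → |x| ≤ H → ‖f x‖ ≤ s |x|)
    (h₃ : ∀ x, H < |x| → ‖f x‖ ≤ c₃ * |x| ^ (-2 : ℝ)) :
    ‖∫ x, f x‖ ≤ 2 * (c₁ * a + (∫ x in a..H, s x) + c₃ / H) := by
  have hsplit : ∫ x, f x = (∫ x in Set.Ioi 0, f (-x)) + ∫ x in Set.Ioi 0, f x := by
    have h := integral_comp_neg_Ioi (0 : ℝ) f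
    rw [neg_zero] at h
    rw [h]
    exact (intervalIntegral.integral_Iic_add_Ioi hf.integrableOn hf.integrableOn).symm
  rw [hsplit]
  refine (norm_add_le _ _).trans ?_
  have p := norm_integral_Ioi_le hf hs ha haH hH
    (fun x h0 h => h₁ x (by rwa [abs_of_pos h0]))
    (fun x h h' => by
      have h0 : 0 < x := by linarith
      have := h₂ x (by rwa [abs_of_pos h0]) (by rwa [abs_of_pos h0])
      rwa [abs_of_pos h0] at this)
    (fun x h => by
      have h0 : 0 < x := by linarith
      have := h₃ x (by rwa [abs_of_pos h0])
      rwa [abs_of_pos h0] at this)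
  have m := norm_integral_Ioi_le hf.comp_neg hs ha haH hH
    (fun x h0 h => h₁ (-x) (by rwa [abs_neg, abs_of_pos h0]))
    (fun x h h' => by
      have h0 : 0 < x := by linarith
      have := h₂ (-x) (by rwa [abs_neg, abs_of_pos h0]) (by rwa [abs_neg, abs_of_pos h0])
      rwa [abs_neg, abs_of_pos h0] at this)
    (fun x h => by
      have h0 : 0 < x := by linarith
      have := h₃ (-x) (by rwa [abs_neg, abs_of_pos h0])
      rwa [abs_neg, abs_of_pos h0] at this)
  linarith

lemma norm_primeSum_le {X : ℝ} (hX : 1 ≤ X) (c x : ℝ) : ‖primeSum c X x‖ ≤ X * log X := by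
  unfold primeSum
  refine (norm_sum_le _ _).trans ?_
  calc _ ≤ ∑ n ∈ Finset.Ioc ⌊X / 8⌋₊ ⌊X⌋₊, log X := Finset.sum_le_sum fun n hn => by
        rw [norm_mul, norm_expi, mul_one, Complex.norm_real, Real.norm_eq_abs,
          abs_of_nonneg (primeWeight_nonneg n)]
        exact primeWeight_le_of_mem hX hn
    _ = ((Finset.Ioc ⌊X / 8⌋₊ ⌊X⌋₊).card : ℝ) * log X := by rw [Finset.sum_const, nsmul_eq_mul]
    _ ≤ X * log X := mul_le_mul_of_nonneg_right (card_dyadic_range_le (by linarith))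
        (Real.log_nonneg hX)

lemma norm_le_of_decay {g : ℝ → ℂ} {C : ℝ} {K : ℕ} (h : ∀ x, |x| ^ (K + 2) * ‖g x‖ ≤ C)
    {u v z : ℝ} (hu : 0 < u) (huz : u ≤ |z|) (hv : 0 < v) (hvz : v ≤ z ^ 2) :
    ‖g z‖ ≤ C / (u ^ K * v) := by
  have hz := h z
  rw [le_div_iff₀ (by positivity)]
  calc ‖g z‖ * (u ^ K * v) ≤ ‖g z‖ * (|z| ^ K * |z| ^ 2) := by
        rw [← sq_abs] at hvz
        gcongr
    _ = |z| ^ (K + 2) * ‖g z‖ := by ring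
    _ ≤ C := hz

theorem exists_smoothCount_comparison {c : ℝ} (hc1 : 1 < c) (hc2 : c < 39 / 29) {w : ℝ → ℝ}
    {g : ℝ → ℂ} (hg : Continuous g) (hgi : Integrable fun x => ‖g x‖)
    (hgd : ∀ k : ℕ, ∃ C > 0, ∀ x, |x| ^ k * ‖g x‖ ≤ C)
    (hgL : ∃ L > 0, ∀ x y, ‖g x - g y‖ ≤ L * |x - y|)
    (hw : ∀ t, (w t : ℂ) = ∫ x, g x * expi (x * t)) :
    ∃ C > 0, ∃ X₀ : ℝ, ∀ X, X₀ ≤ X → ∀ R δ : ℝ, X ^ (-(1 / 2000) : ℝ) ≤ δ → δ ≤ 1 →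
      |smoothCount w c X R δ / δ -
        smoothCount w c X R (X ^ c / log X ^ 53) / (X ^ c / log X ^ 53)| ≤
        C * (X ^ (4 - c) / log X) := by
  obtain ⟨K, hK⟩ : ∃ K : ℕ, (K : ℝ) = 20000 := ⟨20000, by norm_num⟩
  obtain ⟨D, hD, hgK⟩ := hgd (K + 2)
  obtain ⟨G, hG, hg0⟩ := hgd 0
  obtain ⟨L, hL, hgL⟩ := hgL
  simp only [pow_zero, one_mul] at hg0
  obtain ⟨Cm, hCm, X₁, hminor⟩ := exists_minor_arc_bound hc1 hc2
  obtain ⟨X₂, hX₂⟩ := exists_log_pow_le_rpow 53 one_pos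
  refine ⟨2 * (L + 2 * G * Cm + 2 * D), by positivity, max (max X₁ X₂) 8, fun X hX R δ hδ hδ1 => ?_⟩
  have hX1 : X₁ ≤ X := le_trans (le_trans (le_max_left _ _) (le_max_left _ _)) hX
  have hX2 : X₂ ≤ X := le_trans (le_trans (le_max_right _ _) (le_max_left _ _)) hX
  have hX8 : 8 ≤ X := le_trans (le_max_right _ _) hX
  have hX0 : 0 < X := by linarith
  have hXo : 1 ≤ X := by linarith
  have hl1 : 1 ≤ log X := one_le_log_of_eight_le hX8
  have hl0 : 0 < log X := by linarith
  have hlog53 : log X ^ 53 ≤ X := by simpa using hX₂ X hX2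
  have hlogk : ∀ k ≤ 53, log X ^ k ≤ X := fun k hk => (pow_le_pow_right₀ hl1 hk).trans hlog53
  have hXc : X ≤ X ^ c := by
    simpa using Real.rpow_le_rpow_of_exponent_le hXo hc1.le
  set δ' := X ^ c / log X ^ 53 with hδ'
  have hδ'1 : 1 ≤ δ' := by rw [hδ', one_le_div (by positivity)]; linarith
  have hδ0 : 0 < δ := lt_of_lt_of_le (by positivity) hδ
  have hδ'0 : 0 < δ' := by linarith
  set a := X ^ (-c) * log X ^ 24 with ha
  set H := X ^ (1 / 1000 : ℝ) with hH
  have ha0 : 0 ≤ a := by positivity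
  have hH1 : 1 ≤ H := Real.one_le_rpow hXo (by norm_num)
  have haH : a ≤ H := by
    refine le_trans ?_ hH1
    rw [ha, Real.rpow_neg hX0.le, inv_mul_eq_div, div_le_one (by positivity)]
    exact (hlogk 24 (by norm_num)).trans hXc
  set f : ℝ → ℂ := fun x => (g (δ * x) - g (δ' * x)) * (primeSum c X x ^ 4 * expi (-(x * R))) with hf
  have hPb : ∀ x, ‖primeSum c X x ^ 4 * expi (-(x * R))‖ = ‖primeSum c X x‖ ^ 4 := fun x => by
    rw [norm_mul, norm_expi, mul_one, norm_pow]
  have hfn : ∀ x, ‖f x‖ = ‖g (δ * x) - g (δ' * x)‖ * ‖primeSum c X x‖ ^ 4 := fun x => by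
    rw [hf]
    simp only [norm_mul (g (δ * x) - g (δ' * x)), hPb]
  have hM : ∀ x, ‖primeSum c X x‖ ^ 4 ≤ (X * log X) ^ 4 := fun x =>
    pow_le_pow_left₀ (norm_nonneg _) (norm_primeSum_le hXo c x) 4
  have hInt : ∀ d : ℝ, 0 < d →
      Integrable fun x => g (d * x) * (primeSum c X x ^ 4 * expi (-(x * R))) := fun d hd => by
    have hgi' : Integrable g := (integrable_norm_iff hg.aestronglyMeasurable).1 hgi
    refine (hgi'.comp_mul_left' hd.ne').mul_bdd (c := (X * log X) ^ 4) ?_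
      (Filter.Eventually.of_forall fun x => by rw [hPb]; exact hM x)
    exact (((continuous_primeSum c X).pow 4).mul (continuous_expi.comp
      (continuous_id.mul continuous_const).neg)).aestronglyMeasurable
  have hfint : Integrable f := by
    refine ((hInt δ hδ0).sub (hInt δ' hδ'0)).congr (Filter.Eventually.of_forall fun x => ?_)
    simp only [hf, Pi.sub_apply, sub_mul]
  have hdiff : ((smoothCount w c X R δ / δ - smoothCount w c X R δ' / δ' : ℝ) : ℂ) = ∫ x, f x := by
    rw [Complex.ofReal_sub, smoothCount_div_eq_integral hg hgi hw c X R hδ0,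
      smoothCount_div_eq_integral hg hgi hw c X R hδ'0, ← integral_sub (hInt δ hδ0) (hInt δ' hδ'0)]
    exact integral_congr_ae (Filter.Eventually.of_forall fun x => by simp only [hf, sub_mul])
  have hkey := norm_integral_le_of_three_ranges hfint
    (s := fun t => 2 * G * ‖primeSum c X t‖ ^ 4) (a := a) (H := H)
    (c₁ := L * (δ' * a) * (X * log X) ^ 4) (c₃ := 2 * D / X ^ 9 * (X * log X) ^ 4)
    (continuous_const.mul ((continuous_primeSum c X).norm.pow 4)) ha0 haH (by linarith)
    (fun x hx => by
      rw [hfn]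
      refine mul_le_mul ?_ (hM x) (by positivity) (by positivity)
      refine (hgL _ _).trans (mul_le_mul_of_nonneg_left ?_ hL.le)
      rw [← sub_mul, abs_mul]
      refine mul_le_mul ?_ hx (abs_nonneg _) hδ'0.le
      rw [abs_le]
      constructor <;> linarith)
    (fun x _ _ => by
      rw [hfn]
      have hSabs : ‖primeSum c X |x|‖ = ‖primeSum c X x‖ := by
        rcases abs_choice x with h | h
        · rw [h]
        · rw [h, primeSum_neg, RCLike.norm_conj]
      simp only [hSabs]
      refine mul_le_mul_of_nonneg_right ?_ (by positivity)
      refine (norm_sub_le _ _).trans ?_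
      linarith [hg0 (δ * x), hg0 (δ' * x)])
    (fun x hx => by
      rw [hfn]
      have hx0 : 0 < |x| := by linarith
      have hu : X ^ (1 / 2000 : ℝ) ≤ δ * |x| := by
        calc X ^ (1 / 2000 : ℝ) = X ^ (-(1 / 2000) : ℝ) * X ^ (1 / 1000 : ℝ) := by
              rw [← Real.rpow_add hX0]; norm_num
          _ ≤ δ * |x| := by gcongr
      have hδsq : X⁻¹ ≤ δ ^ 2 := by
        calc X⁻¹ = X ^ (-1 : ℝ) := (Real.rpow_neg_one X).symm
          _ ≤ X ^ (-(1 / 1000) : ℝ) := Real.rpow_le_rpow_of_exponent_le hXo (by norm_num)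
          _ = (X ^ (-(1 / 2000) : ℝ)) ^ 2 := by
              rw [← Real.rpow_natCast, ← Real.rpow_mul hX0.le]; norm_num
          _ ≤ δ ^ 2 := by gcongr
      have hXK : (X ^ (1 / 2000 : ℝ)) ^ K = X ^ 10 := by
        rw [← Real.rpow_natCast, ← Real.rpow_mul hX0.le, hK, ← Real.rpow_natCast]; norm_num
      have hdec : ∀ d : ℝ, δ ≤ d → ‖g (d * x)‖ ≤ D / X ^ 9 * |x| ^ (-2 : ℝ) := fun d hd => by
        have hd0 : 0 < d := by linarith
        have := norm_le_of_decay hgK (u := X ^ (1 / 2000 : ℝ)) (v := X⁻¹ * x ^ 2) (z := d * x)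
          (by positivity) (by
            rw [abs_mul, abs_of_pos hd0]
            exact hu.trans (by gcongr)) (by
            rw [← sq_abs]; positivity) (by
            rw [mul_pow]
            exact mul_le_mul_of_nonneg_right (hδsq.trans (by gcongr)) (sq_nonneg x))
        refine this.trans (le_of_eq ?_)
        rw [hXK, Real.rpow_neg hx0.le, show (2 : ℝ) = ((2 : ℕ) : ℝ) by norm_num, Real.rpow_natCast,
          sq_abs]
        have hx2 : x ≠ 0 := abs_pos.1 hx0
        field_simp
      calc _ ≤ (D / X ^ 9 * |x| ^ (-2 : ℝ) + D / X ^ 9 * |x| ^ (-2 : ℝ)) * (X * log X) ^ 4 := by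
            refine mul_le_mul ?_ (hM x) (by positivity) (by positivity)
            exact (norm_sub_le _ _).trans (add_le_add (hdec δ le_rfl) (hdec δ' (by linarith)))
        _ = _ := by ring)
  rw [← hdiff, Complex.norm_real, Real.norm_eq_abs, intervalIntegral.integral_const_mul] at hkey
  refine hkey.trans ?_
  have hm := hminor X hX1
  have hXsplit : X ^ (4 - c) = X ^ 4 * X ^ (-c) := by
    rw [sub_eq_add_neg, Real.rpow_add hX0]
    norm_cast
  have hcc : X ^ c * X ^ (-c) = 1 := by rw [← Real.rpow_add hX0]; simp
  have t1 : L * (δ' * a) * (X * log X) ^ 4 * a = L * (X ^ (4 - c) / log X) := by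
    rw [hXsplit, hδ', ha]
    have e : L * (X ^ c / log X ^ 53 * (X ^ (-c) * log X ^ 24)) * (X * log X) ^ 4 *
        (X ^ (-c) * log X ^ 24) =
        (X ^ c * X ^ (-c)) * (L * (X ^ 4 * X ^ (-c) * (log X ^ 52 / log X ^ 53))) := by ring
    rw [e, hcc, one_mul]
    have : log X ^ 52 / log X ^ 53 = 1 / log X := by field_simp
    rw [this]
    ring
  have t3 : 2 * D / X ^ 9 * (X * log X) ^ 4 / H ≤ 2 * D * (X ^ (4 - c) / log X) := by
    have h1 : (1 : ℝ) ≤ X ^ (4 - c) := Real.one_le_rpow hXo (by linarith)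
    calc 2 * D / X ^ 9 * (X * log X) ^ 4 / H ≤ 2 * D / X ^ 9 * (X * log X) ^ 4 :=
          div_le_self (by positivity) hH1
      _ = 2 * D * (log X ^ 4 / X ^ 5) := by field_simp
      _ ≤ 2 * D * (X ^ (4 - c) / log X) := by
          refine mul_le_mul_of_nonneg_left ?_ (by positivity)
          rw [div_le_div_iff₀ (by positivity) hl0]
          calc log X ^ 4 * log X = log X ^ 5 := by ring
            _ ≤ X := hlogk 5 (by norm_num)
            _ ≤ 1 * X ^ 5 := by rw [one_mul]; exact le_self_pow₀ hXo (by norm_num)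
            _ ≤ X ^ (4 - c) * X ^ 5 := by gcongr
  have t2 : 2 * G * ∫ x in a..H, ‖primeSum c X x‖ ^ 4 ≤ 2 * G * (Cm * (X ^ (4 - c) / log X)) := by
    gcongr
  calc _ ≤ 2 * (L * (X ^ (4 - c) / log X) + 2 * G * (Cm * (X ^ (4 - c) / log X)) +
        2 * D * (X ^ (4 - c) / log X)) := by
        rw [t1]
        gcongr
    _ = _ := by ring

lemma rpow_window_bounds {c y n h u : ℝ} (hy : 0 < y) (hn : 0 < n) (hc : 0 < c)
    (hl : |log n - log y| < h) (hu : c * h ≤ u) (hu1 : u < 1) :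
    (1 - u) * y ^ c ≤ n ^ c ∧ n ^ c ≤ y ^ c / (1 - u) := by
  obtain ⟨h1, h2⟩ := abs_lt.1 hl
  have hyc : 0 < y ^ c := by positivity
  have e : n ^ c = y ^ c * exp (c * (log n - log y)) := by
    rw [Real.rpow_def_of_pos hn, Real.rpow_def_of_pos hy, ← Real.exp_add]
    ring_nf
  have hθ1 : -u ≤ c * (log n - log y) := by nlinarith
  have hθ2 : c * (log n - log y) ≤ u := by nlinarith
  have a := Real.add_one_le_exp (c * (log n - log y))
  have b : exp (c * (log n - log y)) ≤ 1 / (1 - u) := by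
    have b1 := Real.add_one_le_exp (-u)
    have b2 := Real.exp_le_exp.2 hθ2
    rw [le_div_iff₀ (by linarith)]
    calc exp (c * (log n - log y)) * (1 - u) ≤ exp u * exp (-u) :=
          mul_le_mul b2 (by linarith) (by linarith) (Real.exp_pos _).le
      _ = 1 := by rw [← Real.exp_add]; simp
  rw [e]
  constructor
  · rw [mul_comm]
    exact mul_le_mul_of_nonneg_left (by linarith) hyc.le
  · rw [div_eq_mul_one_div]
    exact mul_le_mul_of_nonneg_left b hyc.le

lemma abs_rpow_sub_le {c y n h : ℝ} (hy : 0 < y) (hn : 0 < n) (hc : 0 < c) (hc2 : c < 3 / 2)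
    (hl : |log n - log y| < h) (hh : h ≤ 1 / 100) : |n ^ c - y ^ c| ≤ 4 * y ^ c * h := by
  have hh0 : 0 < h := (abs_nonneg _).trans_lt hl
  have hyc : 0 < y ^ c := by positivity
  have hyh : 0 < y ^ c * h := by positivity
  obtain ⟨a, b⟩ := rpow_window_bounds hy hn hc hl (u := 2 * h)
    (mul_le_mul_of_nonneg_right (by linarith) hh0.le) (by linarith)
  refine abs_le.2 ⟨by linarith, ?_⟩
  rw [le_div_iff₀ (by linarith)] at b
  have : n ^ c ≤ y ^ c * (1 + 4 * h) := by
    refine le_of_mul_le_mul_right (b.trans ?_) (show 0 < 1 - 2 * h by linarith)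
    have : 0 ≤ y ^ c * h * (2 * (1 - 4 * h)) := mul_nonneg hyh.le (by linarith)
    linarith
  linarith

lemma mem_Ioc_of_rpow_mem {c X u : ℝ} (hc : 1 ≤ c) (hX : 0 < X) (hu : 0 < u)
    (h1 : X ^ c / 8 < u ^ c) (h2 : u ^ c ≤ X ^ c) : X / 8 < u ∧ u ≤ X := by
  have hc0 : 0 < c := by linarith
  refine ⟨?_, (Real.rpow_le_rpow_iff hu.le hX.le hc0).1 h2⟩
  by_contra hcon
  have h3 := Real.rpow_le_rpow hu.le (not_lt.1 hcon) hc0.le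
  rw [Real.div_rpow hX.le (by norm_num)] at h3
  have h4 : (8 : ℝ) ≤ 8 ^ c := by
    simpa using Real.rpow_le_rpow_of_exponent_le (show (1 : ℝ) ≤ 8 by norm_num) hc
  have h5 : X ^ c / 8 ^ c ≤ X ^ c / 8 := by gcongr
  linarith

lemma mul_le_sum_mul_of_subset {W I : Finset ℕ} (hWI : W ⊆ I) {f F : ℕ → ℝ} (hf : ∀ n, 0 ≤ f n)
    (hF : ∀ n, 0 ≤ F n) {V P : ℝ} (hV0 : 0 ≤ V) (hV : ∀ n ∈ W, V ≤ F n) (hP : P ≤ ∑ n ∈ W, f n) :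
    P * V ≤ ∑ n ∈ I, f n * F n :=
  calc P * V ≤ (∑ n ∈ W, f n) * V := by gcongr
    _ = ∑ n ∈ W, f n * V := Finset.sum_mul _ _ _
    _ ≤ ∑ n ∈ W, f n * F n :=
        Finset.sum_le_sum fun n hn => mul_le_mul_of_nonneg_left (hV n hn) (hf n)
    _ ≤ _ := Finset.sum_le_sum_of_subset_of_nonneg hWI fun n _ _ => mul_nonneg (hf n) (hF n)

lemma smoothCount_eq_iterated (w : ℝ → ℝ) (c X R δ : ℝ) :
    smoothCount w c X R δ = ∑ n₁ ∈ dyadicRange X, primeWeight n₁ * ∑ n₂ ∈ dyadicRange X,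
      primeWeight n₂ * ∑ n₃ ∈ dyadicRange X, primeWeight n₃ * ∑ n₄ ∈ dyadicRange X,
        primeWeight n₄ * w ((powSum c (n₁, n₂, n₃, n₄) - R) / δ) := by
  simp only [smoothCount, quads, Finset.sum_product, Finset.mul_sum, quadWeight, mul_assoc]

theorem exists_smoothCount_ge {c : ℝ} (hc1 : 1 < c) (hc2 : c < 3 / 2) {w : ℝ → ℝ}
    (hwn : ∀ t, 0 ≤ w t) (hw1 : ∀ t, |t| ≤ 1 / 2 → w t = 1) :
    ∃ c₂ > 0, ∃ X₀ : ℝ, ∀ X, X₀ ≤ X →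
      c₂ * (X ^ 4 / log X ^ 53) ≤ smoothCount w c X (X ^ c) (X ^ c / log X ^ 53) := by
  obtain ⟨k₁, hk₁, x₁, hP1⟩ := exists_primeWeight_window_ge 1
  obtain ⟨k₂, hk₂, x₂, hP2⟩ := exists_primeWeight_window_ge 54
  obtain ⟨Q, hQ⟩ : ∃ Q : ℝ, Q = 8 * 2 ^ 54 := ⟨_, rfl⟩
  have hQ0 : 40 ≤ Q := by rw [hQ]; norm_num
  refine ⟨(k₁ / 160) ^ 3 * (k₂ / 64), by positivity,
    max (max (8 * x₁) (8 * x₂)) (exp Q), fun X hX => ?_⟩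
  have hX1 : 8 * x₁ ≤ X := le_trans (le_trans (le_max_left _ _) (le_max_left _ _)) hX
  have hX2 : 8 * x₂ ≤ X := le_trans (le_trans (le_max_right _ _) (le_max_left _ _)) hX
  have hX3 : exp Q ≤ X := le_trans (le_max_right _ _) hX
  have hX0 : 0 < X := (Real.exp_pos _).trans_le hX3
  have hlQ : Q ≤ log X := by rwa [Real.le_log_iff_exp_le hX0]
  have hl0 : 0 < log X := by linarith
  have hc0 : 0 < c := by linarith
  have hlog8 : log 8 ≤ 7 := by
    have := Real.log_le_sub_one_of_pos (show (0 : ℝ) < 8 by norm_num)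
    linarith
  have hlogy : ∀ y, X / 8 < y → log X / 2 ≤ log y := fun y hy => by
    have h := Real.log_le_log (by positivity) hy.le
    rw [Real.log_div hX0.ne' (by norm_num)] at h
    linarith
  set R := X ^ c with hR
  have hR0 : 0 < R := by positivity
  have hroot : ∀ t : ℝ, 0 < t → (t ^ (1 / c)) ^ c = t := fun t ht => by
    rw [← Real.rpow_mul ht.le, one_div_mul_cancel hc0.ne', Real.rpow_one]
  set y₀ := (R / 4) ^ (1 / c) with hy₀
  have hy₀0 : 0 < y₀ := by positivity
  have hy₀c : y₀ ^ c = R / 4 := hroot _ (by positivity)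
  have hy₀X := mem_Ioc_of_rpow_mem hc1.le hX0 hy₀0 (by rw [hy₀c]; linarith) (by rw [hy₀c]; linarith)
  set W := logWindow y₀ (1 / 20) with hW
  have hWb : ∀ n ∈ W, (0 : ℝ) < n ∧ 0.231 * R ≤ (n : ℝ) ^ c ∧ (n : ℝ) ^ c ≤ 0.2703 * R := by
    intro n hn
    rw [hW, mem_logWindow hy₀0 (by norm_num)] at hn
    have hn0 : (0 : ℝ) < n := by exact_mod_cast hn.1
    obtain ⟨a, b⟩ := rpow_window_bounds hy₀0 hn0 hc0 hn.2 (u := 0.075) (by linarith) (by norm_num)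
    rw [hy₀c] at a b
    refine ⟨hn0, by linarith, b.trans ?_⟩
    rw [div_le_iff₀ (by norm_num)]
    linarith
  have hmemI : ∀ n : ℕ, (0 : ℝ) < n → R / 8 < (n : ℝ) ^ c → (n : ℝ) ^ c ≤ R → n ∈ dyadicRange X :=
    fun n h0 h1 h2 => (mem_dyadic_range hX0.le).2 (mem_Ioc_of_rpow_mem hc1.le hX0 h0 h1 h2)
  have hWI : W ⊆ dyadicRange X := fun n hn => by
    obtain ⟨a, b, d⟩ := hWb n hn
    exact hmemI n a (by linarith) (by linarith)
  have hWsum : k₁ / 160 * X ≤ ∑ n ∈ W, primeWeight n := by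
    have h := hP1 y₀ (by linarith) (1 / 20) (by norm_num)
      (by rw [pow_one]; linarith [hlogy y₀ hy₀X.1]) (by norm_num)
    refine le_trans ?_ h
    have := hy₀X.1
    calc k₁ / 160 * X = k₁ * (1 / 20) * (X / 8) := by ring
      _ ≤ _ := by gcongr
  set h := 1 / (8 * log X ^ 53) with hh
  have hh0 : 0 < h := by positivity
  have hlog1 : 1 ≤ log X := by linarith
  have hhsmall : h ≤ 1 / 100 := by
    rw [hh]
    refine one_div_le_one_div_of_le (by norm_num) ?_
    have : log X ≤ log X ^ 53 := le_self_pow₀ hlog1 (by norm_num)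
    linarith
  have hinner : ∀ n₁ ∈ W, ∀ n₂ ∈ W, ∀ n₃ ∈ W, k₂ / 64 * (X / log X ^ 53) * 1 ≤
      ∑ n₄ ∈ dyadicRange X,
        primeWeight n₄ * w ((powSum c (n₁, n₂, n₃, n₄) - R) / (R / log X ^ 53)) := by
    intro n₁ hn₁ n₂ hn₂ n₃ hn₃
    obtain ⟨-, a₁, b₁⟩ := hWb n₁ hn₁
    obtain ⟨-, a₂, b₂⟩ := hWb n₂ hn₂
    obtain ⟨-, a₃, b₃⟩ := hWb n₃ hn₃
    set t := R - ((n₁ : ℝ) ^ c + (n₂ : ℝ) ^ c + (n₃ : ℝ) ^ c) with ht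
    have ht1 : 0.189 * R ≤ t := by linarith
    have ht2 : t ≤ 0.308 * R := by linarith
    have ht0 : 0 < t := by linarith
    set y := t ^ (1 / c) with hy
    have hy0 : 0 < y := by positivity
    have hyc : y ^ c = t := hroot _ ht0
    have hyX := mem_Ioc_of_rpow_mem hc1.le hX0 hy0 (by rw [hyc]; linarith) (by rw [hyc]; linarith)
    have hnear : ∀ n ∈ logWindow y h, (0 : ℝ) < n ∧ |(n : ℝ) ^ c - t| ≤ 4 * R * h := by
      intro n hn
      rw [mem_logWindow hy0 (by linarith)] at hn
      have hn0 : (0 : ℝ) < n := by exact_mod_cast hn.1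
      have := abs_rpow_sub_le hy0 hn0 hc0 hc2 hn.2 hhsmall
      rw [hyc] at this
      refine ⟨hn0, this.trans ?_⟩
      have htR : t ≤ R := by linarith
      gcongr
    refine mul_le_sum_mul_of_subset (W := logWindow y h) ?_ primeWeight_nonneg (fun n => hwn _)
      zero_le_one ?_ ?_
    · intro n hn
      obtain ⟨hn0, hn1⟩ := hnear n hn
      obtain ⟨p, q⟩ := abs_le.1 hn1
      have : 4 * R * h ≤ 4 * R * (1 / 100) := by gcongr
      exact hmemI n hn0 (by linarith) (by linarith)
    · intro n hn
      obtain ⟨hn0, hn1⟩ := hnear n hn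
      refine (hw1 _ ?_).ge
      have e : powSum c (n₁, n₂, n₃, n) - R = (n : ℝ) ^ c - t := by
        simp only [powSum, ht]; ring
      rw [e, abs_div, abs_of_pos (by positivity : 0 < R / log X ^ 53), div_le_iff₀ (by positivity)]
      refine hn1.trans (le_of_eq ?_)
      rw [hh]
      field_simp
      norm_num
    · have hA : 1 ≤ h * log y ^ 54 := by
        calc (1 : ℝ) ≤ log X / Q := by rw [one_le_div (by linarith)]; exact hlQ
          _ = h * (log X / 2) ^ 54 := by
              rw [hh, hQ, div_pow]; field_simp
          _ ≤ h * log y ^ 54 := by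
              have := hlogy y hyX.1
              gcongr
      refine le_trans ?_ (hP2 y (by linarith) h hh0 hA (by linarith))
      calc k₂ / 64 * (X / log X ^ 53) = k₂ * h * (X / 8) := by rw [hh]; field_simp; norm_num
        _ ≤ k₂ * h * y := by
            have := hyX.1
            gcongr
  rw [smoothCount_eq_iterated]
  have hnn : ∀ n₁ n₂ n₃ : ℕ, 0 ≤ ∑ n₄ ∈ dyadicRange X,
      primeWeight n₄ * w ((powSum c (n₁, n₂, n₃, n₄) - R) / (R / log X ^ 53)) := fun n₁ n₂ n₃ =>
    Finset.sum_nonneg fun n _ => mul_nonneg (primeWeight_nonneg n) (hwn _)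
  have hnn2 : ∀ n₁ n₂ : ℕ, 0 ≤ ∑ n₃ ∈ dyadicRange X, primeWeight n₃ * ∑ n₄ ∈ dyadicRange X,
      primeWeight n₄ * w ((powSum c (n₁, n₂, n₃, n₄) - R) / (R / log X ^ 53)) := fun n₁ n₂ =>
    Finset.sum_nonneg fun n _ => mul_nonneg (primeWeight_nonneg n) (hnn _ _ _)
  have hnn3 : ∀ n₁ : ℕ, 0 ≤ ∑ n₂ ∈ dyadicRange X, primeWeight n₂ * ∑ n₃ ∈ dyadicRange X,
      primeWeight n₃ * ∑ n₄ ∈ dyadicRange X,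
      primeWeight n₄ * w ((powSum c (n₁, n₂, n₃, n₄) - R) / (R / log X ^ 53)) := fun n₁ =>
    Finset.sum_nonneg fun n _ => mul_nonneg (primeWeight_nonneg n) (hnn2 _ _)
  have hV0 : 0 ≤ k₂ / 64 * (X / log X ^ 53) * 1 := by positivity
  have hkX : 0 ≤ k₁ / 160 * X := by positivity
  have hmain := mul_le_sum_mul_of_subset hWI primeWeight_nonneg hnn3
    (mul_nonneg hkX (mul_nonneg hkX hV0)) (fun n₁ hn₁ =>
      mul_le_sum_mul_of_subset hWI primeWeight_nonneg (hnn2 n₁) (mul_nonneg hkX hV0) (fun n₂ hn₂ =>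
        mul_le_sum_mul_of_subset hWI primeWeight_nonneg (hnn n₁ n₂) hV0
          (fun n₃ hn₃ => hinner n₁ hn₁ n₂ hn₂ n₃ hn₃) hWsum) hWsum) hWsum
  refine le_trans (le_of_eq ?_) hmain
  ring

lemma card_filter_quads_le_countSol (c η : ℝ) {R : ℝ} (hR : 0 ≤ R) :
    ((quads (R ^ (1 / c))).filter fun q => q.1.Prime ∧ q.2.1.Prime ∧ q.2.2.1.Prime ∧
      q.2.2.2.Prime ∧ |powSum c q - R| < R ^ (-η)).card ≤ countSol c η R 4 := by
  set X := R ^ (1 / c) with hX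
  have hX0 : 0 ≤ X := by positivity
  set F := (quads X).filter fun q => q.1.Prime ∧ q.2.1.Prime ∧ q.2.2.1.Prime ∧
      q.2.2.2.Prime ∧ |powSum c q - R| < R ^ (-η) with hF
  rw [countSol, ← hX]
  have hfin : Finite {p : Fin 4 → ℕ //
      (∀ j, (p j).Prime ∧ X / 8 < (p j : ℝ) ∧ (p j : ℝ) ≤ X) ∧
      |(∑ j, (p j : ℝ) ^ c) - R| < R ^ (-η)} := by
    refine Set.Finite.subset (Set.Finite.pi' fun _ : Fin 4 => Set.finite_Iic ⌊X⌋₊) fun p hp j => ?_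
    exact Nat.le_floor (hp.1 j).2.2
  have hmem : ∀ q : F, (∀ j, ((![q.1.1, q.1.2.1, q.1.2.2.1, q.1.2.2.2] : Fin 4 → ℕ) j).Prime ∧
      X / 8 < ((![q.1.1, q.1.2.1, q.1.2.2.1, q.1.2.2.2] : Fin 4 → ℕ) j : ℝ) ∧
      ((![q.1.1, q.1.2.1, q.1.2.2.1, q.1.2.2.2] : Fin 4 → ℕ) j : ℝ) ≤ X) ∧
      |(∑ j, ((![q.1.1, q.1.2.1, q.1.2.2.1, q.1.2.2.2] : Fin 4 → ℕ) j : ℝ) ^ c) - R| < R ^ (-η) := by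
    rintro ⟨⟨a, b, d, e⟩, hq⟩
    simp only [hF, quads, dyadicRange, Finset.mem_filter, Finset.mem_product,
      mem_dyadic_range hX0] at hq
    obtain ⟨⟨ha, hb, hd, he⟩, pa, pb, pd, pe, hs⟩ := hq
    refine ⟨fun j => ?_, ?_⟩
    · fin_cases j
      · exact ⟨pa, ha⟩
      · exact ⟨pb, hb⟩
      · exact ⟨pd, hd⟩
      · exact ⟨pe, he⟩
    · simp only [powSum] at hs
      simpa [Fin.sum_univ_four, add_assoc] using hs
  rw [← Nat.card_eq_finsetCard F]
  refine Nat.card_le_card_of_injective (fun q : F => ⟨_, hmem q⟩) fun q r hqr => ?_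
  have h := Subtype.ext_iff.1 hqr
  have h0 := congrFun h 0
  have h1 := congrFun h 1
  have h2 := congrFun h 2
  have h3 := congrFun h 3
  exact Subtype.ext (Prod.ext h0 (Prod.ext h1 (Prod.ext h2 h3)))

lemma smoothCount_le_countSol {w : ℝ → ℝ} (hwo : ∀ t, w t ≤ 1) (hw0 : ∀ t, 1 ≤ |t| → w t = 0)
    (c η : ℝ) {R : ℝ} (hR : 0 < R) (hX : 1 ≤ R ^ (1 / c)) :
    smoothCount w c (R ^ (1 / c)) R (R ^ (-η)) ≤
      log (R ^ (1 / c)) ^ 4 * (countSol c η R 4 : ℝ) := by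
  have hcard := card_filter_quads_le_countSol c η hR.le
  set X := R ^ (1 / c)
  have hl : 0 ≤ log X := Real.log_nonneg hX
  have hδ : 0 < R ^ (-η) := by positivity
  set F := (quads X).filter fun q => q.1.Prime ∧ q.2.1.Prime ∧ q.2.2.1.Prime ∧
      q.2.2.2.Prime ∧ |powSum c q - R| < R ^ (-η) with hF
  have h1 : smoothCount w c X R (R ^ (-η)) ≤ ∑ q ∈ F, log X ^ 4 := by
    rw [smoothCount, hF, Finset.sum_filter]
    refine Finset.sum_le_sum fun q hq => ?_
    split_ifs with hcond
    · simp only [quads, Finset.mem_product] at hq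
      obtain ⟨ha, hb, hd, he⟩ := hq
      have hp := fun n => primeWeight_nonneg n
      have ha' := primeWeight_le_of_mem hX ha
      have hb' := primeWeight_le_of_mem hX hb
      have hd' := primeWeight_le_of_mem hX hd
      have he' := primeWeight_le_of_mem hX he
      calc quadWeight q * w ((powSum c q - R) / R ^ (-η)) ≤ quadWeight q * 1 :=
            mul_le_mul_of_nonneg_left (hwo _) (quadWeight_nonneg q)
        _ = quadWeight q := mul_one _
        _ ≤ log X * (log X * (log X * log X)) := by
            unfold quadWeight
            refine mul_le_mul ha' (mul_le_mul hb' (mul_le_mul hd' he' (hp _) hl) ?_ hl) ?_ hl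
            · exact mul_nonneg (hp _) (hp _)
            · exact mul_nonneg (hp _) (mul_nonneg (hp _) (hp _))
        _ = log X ^ 4 := by ring
    · by_cases hs : |powSum c q - R| < R ^ (-η)
      · have : quadWeight q = 0 := by
          unfold quadWeight primeWeight
          by_contra hne
          refine hcond ⟨?_, ?_, ?_, ?_, hs⟩ <;> by_contra hnp <;> simp [hnp] at hne
        rw [this, zero_mul]
      · rw [hw0 _ (by rw [abs_div, abs_of_pos hδ, one_le_div hδ]; exact not_lt.1 hs), mul_zero]
  refine h1.trans ?_
  rw [Finset.sum_const, nsmul_eq_mul, mul_comm]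
  gcongr

end PrimePowerSums

open PrimePowerSums in
theorem baker_thm3 (c : ℝ) (hc1 : 1 < c) (hc2 : c < 39/29) (hc3 : ∀ n : ℕ, c ≠ n) :
    ∃ η₀ > 0, ∀ η : ℝ, 0 < η → η ≤ η₀ →
    ∃ c₀ > 0, ∃ R₀ : ℝ, ∀ R : ℝ, R₀ ≤ R →
      c₀ * R ^ (4/c - 1 - η) / (Real.log R) ^ 4 ≤ (countSol c η R 4 : ℝ) := by
  refine ⟨1 / 4000, by norm_num, fun η hη0 hη1 => ?_⟩
  obtain ⟨w, g, hwn, hwo, hw1, hw0, hg, hgd, hgi, hgL, hw⟩ := exists_smooth_cutoff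
  obtain ⟨C, hC, X₁, hcmp⟩ := exists_smoothCount_comparison hc1 hc2 hg (by simpa using hgi 0) hgd hgL hw
  obtain ⟨c₂, hc₂, X₂, hlow⟩ := exists_smoothCount_ge hc1 (by linarith) hwn hw1
  have hc0 : 0 < c := by linarith
  set X₀ := max (max (max X₁ X₂) 8) (exp (2 * C / c₂)) with hX₀
  refine ⟨c₂ / 2, by positivity, X₀ ^ c, fun R hR => ?_⟩
  have hX₀8 : 8 ≤ X₀ := le_trans (le_max_right _ _) (le_max_left _ _)
  have hX₀0 : 0 < X₀ := by linarith
  have hR0 : 0 < R := lt_of_lt_of_le (by positivity) hR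
  have hcount := smoothCount_le_countSol hwo hw0 c η hR0
  set X := R ^ (1 / c) with hX
  have hXX : X₀ ≤ X := by
    have := Real.rpow_le_rpow (by positivity) hR (show 0 ≤ 1 / c by positivity)
    rwa [← Real.rpow_mul hX₀0.le, mul_one_div_cancel hc0.ne', Real.rpow_one] at this
  have hX8 : 8 ≤ X := hX₀8.trans hXX
  have hX0 : 0 < X := by linarith
  have hXc : X ^ c = R := by
    rw [hX, ← Real.rpow_mul hR0.le, one_div_mul_cancel hc0.ne', Real.rpow_one]
  have hX1 : X₁ ≤ X :=
    le_trans (le_trans (le_trans (le_max_left _ _) (le_max_left _ _)) (le_max_left _ _)) hXX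
  have hX2 : X₂ ≤ X :=
    le_trans (le_trans (le_trans (le_max_right _ _) (le_max_left _ _)) (le_max_left _ _)) hXX
  have hlC : 2 * C / c₂ ≤ log X := by
    rw [Real.le_log_iff_exp_le hX0]; exact (le_max_right _ _).trans hXX
  have hl1 : 1 ≤ log X := one_le_log_of_eight_le hX8
  have hl0 : 0 < log X := by linarith
  have hR1 : 1 ≤ R := by rw [← hXc]; exact Real.one_le_rpow (by linarith) hc0.le
  have hδX : R ^ (-η) = X ^ (-(c * η)) := by
    rw [← hXc, ← Real.rpow_mul hX0.le]; ring_nf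
  have hcη : c * η ≤ 1 / 2000 := by nlinarith
  have hδ1 : X ^ (-(1 / 2000) : ℝ) ≤ R ^ (-η) := by
    rw [hδX]; exact Real.rpow_le_rpow_of_exponent_le (by linarith) (by linarith)
  have hδ2 : R ^ (-η) ≤ 1 := Real.rpow_le_one_of_one_le_of_nonpos hR1 (by linarith)
  have hδ0 : 0 < R ^ (-η) := by positivity
  have h1 := (abs_le.1 (hcmp X hX1 R (R ^ (-η)) hδ1 hδ2)).1
  have h2 := hlow X hX2
  rw [hXc] at h1 h2
  have hcount' := hcount (by linarith)
  set N := smoothCount w c X R (R ^ (-η))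
  set N' := smoothCount w c X R (R / log X ^ 53)
  have hXs : X ^ 4 = X ^ (4 - c) * R := by
    rw [← hXc, ← Real.rpow_add hX0, ← Real.rpow_natCast]; norm_num
  have h3 : c₂ * X ^ (4 - c) ≤ N' / (R / log X ^ 53) := by
    rw [le_div_iff₀ (by positivity)]
    refine le_trans (le_of_eq ?_) h2
    rw [hXs]; ring
  have h4 : C * (X ^ (4 - c) / log X) ≤ c₂ / 2 * X ^ (4 - c) := by
    rw [div_le_iff₀ hc₂] at hlC
    rw [mul_div_assoc', div_le_iff₀ hl0]
    have : C ≤ c₂ / 2 * log X := by linarith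
    calc C * X ^ (4 - c) ≤ c₂ / 2 * log X * X ^ (4 - c) := by gcongr
      _ = _ := by ring
  have h5 : c₂ / 2 * X ^ (4 - c) ≤ N / R ^ (-η) := by linarith
  rw [le_div_iff₀ hδ0] at h5
  have hpow : X ^ (4 - c) * R ^ (-η) = R ^ (4 / c - 1 - η) := by
    rw [hX, ← Real.rpow_mul hR0.le, ← Real.rpow_add hR0]
    congr 1
    field_simp
    ring
  have hlogR : log X ≤ log R := by
    rw [← hXc, Real.log_rpow hX0]
    nlinarith
  have hlR0 : 0 < log R := by linarith
  rw [div_le_iff₀ (by positivity), ← hpow, ← mul_assoc]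
  calc c₂ / 2 * X ^ (4 - c) * R ^ (-η) ≤ N := h5
    _ ≤ log X ^ 4 * (countSol c η R 4 : ℝ) := hcount'
    _ ≤ log R ^ 4 * (countSol c η R 4 : ℝ) := by gcongr
    _ = _ := mul_comm _ _
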